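/- If E is an elliptic curve over ℚ without complex multiplication and p > 37 is a prime such that the image of ρ_{E,p} is contained (up to conjugacy) in the normaliser C_ns⁺(p) of a non-split Cartan subgroup of GL₂(F_p), then either v_p(j(E)) = 0 or v_p(j(E)) ≥ 3. -/

import Mathlib

/-!
Setup: the mod-`p` Galois representation attached to an elliptic curve over `ℚ`,
the non-split Cartan subgroup and related subgroups of `GL₂(𝔽_p)`.
-/

open WeierstrassCurve WeierstrassCurve.Affine Matrix

noncomputable section

/-- A fixed algebraic closure `ℚ̄` of `ℚ`. -/
abbrev Qbar : Type := AlgebraicClosure ℚ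

/-- The thirteen rational CM `j`-invariants.  An elliptic curve over `ℚ` has complex
multiplication (equivalently, its geometric endomorphism ring is strictly larger than `ℤ`)
if and only if its `j`-invariant belongs to this set; thus `E.j ∉ CMjInvariants` expresses
that `E` is a non-CM elliptic curve over `ℚ`. -/
def CMjInvariants : Set ℚ :=
  {0, 1728, -3375, 8000, 54000, -32768, 287496, -884736, -12288000, 16581375, -884736000,
    -147197952000, -262537412640768000}

variable (E : WeierstrassCurve ℚ)

open scoped Classical in
/-- The action of `σ ∈ Gal(ℚ̄/ℚ)` on the group `E(ℚ̄)` of `ℚ̄`-points of `E`. -/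
def galAct (σ : Qbar ≃ₐ[ℚ] Qbar) : (E⁄Qbar).Point →+ (E⁄Qbar).Point :=
  Point.map (W' := E) σ.toAlgHom

open scoped Classical in
/-- The subgroup `E[p] ⊆ E(ℚ̄)` of `p`-torsion points. -/
def pTorsion (p : ℕ) : AddSubgroup ((E⁄Qbar).Point) where
  carrier := {P | p • P = 0}
  zero_mem' := smul_zero p
  add_mem' := fun {a b} ha hb => by
    have h : p • (a + b) = p • a + p • b := smul_add p a b
    simp only [Set.mem_setOf_eq] at *
    rw [h, ha, hb, add_zero]
  neg_mem' := fun {a} ha => by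
    have h : p • (-a) = -(p • a) := smul_neg p a
    simp only [Set.mem_setOf_eq] at *
    rw [h, ha, neg_zero]

/-- `ρ` *is* the mod-`p` Galois representation `ρ_{E,p}` of `E`, written in some `𝔽_p`-basis of
`E[p]`: there is an additive (equivalently, `𝔽_p`-linear) isomorphism `e : E[p] ≃ 𝔽_p²` through
which the Galois action on `E[p]` corresponds to the matrix action of `ρ`. -/
def IsModPRep (p : ℕ) (ρ : (Qbar ≃ₐ[ℚ] Qbar) →* GL (Fin 2) (ZMod p)) : Prop :=
  ∃ e : pTorsion E p ≃+ (Fin 2 → ZMod p),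
    ∀ (σ : Qbar ≃ₐ[ℚ] Qbar) (P : pTorsion E p) (hP : galAct E σ P.1 ∈ pTorsion E p),
      e ⟨galAct E σ P.1, hP⟩ = Matrix.mulVec (ρ σ : Matrix (Fin 2) (Fin 2) (ZMod p)) (e P)

/-- The least positive integer which is a quadratic non-residue modulo `p`. -/
def leastNonResidue (p : ℕ) : ℕ :=
  sInf {n : ℕ | 0 < n ∧ ¬∃ x : ZMod p, x ^ 2 = (n : ZMod p)}

/-- `ε ∈ 𝔽_p`: the reduction mod `p` of the least positive quadratic non-residue. -/
def nsEps (p : ℕ) : ZMod p := (leastNonResidue p : ZMod p)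

/-- The non-split Cartan subgroup `C_ns(p) ⊆ GL₂(𝔽_p)` (as a set): invertible matrices of the
form `[[a, εb], [b, a]]`.  (Invertibility forces `(a, b) ≠ (0, 0)`.) -/
def Cns (p : ℕ) : Set (GL (Fin 2) (ZMod p)) :=
  {M | ∃ a b : ZMod p, (M : Matrix (Fin 2) (Fin 2) (ZMod p)) = !![a, nsEps p * b; b, a]}

/-- `C_ns⁺(p)`: the normaliser of the non-split Cartan subgroup in `GL₂(𝔽_p)`. -/
def CnsPlus (p : ℕ) : Subgroup (GL (Fin 2) (ZMod p)) :=
  Subgroup.setNormalizer (Cns p)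

/-- The subgroup `G(p) = {a³ : a ∈ C_ns(p)} ∪ {diag(1,-1)·a³ : a ∈ C_ns(p)}` of `GL₂(𝔽_p)`
(as a set). -/
def Gset (p : ℕ) : Set (GL (Fin 2) (ZMod p)) :=
  {M | (∃ a ∈ Cns p, M = a ^ 3) ∨
    ∃ a ∈ Cns p, (M : Matrix (Fin 2) (Fin 2) (ZMod p)) =
      !![1, 0; 0, -1] * ((a : Matrix (Fin 2) (Fin 2) (ZMod p)) ^ 3)}

/-- The image of `ρ` is conjugate in `GL₂(𝔽_p)` to the subset `S`. -/
def ImageConjTo {p : ℕ} (ρ : (Qbar ≃ₐ[ℚ] Qbar) →* GL (Fin 2) (ZMod p))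
    (S : Set (GL (Fin 2) (ZMod p))) : Prop :=
  ∃ g : GL (Fin 2) (ZMod p), Set.range ρ = (fun x => g * x * g⁻¹) '' S

end


/-- Abstract data of a group with coordinates on a short Weierstrass curve. -/
structure WCrv {F : Type*} [Field F] (a b : F) {G : Type*} [AddCommGroup G] (X Y : G → F) :
    Prop where
  two : (2 : F) ≠ 0
  eq : ∀ P, P ≠ 0 → Y P ^ 2 = X P ^ 3 + a * X P + b
  negX : ∀ P, X (-P) = X P
  negY : ∀ P, P ≠ 0 → Y (-P) = - Y P
  add : ∀ P Q, P ≠ 0 → Q ≠ 0 → X P ≠ X Q →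
    X (P + Q) = ((Y P - Y Q) / (X P - X Q)) ^ 2 - X P - X Q
  dblY : ∀ P, P ≠ 0 → P + P ≠ 0 → Y P ≠ 0
  dbl : ∀ P, P ≠ 0 → P + P ≠ 0 → X (P + P) = ((3 * X P ^ 2 + a) / (2 * Y P)) ^ 2 - 2 * X P
  inj : ∀ P Q, P ≠ 0 → Q ≠ 0 → X P = X Q → P = Q ∨ P = -Q

namespace WCrv

variable {F : Type*} [Field F] {a b : F} {G : Type*} [AddCommGroup G] {X Y : G → F}

theorem sub (h : WCrv a b X Y) (P Q : G) (hP : P ≠ 0) (hQ : Q ≠ 0) (hne : X P ≠ X Q) :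
    X (P - Q) = ((Y P + Y Q) / (X P - X Q)) ^ 2 - X P - X Q := by
  rw [sub_eq_add_neg, h.add P (-Q) hP (neg_ne_zero.2 hQ) (by rwa [h.negX]), h.negX, h.negY Q hQ,
    sub_neg_eq_add]

/-- the symmetric form -/
def BB (a b q r t : F) : F := (q * r - a) ^ 2 - 4 * b * (q + r)
    - 2 * t * ((q * r + a) * (q + r) + 2 * b) + t ^ 2 * (q - r) ^ 2

theorem BB_eq (h : WCrv a b X Y) (P Q : G) (hP : P ≠ 0) (hQ : Q ≠ 0) (hne : X P ≠ X Q) (t : F) :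
    (X (P + Q) - t) * (X (P - Q) - t) * (X P - X Q) ^ 2 = BB a b (X P) (X Q) t := by
  rw [h.add P Q hP hQ hne, h.sub P Q hP hQ hne]
  have e1 := h.eq P hP
  have e2 := h.eq Q hQ
  have hd : X P - X Q ≠ 0 := sub_ne_zero.2 hne
  generalize X P = q at *
  generalize X Q = r at *
  generalize Y P = y at *
  generalize Y Q = z at *
  have : ((y - z) / (q - r)) ^ 2 = (y - z) ^ 2 / (q - r) ^ 2 := by rw [div_pow]
  have h2 : ((y + z) / (q - r)) ^ 2 = (y + z) ^ 2 / (q - r) ^ 2 := by rw [div_pow]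
  rw [this, h2]
  have hd2 : (q - r) ^ 2 ≠ 0 := pow_ne_zero _ hd
  have key : ((y - z) ^ 2 - (q + r + t) * (q - r) ^ 2) * ((y + z) ^ 2 - (q + r + t) * (q - r) ^ 2)
     = BB a b q r t * (q - r) ^ 2 := by
    have : ((y - z) ^ 2 - (q + r + t) * (q - r) ^ 2) * ((y + z) ^ 2 - (q + r + t) * (q - r) ^ 2)
      = (y ^ 2 - z ^ 2) ^ 2 - 2 * (q + r + t) * (q - r) ^ 2 * (y ^ 2 + z ^ 2)
        + (q + r + t) ^ 2 * (q - r) ^ 4 := by ring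
    rw [this, e1, e2]
    unfold BB; ring
  have : ((y - z) ^ 2 / (q - r) ^ 2 - q - r - t) * ((y + z) ^ 2 / (q - r) ^ 2 - q - r - t)
      * (q - r) ^ 2 = (((y - z) ^ 2 - (q + r + t) * (q - r) ^ 2) *
      ((y + z) ^ 2 - (q + r + t) * (q - r) ^ 2)) / (q - r) ^ 2 := by
    field_simp
    ring
  rw [this, key, mul_div_assoc, div_self hd2, mul_one]

theorem BB_symm (q r t : F) : BB a b q r t = BB a b t r q := by
  unfold BB; ring

theorem BB_dbl (h : WCrv a b X Y) (P : G) (hP : P ≠ 0) (h2P : P + P ≠ 0) (t : F) :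
    BB a b (X P) (X P) t = 4 * Y P ^ 2 * (X (P + P) - t) := by
  have hy := h.dblY P hP h2P
  have h2 := h.two
  rw [h.dbl P hP h2P]
  have e1 := h.eq P hP
  have : 4 * Y P ^ 2 * (((3 * X P ^ 2 + a) / (2 * Y P)) ^ 2 - 2 * X P - t)
    = (3 * X P ^ 2 + a) ^ 2 - 4 * Y P ^ 2 * (2 * X P + t) := by
    field_simp
    ring
  rw [this, e1]; unfold BB; ring

theorem sub_sub_add (h : WCrv a b X Y) (P Q : G) (hP : P ≠ 0) (hQ : Q ≠ 0) (hne : X P ≠ X Q) :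
    (X (P - Q) - X (P + Q)) * (X P - X Q) ^ 2 = 4 * Y P * Y Q := by
  rw [h.add P Q hP hQ hne, h.sub P Q hP hQ hne]
  have hd : X P - X Q ≠ 0 := sub_ne_zero.2 hne
  field_simp
  ring

theorem add_add_sub (h : WCrv a b X Y) (P Q : G) (hP : P ≠ 0) (hQ : Q ≠ 0) (hne : X P ≠ X Q) :
    (X (P + Q) + X (P - Q)) * (X P - X Q) ^ 2 =
      2 * ((X P * X Q + a) * (X P + X Q) + 2 * b) := by
  rw [h.add P Q hP hQ hne, h.sub P Q hP hQ hne]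
  have hd : X P - X Q ≠ 0 := sub_ne_zero.2 hne
  have e1 := h.eq P hP
  have e2 := h.eq Q hQ
  have : (((Y P - Y Q) / (X P - X Q)) ^ 2 - X P - X Q +
      (((Y P + Y Q) / (X P - X Q)) ^ 2 - X P - X Q)) * (X P - X Q) ^ 2
      = 2 * (Y P ^ 2 + Y Q ^ 2) - 2 * (X P + X Q) * (X P - X Q) ^ 2 := by
      field_simp; ring
  rw [this, e1, e2]; ring

/-- elliptic recurrences for a sequence -/
structure Rec (a b x y : F) (u : ℕ → F) : Prop where
  u0 : u 0 = 0
  u1 : u 1 = 1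
  u2 : u 2 = 2 * y
  u3 : u 3 = 3 * x ^ 4 + 6 * a * x ^ 2 + 12 * b * x - a ^ 2
  u4 : u 4 = 2 * y * (2 * (x ^ 6 + 5 * a * x ^ 4 + 20 * b * x ^ 3 - 5 * a ^ 2 * x ^ 2
      - 4 * a * b * x - 8 * b ^ 2 - a ^ 3))
  odd : ∀ m, u (2 * m + 5) = u (m + 4) * u (m + 2) ^ 3 - u (m + 1) * u (m + 3) ^ 3
  even : ∀ m, u (2 * m + 4) * u 2 =
    u (m + 2) * (u (m + 4) * u (m + 1) ^ 2 - u m * u (m + 3) ^ 2)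

theorem xne (h : WCrv a b X Y) (P : G) {m n : ℕ} (hn : 1 ≤ n) (hnm : n < m)
    (hk : ∀ k, 1 ≤ k → k ≤ m + n → k • P ≠ 0) : X (m • P) ≠ X (n • P) := by
  intro he
  rcases h.inj _ _ (hk m (by omega) (by omega)) (hk n hn (by omega)) he with h1 | h1
  · apply hk (m - n) (by omega) (by omega)
    have : (m - n) • P + n • P = n • P := by rw [← add_smul, Nat.sub_add_cancel hnm.le, h1]
    simpa using this
  · apply hk (m + n) (by omega) le_rfl
    rw [add_smul, h1]; simp

theorem base3 (h : WCrv a b X Y) (P : G) (hP : P ≠ 0) (h2 : P + P ≠ 0) :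
    (X (P + P) - X P) * (2 * Y P) ^ 2 =
    -(3 * X P ^ 4 + 6 * a * X P ^ 2 + 12 * b * X P - a ^ 2) := by
  have := h.BB_dbl P hP h2 (X P)
  unfold BB at this
  linear_combination -this

theorem base4 (h : WCrv a b X Y) (P : G) (hP : P ≠ 0) (h2 : P + P ≠ 0) (hne : X (P + P) ≠ X P) :
    (X (P + P + P) - X P) * (3 * X P ^ 4 + 6 * a * X P ^ 2 + 12 * b * X P - a ^ 2) ^ 2 =
    - (2 * Y P) ^ 2 * (2 * (X P ^ 6 + 5 * a * X P ^ 4 + 20 * b * X P ^ 3 - 5 * a ^ 2 * X P ^ 2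
      - 4 * a * b * X P - 8 * b ^ 2 - a ^ 3)) := by
  have h3 := h.base3 P hP h2
  have e1 := h.eq P hP
  have hd : X (P + P) - X P ≠ 0 := sub_ne_zero.2 hne
  have hy := h.dblY P hP h2
  have hsum := h.add_add_sub (P + P) P h2 hP hne
  rw [add_sub_cancel_right] at hsum
  generalize X (P + P + P) = z at *
  generalize X (P + P) = q at *
  generalize X P = x at *
  generalize Y P = y at *
  have hy4 : (2 * y) ^ 4 ≠ 0 := pow_ne_zero _ (mul_ne_zero h.two hy)
  have hq : q * (2 * y) ^ 2 = x * (2 * y) ^ 2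
     - (3 * x ^ 4 + 6 * a * x ^ 2 + 12 * b * x - a ^ 2) := by linear_combination h3
  have hf : (2 * y) ^ 2 = 4 * (x ^ 3 + a * x + b) := by rw [mul_pow, e1]; ring
  -- multiply hsum by (2y)^4
  have hm : (z + x) * ((q - x) * (2 * y) ^ 2) ^ 2 =
    2 * ((q * (2 * y) ^ 2 * x + a * (2 * y) ^ 2) * (q * (2 * y) ^ 2 + x * (2 * y) ^ 2)
      + 2 * b * ((2 * y) ^ 2) ^ 2) := by
    linear_combination (2 * y) ^ 4 * hsum
  rw [h3, hq, hf] at hm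
  rw [hf]
  linear_combination hm

/-- The division polynomial identity. -/
theorem eds (h : WCrv a b X Y) (P : G) (u : ℕ → F) (hu : Rec a b (X P) (Y P) u) :
    ∀ s : ℕ, (∀ k, 1 ≤ k → k < s → k • P ≠ 0) →
      (∀ k, 1 ≤ k → k < s → u k ≠ 0) ∧
      (∀ m n, 1 ≤ n → n < m → m + n = s →
        (X (m • P) - X (n • P)) * u m ^ 2 * u n ^ 2 = - (u (m + n) * u (m - n))) := by
  intro s
  induction s using Nat.strong_induction_on with
  | _ s IH =>
  intro hk
  have hP : 1 < s → P ≠ 0 := fun h1 => by simpa using hk 1 le_rfl h1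
  have h2P : 2 < s → P + P ≠ 0 := fun h1 => by simpa [two_smul] using hk 2 (by norm_num) h1
  have hu2 : 2 < s → u 2 ≠ 0 := fun h1 => by
    rw [hu.u2]
    exact mul_ne_zero h.two (h.dblY P (hP (by omega)) (h2P h1))
  have hnz : ∀ k, 1 ≤ k → k < s → u k ≠ 0 := by
    intro k hk1 hks
    rcases Nat.lt_or_ge k 3 with hk3 | hk3
    · interval_cases k
      · rw [hu.u1]; exact one_ne_zero
      · exact hu2 hks
    · obtain ⟨h1, h2⟩ := IH k hks (fun j hj1 hj2 => hk j hj1 (by omega))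
      intro h0
      have h3 := h2 (k - 1) 1 le_rfl (by omega) (by omega)
      rw [show k - 1 + 1 = k by omega, h0, hu.u1] at h3
      have hne : X ((k - 1) • P) ≠ X (1 • P) :=
        h.xne P le_rfl (by omega) (fun j hj1 hj2 => hk j hj1 (by omega))
      have := h1 (k - 1) (by omega) (by omega)
      have h5 := sub_ne_zero.2 hne
      rw [one_smul] at h5
      simp [h5, this] at h3
  refine ⟨hnz, ?_⟩
  -- known smaller identities
  have hS : ∀ m n, 1 ≤ n → n < m → m + n < s →
      (X (m • P) - X (n • P)) * u m ^ 2 * u n ^ 2 = - (u (m + n) * u (m - n)) := by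
    intro m n h1 h2 h3
    exact (IH (m + n) h3 (fun j hj1 hj2 => hk j hj1 (by omega))).2 m n h1 h2 rfl
  have hC : ∀ m, 1 ≤ m → m + 1 < s → (X (m • P) - X P) * u m ^ 2 = - (u (m + 1) * u (m - 1)) := by
    intro m h1 h2
    rcases Nat.eq_or_lt_of_le h1 with rfl | h1
    · simp [hu.u0]
    · have := hS m 1 le_rfl h1 h2
      rw [hu.u1, one_smul] at this
      linear_combination this
  have main : ∀ d m n, d = m - n → 1 ≤ n → n < m → m + n = s →
      (X (m • P) - X (n • P)) * u m ^ 2 * u n ^ 2 = - (u (m + n) * u (m - n)) := by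
    intro d
    induction d using Nat.strong_induction_on with
    | _ d IHd =>
    intro m n hd hn hnm hs
    rcases Nat.lt_or_ge 2 d with hd2 | hd2
    · -- step
      obtain ⟨m, rfl⟩ : ∃ m', m = m' + 1 := ⟨m - 1, by omega⟩
      have g1 := IHd (d - 2) (by omega) m (n + 1) (by omega) (by omega) (by omega) (by omega)
      have cm := hC m (by omega) (by omega)
      rcases Nat.eq_or_lt_of_le hn with rfl | hn1
      · -- n = 1
        have c' := hC (m - 1) (by omega) (by omega)
        have hne : X (m • P) ≠ X P := by
          have := h.xne P (m := m) (n := 1) le_rfl (by omega)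
            (fun k hk1 hk2 => hk k hk1 (by omega))
          simpa using this
        have b1 := h.BB_eq (m • P) P (hk m (by omega) (by omega)) (hP (by omega)) hne (X P)
        rw [BB_symm, h.BB_dbl P (hP (by omega)) (h2P (by omega))] at b1
        have e1 : m • P + P = (m + 1) • P := by rw [add_smul, one_smul]
        have e2 : m • P - P = (m - 1) • P := by
          conv_lhs => rw [show m = (m - 1) + 1 by omega, add_smul, one_smul]
          simp
        rw [e1, e2, ← two_smul ℕ P] at b1
        have n1 := hnz (m - 2) (by omega) (by omega)
        have n2 := hnz m (by omega) (by omega)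
        rw [show m - 1 + 1 = m by omega, show m - 1 - 1 = m - 2 by omega] at c'
        rw [show m + (1 + 1) = m + 2 by omega, show m - (1 + 1) = m - 2 by omega,
          show 1 + 1 = 2 from rfl, hu.u2] at g1
        rw [one_smul, hu.u1, show m + 1 + 1 = m + 2 by omega, Nat.add_sub_cancel]
        apply mul_right_cancel₀ (mul_ne_zero n1 n2)
        have k1 : (X (m • P) - X P) ^ 2 * u m ^ 4 = u (m + 1) ^ 2 * u (m - 1) ^ 2 := by
          linear_combination ((X (m • P) - X P) * u m ^ 2 - u (m + 1) * u (m - 1)) * cm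
        linear_combination -u m ^ 4 * b1 + u m ^ 2 * g1
          + (X ((m + 1) • P) - X P) * (X ((m - 1) • P) - X P) * k1
          + (X ((m + 1) • P) - X P) * u (m + 1) ^ 2 * c'
      · have cn := hC n (by omega) (by omega)
        have g2 := hS m (n - 1) (by omega) (by omega) (by omega)
        have g3 := hS (m - 1) n (by omega) (by omega) (by omega)
        have hne : X (m • P) ≠ X P := by
          have := h.xne P (m := m) (n := 1) le_rfl (by omega)
            (fun k hk1 hk2 => hk k hk1 (by omega))
          simpa using this
        have hne' : X (n • P) ≠ X P := by
          have := h.xne P (m := n) (n := 1) le_rfl (by omega)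
            (fun k hk1 hk2 => hk k hk1 (by omega))
          simpa using this
        have b1 := h.BB_eq (m • P) P (hk m (by omega) (by omega)) (hP (by omega)) hne (X (n • P))
        have b2 := h.BB_eq (n • P) P (hk n (by omega) (by omega)) (hP (by omega)) hne' (X (m • P))
        rw [BB_symm] at b1
        rw [← b2] at b1
        have e1 : ∀ m : ℕ, m • P + P = (m + 1) • P := fun m => by rw [add_smul, one_smul]
        have e2 : ∀ m : ℕ, 1 ≤ m →  m • P - P = (m - 1) • P := by
          intro m hm
          conv_lhs => rw [show m = (m - 1) + 1 by omega, add_smul, one_smul]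
          simp
        rw [e1, e1, e2 m (by omega), e2 n (by omega)] at b1
        have n1 := hnz (m - 1 - n) (by omega) (by omega)
        have n2 := hnz (m - 1 + n) (by omega) (by omega)
        have n3 := hnz n (by omega) (by omega)
        rw [show m + (n + 1) = m + 1 + n by omega, show m - (n + 1) = m - 1 - n by omega] at g1
        rw [show m + (n - 1) = m - 1 + n by omega, show m - (n - 1) = m + 1 - n by omega] at g2
        apply mul_right_cancel₀ (mul_ne_zero n1 n2)
        have k1 : (X (m • P) - X P) ^ 2 * u m ^ 4 = u (m + 1) ^ 2 * u (m - 1) ^ 2 := by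
          linear_combination ((X (m • P) - X P) * u m ^ 2 - u (m + 1) * u (m - 1)) * cm
        have k2 : (X (n • P) - X P) ^ 2 * u n ^ 4 = u (n + 1) ^ 2 * u (n - 1) ^ 2 := by
          linear_combination ((X (n • P) - X P) * u n ^ 2 - u (n + 1) * u (n - 1)) * cn
        have k3 : (X (m • P) - X ((n + 1) • P)) * (X (m • P) - X ((n - 1) • P)) *
          u m ^ 4 * u (n + 1) ^ 2 * u (n - 1) ^ 2 = u (m + 1 + n) * u (m - 1 - n) *
            (u (m - 1 + n) * u (m + 1 - n)) := by
          linear_combination (X (m • P) - X ((n - 1) • P)) * u m ^ 2 * u (n - 1) ^ 2 * g1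
            - (u (m + 1 + n) * u (m - 1 - n)) * g2
        linear_combination (X ((m + 1) • P) - X (n • P)) * u (m + 1) ^ 2 * u n ^ 2 * g3
          - u m ^ 4 * u n ^ 4 * b1 - k3
          + (X ((m + 1) • P) - X (n • P)) * (X ((m - 1) • P) - X (n • P)) * u n ^ 4 * k1
          - (X (m • P) - X ((n + 1) • P)) * (X (m • P) - X ((n - 1) • P)) * u m ^ 4 * k2
    · -- balanced
      rcases (show m = n + 1 ∨ m = n + 2 by omega) with rfl | rfl
      · rcases Nat.eq_or_lt_of_le hn with rfl | hn1
        · have b3 := h.base3 P (hP (by omega)) (h2P (by omega))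
          simp only [one_smul, hu.u1, Nat.reduceAdd, Nat.reduceSub, hu.u2, hu.u3, two_smul]
          linear_combination b3
        · obtain ⟨k, rfl⟩ : ∃ k, n = k + 2 := ⟨n - 2, by omega⟩
          have c1 := hC (k + 2) (by omega) (by omega)
          have c2 := hC (k + 3) (by omega) (by omega)
          have o := hu.odd k
          rw [show k + 2 + 1 + (k + 2) = 2 * k + 5 by omega,
            show k + 2 + 1 - (k + 2) = 1 by omega, hu.u1, o]
          simp only [show k + 2 - 1 = k + 1 by omega, show k + 3 - 1 = k + 2 by omega,
            show k + 2 + 1 = k + 3 by omega, show k + 3 + 1 = k + 4 by omega] at *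
          linear_combination u (k + 2) ^ 2 * c2 - u (k + 3) ^ 2 * c1
      · rcases Nat.eq_or_lt_of_le hn with rfl | hn1
        · have hne : X (P + P) ≠ X P := by
            have := h.xne P (m := 2) (n := 1) le_rfl (by omega)
              (fun k hk1 hk2 => hk k hk1 (by omega))
            simpa [two_smul] using this
          have b4 := h.base4 P (hP (by omega)) (h2P (by omega)) hne
          have e3 : 3 • P = P + P + P := by rw [show 3 = 2 + 1 from rfl, add_smul, two_smul, one_smul]
          simp only [one_smul, hu.u1, Nat.reduceAdd, Nat.reduceSub, hu.u2, hu.u3, hu.u4, e3]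
          linear_combination b4
        · obtain ⟨k, rfl⟩ : ∃ k, n = k + 1 := ⟨n - 1, by omega⟩
          have c1 := hC (k + 1) (by omega) (by omega)
          have c2 := hC (k + 3) (by omega) (by omega)
          have o := hu.even k
          rw [show k + 1 + 2 + (k + 1) = 2 * k + 4 by omega,
            show k + 1 + 2 - (k + 1) = 2 by omega, o]
          simp only [show k + 1 - 1 = k by omega, show k + 3 - 1 = k + 2 by omega,
            show k + 1 + 2 = k + 3 by omega, show k + 3 + 1 = k + 4 by omega,
            show k + 1 + 1 = k + 2 by omega] at *
          linear_combination u (k + 1) ^ 2 * c2 - u (k + 3) ^ 2 * c1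
  intro m n h1 h2 h3
  exact main _ m n rfl h1 h2 h3

theorem eds_ne (h : WCrv a b X Y) (P : G) (u : ℕ → F) (hu : Rec a b (X P) (Y P) u) (n : ℕ)
    (hn : 1 ≤ n) (hk : ∀ k, 1 ≤ k → k ≤ n → k • P ≠ 0) : u n ≠ 0 :=
  (h.eds P u hu (n + 1) (fun k h1 h2 => hk k h1 (by omega))).1 n hn (by omega)

theorem eds_C (h : WCrv a b X Y) (P : G) (u : ℕ → F) (hu : Rec a b (X P) (Y P) u) (n : ℕ)
    (hn : 1 ≤ n) (hk : ∀ k, 1 ≤ k → k ≤ n → k • P ≠ 0) :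
    (X (n • P) - X P) * u n ^ 2 = - (u (n + 1) * u (n - 1)) := by
  rcases Nat.eq_or_lt_of_le hn with rfl | h1
  · simp [hu.u0]
  · have := (h.eds P u hu (n + 1) (fun k h1 h2 => hk k h1 (by omega))).2 n 1 le_rfl h1 rfl
    rw [hu.u1, one_smul] at this
    linear_combination this

theorem eds_zero (h : WCrv a b X Y) (P : G) (u : ℕ → F) (hu : Rec a b (X P) (Y P) u) (n : ℕ)
    (hn : 3 ≤ n) (hk : ∀ k, 1 ≤ k → k < n → k • P ≠ 0) (h0 : n • P = 0) : u n = 0 := by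
  have h1 := h.eds_C P u hu (n - 1) (by omega) (fun k h1 h2 => hk k h1 (by omega))
  have h2 := h.eds_ne P u hu (n - 2) (by omega) (fun k h1 h2 => hk k h1 (by omega))
  have : (n - 1) • P = -P := by
    rw [eq_neg_iff_add_eq_zero]
    nth_rewrite 2 [← one_smul ℕ P]
    rw [← add_smul, Nat.sub_add_cancel (by omega), h0]
  rw [this, h.negX, sub_self, zero_mul, show n - 1 + 1 = n by omega,
    show n - 1 - 1 = n - 2 by omega] at h1
  have h3 := neg_eq_zero.1 h1.symm
  exact (mul_eq_zero.1 h3).resolve_right h2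

theorem eds_Y (h : WCrv a b X Y) (P : G) (u : ℕ → F) (hu : Rec a b (X P) (Y P) u) (n : ℕ)
    (hn : 2 ≤ n) (hk : ∀ k, 1 ≤ k → k ≤ n + 1 → k • P ≠ 0) :
    4 * Y P * Y (n • P) * u n ^ 3 = u (n + 2) * u (n - 1) ^ 2 - u (n - 2) * u (n + 1) ^ 2 := by
  have c1 := h.eds_C P u hu (n - 1) (by omega) (fun k h1 h2 => hk k h1 (by omega))
  have c2 := h.eds_C P u hu n (by omega) (fun k h1 h2 => hk k h1 (by omega))
  have c3 := h.eds_C P u hu (n + 1) (by omega) (fun k h1 h2 => hk k h1 (by omega))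
  have n1 := h.eds_ne P u hu n (by omega) (fun k h1 h2 => hk k h1 (by omega))
  have hne : X (n • P) ≠ X P := by
    have := h.xne P (m := n) (n := 1) le_rfl (by omega)
      (fun k hk1 hk2 => hk k hk1 (by omega))
    simpa using this
  have hs := h.sub_sub_add (n • P) P (hk n (by omega) (by omega))
    (by simpa using hk 1 le_rfl (by omega)) hne
  have e1 : n • P + P = (n + 1) • P := by rw [add_smul, one_smul]
  have e2 : n • P - P = (n - 1) • P := by
    conv_lhs => rw [show n = (n - 1) + 1 by omega, add_smul, one_smul]
    simp
  rw [e1, e2] at hs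
  rw [show n - 1 + 1 = n by omega, show n - 1 - 1 = n - 2 by omega] at c1
  rw [show n + 1 + 1 = n + 2 by omega, show n + 1 - 1 = n by omega] at c3
  apply mul_right_cancel₀ n1
  have k1 : (X (n • P) - X P) ^ 2 * u n ^ 4 = u (n + 1) ^ 2 * u (n - 1) ^ 2 := by
    linear_combination ((X (n • P) - X P) * u n ^ 2 - u (n + 1) * u (n - 1)) * c2
  linear_combination - u n ^ 4 * hs + (X ((n - 1) • P) - X ((n + 1) • P)) * k1
    + u (n + 1) ^ 2 * c1 - u (n - 1) ^ 2 * c3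

end WCrv


/-- short Weierstrass curve -/
def sW {R : Type*} [CommRing R] (a b : R) : WeierstrassCurve R := ⟨0, 0, 0, a, b⟩

namespace sW
open Polynomial

section ring
variable {R : Type*} [CommRing R] (a b : R)

theorem eval_two (x : R) : ((sW a b).Ψ₂Sq).eval x = 4 * (x ^ 3 + a * x + b) := by
  simp [WeierstrassCurve.Ψ₂Sq, sW, WeierstrassCurve.b₂, WeierstrassCurve.b₄, WeierstrassCurve.b₆]
  ring

theorem eval_three (x : R) : ((sW a b).Ψ₃).eval x =
    3 * x ^ 4 + 6 * a * x ^ 2 + 12 * b * x - a ^ 2 := by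
  simp [WeierstrassCurve.Ψ₃, sW, WeierstrassCurve.b₂, WeierstrassCurve.b₄, WeierstrassCurve.b₆,
    WeierstrassCurve.b₈]
  ring

theorem eval_four (x : R) : ((sW a b).preΨ₄).eval x =
    2 * (x ^ 6 + 5 * a * x ^ 4 + 20 * b * x ^ 3 - 5 * a ^ 2 * x ^ 2
      - 4 * a * b * x - 8 * b ^ 2 - a ^ 3) := by
  simp [WeierstrassCurve.preΨ₄, sW, WeierstrassCurve.b₂, WeierstrassCurve.b₄, WeierstrassCurve.b₆,
    WeierstrassCurve.b₈]
  ring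

end ring

variable {F : Type*} [Field F] (a b : F)

/-- values of the division polynomials -/
noncomputable def u (x y : F) (n : ℕ) : F :=
  ((sW a b).preΨ' n).eval x * (if Even n then 2 * y else 1)

theorem rec (x y : F) (h : y ^ 2 = x ^ 3 + a * x + b) : WCrv.Rec a b x y (u a b x y) where
  u0 := by simp [u]
  u1 := by simp [u]
  u2 := by simp [u]
  u3 := by simp [u, eval_three, show ¬ Even 3 by decide]
  u4 := by simp [u, eval_four, show Even 4 by decide]; ring
  odd := by
    intro m
    have h4 : ((sW a b).Ψ₂Sq).eval x = (2 * y) ^ 2 := by rw [eval_two, mul_pow, h]; ring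
    have := congrArg (Polynomial.eval x) ((sW a b).preΨ'_odd m)
    rw [show 2 * (m + 2) + 1 = 2 * m + 5 by ring] at this
    by_cases hm : Even m
    · simp only [hm, if_true, eval_sub, eval_mul, eval_pow, eval_one, h4] at this
      simp only [u, this, Nat.even_add, hm, show ¬ Even 5 by decide, show Even 4 by decide,
        show ¬ Even 1 by decide, show ¬ Even 3 by decide, even_two, even_two_mul, if_true, if_false,
        iff_true, iff_false, not_true, not_false_iff]
      ring
    · simp only [hm, if_false, eval_sub, eval_mul, eval_pow, eval_one, h4] at this
      simp only [u, this, Nat.even_add, hm, show ¬ Even 5 by decide, show Even 4 by decide,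
        show ¬ Even 1 by decide, show ¬ Even 3 by decide, even_two, even_two_mul, if_true, if_false,
        iff_true, iff_false, not_true, not_false_iff]
      ring
  even := by
    intro m
    rcases m with _ | m
    · simp [u, show Even 4 by decide]; ring
    have := congrArg (Polynomial.eval x) ((sW a b).preΨ'_even m)
    rw [show 2 * (m + 3) = 2 * (m + 1) + 4 by ring] at this
    simp only [eval_sub, eval_mul, eval_pow] at this
    simp only [show m + 1 + 2 = m + 3 by ring, show m + 1 + 4 = m + 5 by ring,
      show m + 1 + 1 = m + 2 by ring, show m + 1 + 3 = m + 4 by ring]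
    have e2 : Even (2 * (m + 1) + 4) := ⟨m + 3, by ring⟩
    by_cases hm : Even m
    · simp only [u, this, e2, preΨ'_two, eval_one, Nat.even_add, hm, show ¬ Even 5 by decide, show Even 4 by decide,
        show ¬ Even 1 by decide, show ¬ Even 3 by decide, even_two, even_two_mul, if_true, if_false,
        iff_true, iff_false, not_true, not_false_iff]
      ring
    · simp only [u, this, e2, preΨ'_two, eval_one, Nat.even_add, hm, show ¬ Even 5 by decide, show Even 4 by decide,
        show ¬ Even 1 by decide, show ¬ Even 3 by decide, even_two, even_two_mul, if_true, if_false,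
        iff_true, iff_false, not_true, not_false_iff]
      ring

variable {a b} {G : Type*} [AddCommGroup G] {X Y : G → F}

theorem torsion_root (h : WCrv a b X Y) {p : ℕ} (hp : p.Prime) (hp3 : 3 ≤ p) (P : G) (hP : P ≠ 0)
    (h0 : p • P = 0) : ((sW a b).preΨ' p).eval (X P) = 0 := by
  haveI := Fact.mk hp
  have ho : addOrderOf P = p := addOrderOf_eq_prime h0 hP
  have := h.eds_zero P _ (rec a b (X P) (Y P) (h.eq P hP)) p hp3 (fun k h1 h2 => by
    intro hk
    have := addOrderOf_dvd_of_nsmul_eq_zero hk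
    rw [ho] at this
    exact absurd (Nat.le_of_dvd h1 this) (by omega)) h0
  have hodd : ¬ Even p := by
    intro he
    have := (Nat.Prime.even_iff hp).1 he
    omega
  simpa [u, hodd] using this

/-- the polynomial giving the `y`-coordinate of multiplication by `n` for odd `n` -/
noncomputable def omg {R : Type*} [CommRing R] (a b : R) (n : ℕ) : R[X] :=
  (sW a b).preΨ' (n + 2) * (sW a b).preΨ' (n - 1) ^ 2
    - (sW a b).preΨ' (n - 2) * (sW a b).preΨ' (n + 1) ^ 2

theorem curve_identity_eval (h : WCrv a b X Y) {n : ℕ} (hn3 : 3 ≤ n) (hodd : Odd n) (P : G)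
    (hk : ∀ k, 1 ≤ k → k ≤ n + 1 → k • P ≠ 0) :
    ((X P) ^ 3 + a * X P + b) * ((omg a b n).eval (X P)) ^ 2 =
      (((sW a b).Φ n).eval (X P)) ^ 3
      + a * ((sW a b).Φ n).eval (X P) * (((sW a b).preΨ' n).eval (X P)) ^ 4
      + b * (((sW a b).preΨ' n).eval (X P)) ^ 6 := by
  have hP : P ≠ 0 := by simpa using hk 1 le_rfl (by omega)
  have e := h.eq P hP
  have hr := rec a b (X P) (Y P) e
  have hY := h.eds_Y P _ hr n (by omega) hk
  have hC := h.eds_C P _ hr n (by omega) (fun k h1 h2 => hk k h1 (by omega))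
  have hn := h.eds_ne P _ hr n (by omega) (fun k h1 h2 => hk k h1 (by omega))
  have hy : Y P ≠ 0 := h.dblY P hP (by simpa [two_smul] using hk 2 (by omega) (by omega))
  have he := h.eq (n • P) (hk n (by omega) (by omega))
  obtain ⟨k, rfl⟩ : ∃ k, n = k + 1 := ⟨n - 1, by omega⟩
  have hke : Even k := by rw [Nat.odd_add_one, Nat.not_odd_iff_even] at hodd; exact hodd
  have f0 : ¬ Even (k + 1) := by simpa using hodd
  have f1 : Even (k + 1 + 1) := by rw [Nat.even_add_one]; exact f0
  have f2 : ¬ Even (k + 1 + 2) := by rw [Nat.even_add]; simp [f0]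
  have f3 : ¬ Even (k + 1 - 2) := by
    obtain ⟨j, rfl⟩ : ∃ j, k = j + 2 := ⟨k - 2, by omega⟩
    rw [show j + 2 + 1 - 2 = j + 1 by omega]
    rw [show j + 2 + 1 = j + 1 + 2 by omega, Nat.even_add] at f0; simpa using f0
  have hΦ : ((sW a b).Φ ((k + 1 : ℕ) : ℤ)).eval (X P) =
      X P * u a b (X P) (Y P) (k + 1) ^ 2
       - u a b (X P) (Y P) (k + 1 + 1) * u a b (X P) (Y P) k := by
    push_cast
    rw [Φ_ofNat]
    simp only [u, f0, f1, hke, if_true, if_false, eval_sub, eval_mul, eval_pow, eval_X, eval_one,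
      eval_two, ← e]
    ring
  rw [Nat.add_sub_cancel] at hC hY
  have hw : Y (( k + 1) • P) * u a b (X P) (Y P) (k + 1) ^ 3 = Y P * (omg a b (k + 1)).eval (X P) := by
    have h4 : (4 * Y P) ≠ 0 := mul_ne_zero (by
      rw [show (4 : F) = 2 * 2 by norm_num]; exact mul_ne_zero h.two h.two) hy
    apply mul_left_cancel₀ h4
    rw [← mul_assoc, hY]
    simp only [omg, u, f0, f1, f2, f3, hke, if_true, if_false, eval_sub, eval_mul, eval_pow,
      Nat.add_sub_cancel]
    ring
  have hx : ((sW a b).Φ ((k + 1 : ℕ) : ℤ)).eval (X P) =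
      X ((k + 1) • P) * u a b (X P) (Y P) (k + 1) ^ 2 := by
    rw [hΦ]; linear_combination -hC
  have hu : ((sW a b).preΨ' (k + 1)).eval (X P) = u a b (X P) (Y P) (k + 1) := by
    simp [u, f0]
  rw [hx, hu, ← e]
  generalize u a b (X P) (Y P) (k + 1) = U at *
  calc Y P ^ 2 * (omg a b (k + 1)).eval (X P) ^ 2
      = (Y ((k + 1) • P) * U ^ 3) ^ 2 := by rw [hw]; ring
    _ = _ := by rw [mul_pow, he]; ring

theorem curve_identity [CharZero F] (h : WCrv a b X Y) (hinf : (Set.range X).Infinite)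
    {n : ℕ} (hn3 : 3 ≤ n) (hodd : Odd n) :
    (Polynomial.X ^ 3 + C a * Polynomial.X + C b) * (omg a b n) ^ 2 =
      ((sW a b).Φ n) ^ 3 + C a * (sW a b).Φ n * ((sW a b).preΨ' n) ^ 4
      + C b * ((sW a b).preΨ' n) ^ 6 := by
  classical
  -- bad polynomial
  let B : F[X] := (∏ k ∈ Finset.Icc 1 (n + 1), (sW a b).preΨ' k) *
     (Polynomial.X ^ 3 + C a * Polynomial.X + C b)
  have hB : B ≠ 0 := by
    apply mul_ne_zero
    · rw [Finset.prod_ne_zero_iff]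
      intro k hk
      apply preΨ'_ne_zero
      have : 1 ≤ k := (Finset.mem_Icc.1 hk).1
      exact_mod_cast (by omega : k ≠ 0)
    · apply Monic.ne_zero
      monicity!
  have hinf2 : (Set.range X \ (↑(B.roots.toFinset ∪ {X 0}) : Set F)).Infinite :=
    hinf.sdiff (Finset.finite_toSet _)
  rw [← sub_eq_zero]
  apply Polynomial.eq_zero_of_infinite_isRoot
  refine hinf2.mono ?_
  rintro x ⟨⟨P, rfl⟩, hx⟩
  have hP : P ≠ 0 := by
    rintro rfl
    apply hx; simp
  have hBx : B.eval (X P) ≠ 0 := by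
    intro h0
    apply hx
    simp [hB, h0]
  simp only [B, eval_mul, eval_prod, eval_add, eval_pow, eval_X, eval_C] at hBx
  have hBy := right_ne_zero_of_mul hBx
  have hBu := left_ne_zero_of_mul hBx
  rw [Finset.prod_ne_zero_iff] at hBu
  have e := h.eq P hP
  rw [← e] at hBy
  have hr := rec a b (X P) (Y P) e
  have key : ∀ k, 1 ≤ k → k ≤ n + 1 → k • P ≠ 0 := by
    intro k
    induction k using Nat.strong_induction_on with
    | _ k IH =>
    intro h1 h2 h0
    rcases Nat.lt_or_ge k 3 with hk3 | hk3
    · interval_cases k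
      · simp at h0; exact hP h0
      · have : P = -P := by rw [two_smul] at h0; exact eq_neg_of_add_eq_zero_left h0
        have h3 := h.negY P hP
        rw [← this] at h3
        have : 2 * Y P = 0 := by linear_combination h3
        rcases mul_eq_zero.1 this with h4 | h4
        · exact h.two h4
        · simp [h4] at hBy
    · have := h.eds_zero P _ hr k hk3 (fun j hj1 hj2 => IH j hj2 hj1 (by omega)) h0
      have h5 := hBu k (Finset.mem_Icc.2 ⟨h1, h2⟩)
      simp only [u, mul_eq_zero, h5, false_or] at this
      split_ifs at this with h6
      · rcases mul_eq_zero.1 this with h4 | h4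
        · exact h.two h4
        · simp [h4] at hBy
      · simp at this
  have := curve_identity_eval h hn3 hodd P key
  show Polynomial.eval _ _ = 0
  simp only [eval_sub, eval_mul, eval_add, eval_pow, eval_X, eval_C]
  rw [this]; ring

end sW


namespace CharPAlg
open Polynomial

variable {R : Type*} [CommRing R] [Nontrivial R]

/-- The cubic. -/
noncomputable def cub (a b : R) : R[X] := X ^ 3 + C a * X + C b

theorem cub_monic (a b : R) : (cub a b).Monic := by unfold cub; monicity!

theorem cub_natDegree (a b : R) : (cub a b).natDegree = 3 := by unfold cub; compute_degree!

theorem cub_deriv (a b : R) : derivative (cub a b) = 3 * X ^ 2 + C a := by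
  have h2 : (C 2 : R[X]) = 2 := rfl
  simp [cub, h2]; ring

theorem cub_coprime (a b : R) (hd : IsUnit (4 * a ^ 3 + 27 * b ^ 2)) :
    IsCoprime (cub a b) (derivative (cub a b)) := by
  obtain ⟨d, hd⟩ := hd.exists_left_inv
  refine ⟨C d * (-18 * C a * X + 27 * C b),
    C d * (6 * C a * X ^ 2 - 9 * C b * X + 4 * C a ^ 2), ?_⟩
  rw [cub_deriv]
  have : C d * (4 * C a ^ 3 + 27 * C b ^ 2) = (1 : R[X]) := by
    rw [← C_1, ← hd]
    rw [C_mul, C_add, C_mul, C_mul, C_pow, C_pow]; rfl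
  rw [← this, cub]; ring

theorem Z1 (a b : R) (hd : IsUnit (4 * a ^ 3 + 27 * b ^ 2)) (f U φ ψ : R[X]) (hU : U.Monic)
    (h : f * U ^ 2 = φ ^ 3 + C a * φ * ψ ^ 4 + C b * ψ ^ 6) (hψ : IsUnit ψ)
    (hφ1 : 1 ≤ φ.natDegree)
    (hdeg : φ.natDegree + ψ.natDegree ≤ U.natDegree) :
    derivative φ * ψ = 2 * φ * derivative ψ := by
  set D := derivative φ * ψ - 2 * φ * derivative ψ with hD
  have h1 : (3 * φ ^ 2 + C a * ψ ^ 4) * D =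
      U * (ψ * (derivative f * U + 2 * f * derivative U) - 6 * derivative ψ * f * U) := by
    have h2 := congrArg derivative h
    simp only [derivative_mul, derivative_add, derivative_pow, derivative_C, zero_mul,
      zero_add, Nat.cast_ofNat, map_ofNat] at h2
    simp only [Nat.add_one_sub_one, pow_one, Nat.reduceSub] at h2
    rw [hD]
    linear_combination (-ψ) * h2 + 6 * derivative ψ * h
  have hcop : IsCoprime U (3 * φ ^ 2 + C a * ψ ^ 4) := by
    obtain ⟨d, hd⟩ := hd.exists_left_inv
    obtain ⟨e, he⟩ := hψ.exists_left_inv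
    have hcd : C d * (4 * C a ^ 3 + 27 * C b ^ 2) = (1 : R[X]) := by
      rw [← C_1, ← hd]
      rw [C_mul, C_add, C_mul, C_mul, C_pow, C_pow]; rfl
    refine ⟨C d * e ^ 8 * ((-18 * C a * φ + 27 * C b * ψ ^ 2) * f * U),
      C d * e ^ 8 * (6 * C a * φ ^ 2 - 9 * C b * φ * ψ ^ 2 + 4 * C a ^ 2 * ψ ^ 4), ?_⟩
    have : C d * e ^ 8 * ((-18 * C a * φ + 27 * C b * ψ ^ 2) * f * U) * U +
      C d * e ^ 8 * (6 * C a * φ ^ 2 - 9 * C b * φ * ψ ^ 2 + 4 * C a ^ 2 * ψ ^ 4) *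
       (3 * φ ^ 2 + C a * ψ ^ 4) = (C d * (4 * C a ^ 3 + 27 * C b ^ 2)) * (e * ψ) ^ 8 := by
      linear_combination C d * e ^ 8 * (-18 * C a * φ + 27 * C b * ψ ^ 2) * h
    rw [this, hcd, he]; ring
  have hdvd : U ∣ D := hcop.dvd_of_dvd_mul_left ⟨_, h1⟩
  rw [← sub_eq_zero, ← hD]
  by_contra h0
  refine hU.not_dvd_of_natDegree_lt h0 ?_ hdvd
  refine lt_of_le_of_lt (natDegree_sub_le _ _) (max_lt ?_ ?_)
  · refine lt_of_le_of_lt natDegree_mul_le ?_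
    have := natDegree_derivative_lt (p := φ) (by omega)
    omega
  · by_cases h3 : ψ.natDegree = 0
    · rw [derivative_of_natDegree_zero h3]; simp; omega
    · refine lt_of_le_of_lt natDegree_mul_le ?_
      have := natDegree_derivative_lt (p := ψ) h3
      have h5 : (2 * φ).natDegree ≤ φ.natDegree := by
        rw [show (2 : R[X]) = C 2 from rfl]; exact natDegree_C_mul_le _ _
      omega

variable (p : ℕ) [hp : Fact p.Prime] [CharP R p]

theorem unit_of (hn : ¬ p ∣ n) : IsUnit ((n : ℕ) : R) := by
  rwa [CharP.isUnit_natCast_iff hp.out]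

theorem Z1' (hp2 : p ≠ 2) (a b : R) (hd : IsUnit (4 * a ^ 3 + 27 * b ^ 2)) (f U φ ψ : R[X]) (hU : U.Monic)
    (h : f * U ^ 2 = φ ^ 3 + C a * φ * ψ ^ 4 + C b * ψ ^ 6) (hψ : IsUnit ψ) (hφ : φ.Monic)
    (hφ1 : 1 ≤ φ.natDegree)
    (hdeg : φ.natDegree + ψ.natDegree ≤ U.natDegree) :
    derivative φ = 0 ∧ derivative ψ = 0 := by
  have h1 := Z1 a b hd f U φ ψ hU h hψ hφ1 hdeg
  have h2 : derivative φ = 0 := by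
    by_contra h0
    refine hφ.not_dvd_of_natDegree_lt h0 (natDegree_derivative_lt (by omega)) ?_
    have : φ ∣ derivative φ * ψ := by rw [h1]; exact ⟨2 * derivative ψ, by ring⟩
    exact (hψ.dvd_mul_right).1 this
  refine ⟨h2, ?_⟩
  rw [h2, zero_mul] at h1
  have h2u : IsUnit (2 : R[X]) := by
    have : IsUnit ((2 : ℕ) : R) := unit_of p (fun h => hp2 ((Nat.prime_dvd_prime_iff_eq hp.out
      Nat.prime_two).1 h))
    have := this.map (C : R →+* R[X])
    rw [map_natCast] at this
    exact_mod_cast this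
  have h3 : φ * (2 * derivative ψ) = 0 := by rw [h1]; ring
  rw [hφ.mul_right_eq_zero_iff] at h3
  exact (h2u.mul_right_eq_zero).1 h3

theorem Z2 (hp2 : p ≠ 2) (f w : R[X]) (hf : f.Monic) (hc : IsCoprime f (derivative f))
    (h : derivative f * w + 2 * f * derivative w = 0) :
    ∃ g, w = f ^ ((p - 1) / 2) * g ∧ derivative g = 0 := by
  have hodd : p % 2 = 1 := (hp.out.eq_two_or_odd).resolve_left hp2
  have key : ∀ i, i ≤ (p - 1) / 2 → ∃ g, w = f ^ i * g ∧
      ((2 * i + 1 : ℕ) : R[X]) * derivative f * g + 2 * f * derivative g = 0 := by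
    intro i
    induction i with
    | zero => intro _; exact ⟨w, by simp, by simpa using h⟩
    | succ i ih =>
      intro hi
      obtain ⟨g, hg, h2⟩ := ih (by omega)
      have hu : IsUnit ((2 * i + 1 : ℕ) : R[X]) := by
        have : IsUnit ((2 * i + 1 : ℕ) : R) := unit_of p
          (fun h => by have := Nat.le_of_dvd (by omega) h; omega)
        have := this.map (C : R →+* R[X])
        rwa [map_natCast] at this
      have : f ∣ derivative f * g := by
        rw [← hu.dvd_mul_left (b := derivative f * g)]
        exact ⟨- (2 * derivative g), by linear_combination h2⟩
      obtain ⟨g', hg'⟩ := hc.dvd_of_dvd_mul_left this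
      refine ⟨g', by rw [hg, hg']; ring, ?_⟩
      have h3 : f * (((2 * (i + 1) + 1 : ℕ) : R[X]) * derivative f * g' + 2 * f * derivative g') = 0 := by
        rw [hg', derivative_mul] at h2
        push_cast at h2 ⊢
        linear_combination h2
      rwa [hf.mul_right_eq_zero_iff] at h3
  obtain ⟨g, hg, h2⟩ := key _ le_rfl
  refine ⟨g, hg, ?_⟩
  rw [show 2 * ((p - 1) / 2) + 1 = p by have := hp.out.two_le; omega, CharP.cast_eq_zero, zero_mul, zero_mul, zero_add] at h2
  have h2u : IsUnit (2 : R[X]) := by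
    have : IsUnit ((2 : ℕ) : R) := unit_of p (fun h => hp2 ((Nat.prime_dvd_prime_iff_eq hp.out
      Nat.prime_two).1 h))
    have := this.map (C : R →+* R[X])
    rw [map_natCast] at this
    exact_mod_cast this
  have h3 : f * (2 * derivative g) = 0 := by rw [← h2]; ring
  rw [hf.mul_right_eq_zero_iff] at h3
  exact (h2u.mul_right_eq_zero).1 h3

theorem Z3 (f : R[X]) (hf : derivative f = 0) : ∃ g, expand R p g = f := by
  refine ⟨contract p f, ?_⟩
  have hp0 : p ≠ 0 := hp.out.ne_zero
  ext n
  rw [coeff_expand hp0.bot_lt, coeff_contract hp0]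
  split_ifs with h
  · rw [Nat.div_mul_cancel h]
  · rcases n with - | n
    · exact absurd (dvd_zero p) h
    have := coeff_derivative f n
    rw [hf, coeff_zero, ← Nat.cast_succ] at this
    exact ((unit_of p h).mul_left_eq_zero.1 this.symm).symm

theorem descent (hp2 : p ≠ 2) (a b a₁ b₁ : R) (hd : IsUnit (4 * a ^ 3 + 27 * b ^ 2))
    (hd₁ : IsUnit (4 * a₁ ^ 3 + 27 * b₁ ^ 2)) (U φ ψ : R[X]) (hU : U.Monic)
    (h : cub a₁ b₁ * U ^ 2 = φ ^ 3 + C a * φ * ψ ^ 4 + C b * ψ ^ 6) (hψ : IsUnit ψ) (hφ : φ.Monic)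
    (hφ1 : 1 ≤ φ.natDegree)
    (hdeg : φ.natDegree + ψ.natDegree ≤ U.natDegree) :
    ∃ U₀ φ₀ ψ₀ : R[X], expand R p φ₀ = φ ∧ expand R p ψ₀ = ψ ∧
      U = cub a₁ b₁ ^ ((p - 1) / 2) * expand R p U₀ ∧
      cub (a₁ ^ p) (b₁ ^ p) * U₀ ^ 2 = φ₀ ^ 3 + C a * φ₀ * ψ₀ ^ 4 + C b * ψ₀ ^ 6 ∧
      U₀.Monic ∧ φ₀.Monic ∧ IsUnit ψ₀ := by
  obtain ⟨h1, h2⟩ := Z1' p hp2 a b hd _ U φ ψ hU h hψ hφ hφ1 hdeg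
  have h3 : derivative (cub a₁ b₁) * U + 2 * cub a₁ b₁ * derivative U = 0 := by
    have h2' := congrArg derivative h
    simp only [derivative_mul, derivative_add, derivative_pow, derivative_C, zero_mul,
      zero_add, h1, h2, mul_zero, add_zero] at h2'
    have : U * (derivative (cub a₁ b₁) * U + 2 * cub a₁ b₁ * derivative U) = 0 := by
      simp only [Nat.add_one_sub_one, pow_one, Nat.cast_ofNat, map_ofNat] at h2'
      linear_combination h2'
    rwa [hU.mul_right_eq_zero_iff] at this
  obtain ⟨g, hg, hg'⟩ := Z2 p hp2 _ U (cub_monic a₁ b₁) (cub_coprime a₁ b₁ hd₁) h3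
  obtain ⟨U₀, rfl⟩ := Z3 p g hg'
  obtain ⟨φ₀, rfl⟩ := Z3 p φ h1
  obtain ⟨ψ₀, rfl⟩ := Z3 p ψ h2
  have hp0 := hp.out.pos
  refine ⟨U₀, φ₀, ψ₀, rfl, rfl, hg, ?_, ?_, (monic_expand_iff hp0).1 hφ, ?_⟩
  · apply expand_injective hp0
    have hexp : expand R p (cub (a₁ ^ p) (b₁ ^ p)) = cub a₁ b₁ ^ p := by
      haveI : ExpChar R[X] p := inferInstance
      simp only [cub, map_add, map_mul, map_pow, expand_X, expand_C, add_pow_char, mul_pow, C_pow]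
      ring
    rw [hg] at h
    simp only [map_add, map_mul, map_pow, expand_C, hexp]
    rw [← h]
    have hpp : p = 1 + 2 * ((p - 1) / 2) := by
      have hodd : p % 2 = 1 := (hp.out.eq_two_or_odd).resolve_left hp2
      omega
    conv_lhs => rw [show cub a₁ b₁ ^ p = cub a₁ b₁ ^ (1 + 2 * ((p - 1) / 2)) by rw [← hpp]]
    ring
  · rw [← monic_expand_iff hp0]
    exact ((cub_monic a₁ b₁).pow _).of_mul_monic_left (hg ▸ hU)
  · rw [isUnit_iff_coeff_isUnit_isNilpotent] at hψ ⊢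
    refine ⟨by simpa [coeff_expand hp0] using hψ.1, fun i hi => ?_⟩
    have := hψ.2 (i * p) (by positivity)
    rwa [coeff_expand_mul hp0] at this

theorem final (hp3 : 3 < p) (a b : R) (hd : IsUnit (4 * a ^ 3 + 27 * b ^ 2))
    (w φ ψ : R[X]) (hw : w.Monic) (hφ : φ.Monic) (hψ : IsUnit ψ)
    (h : cub a b * w ^ 2 = φ ^ 3 + C a * φ * ψ ^ 4 + C b * ψ ^ 6)
    (dφ : φ.natDegree = p ^ 2) (dw : 2 * w.natDegree + 3 = 3 * p ^ 2)
    (dψ : ψ.natDegree < p * ((p - 1) / 2)) (ha : IsNilpotent a) : a = 0 := by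
  have hodd : p % 2 = 1 := (hp.out.eq_two_or_odd).resolve_left (by omega)
  obtain ⟨k, hk⟩ : ∃ k, p = 2 * k + 1 := ⟨p / 2, by omega⟩
  have hk2 : (p - 1) / 2 = k := by omega
  have hdp : IsUnit (4 * (a ^ p) ^ 3 + 27 * (b ^ p) ^ 2) := by
    have := hd.pow p
    have e : (4 * a ^ 3 + 27 * b ^ 2) ^ p = 4 * (a ^ p) ^ 3 + 27 * (b ^ p) ^ 2 := by
      rw [add_pow_char, mul_pow, mul_pow]
      have h4 : ∀ n : ℕ, (n : R) ^ p = n := fun n => by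
        have := map_natCast (frobenius R p) n
        rwa [frobenius_def] at this
      have := h4 4; have h27 := h4 27
      push_cast at this h27
      rw [this, h27]; ring
    rwa [e] at this
  obtain ⟨U, Φ, Ψ, e1, e2, e3, e4, mU, mΦ, uΨ⟩ := descent p (by omega) a b a b hd hd w φ ψ hw h hψ hφ
    (by rw [dφ]; exact Nat.one_le_pow _ _ hp.out.pos) (by rw [dφ]; rw [hk2] at dψ; nlinarith)
  have dΦ : Φ.natDegree = p := by
    rw [← e1, natDegree_expand] at dφ
    exact Nat.eq_of_mul_eq_mul_right hp.out.pos (by rw [dφ]; ring)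
  have dΨ : Ψ.natDegree < k := by
    rw [← e2, natDegree_expand, hk2, mul_comm] at dψ
    exact Nat.lt_of_mul_lt_mul_left dψ
  have dU : U.natDegree = 3 * k := by
    have : w.natDegree = 3 * k + U.natDegree * p := by
      rw [e3, hk2, ((cub_monic a b).pow k).natDegree_mul (mU.expand hp.out.pos), (cub_monic a b).natDegree_pow,
        cub_natDegree, natDegree_expand]; ring
    rw [this] at dw
    have h5 : 2 * U.natDegree * p = 6 * k * p := by
      have : 3 * p ^ 2 = 6 * k * p + 6 * k + 3 := by rw [hk]; ring
      nlinarith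
    have := Nat.eq_of_mul_eq_mul_right hp.out.pos h5
    omega
  obtain ⟨V, Φ', Ψ', f1, f2, f3, f4, mV, mΦ', uΨ'⟩ := descent p (by omega) a b (a ^ p) (b ^ p) hd hdp U Φ Ψ mU e4 uΨ mΦ
    (by rw [dΦ]; exact hp.out.one_le) (by omega)
  have dΦ' : Φ'.natDegree = 1 := by
    rw [← f1, natDegree_expand] at dΦ
    exact Nat.eq_of_mul_eq_mul_right hp.out.pos (by rw [dΦ]; ring)
  have dΨ' : Ψ'.natDegree = 0 := by
    rw [← f2, natDegree_expand] at dΨ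
    by_contra h0
    have : 1 * p ≤ Ψ'.natDegree * p := Nat.mul_le_mul_right p (by omega)
    omega
  have dV : V.natDegree = 0 := by
    rw [f3, hk2, ((cub_monic _ _).pow k).natDegree_mul (mV.expand hp.out.pos), (cub_monic _ _).natDegree_pow,
        cub_natDegree, natDegree_expand] at dU
    have : V.natDegree * p = 0 := by omega
    exact (Nat.mul_eq_zero.1 this).resolve_right hp.out.ne_zero
  have hV : V = 1 := mV.natDegree_eq_zero.1 dV
  obtain ⟨c, hc⟩ := natDegree_eq_zero.1 dΨ'
  have hΦ' := mΦ'.eq_X_add_C dΦ'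
  set β := Φ'.coeff 0
  rw [hV, hΦ', ← hc] at f4
  -- compare coefficients
  have c2 := congrArg (fun q => coeff q 2) f4
  have c1 := congrArg (fun q => coeff q 1) f4
  have ex : (X + C β) ^ 3 + C a * (X + C β) * C c ^ 4 + C b * C c ^ 6 =
     X ^ 3 + C (3 * β) * X ^ 2 + C (3 * β ^ 2 + a * c ^ 4) * X
       + C (β ^ 3 + a * β * c ^ 4 + b * c ^ 6) := by
    simp only [C_add, C_mul, C_pow, map_ofNat]; ring
  rw [ex] at c1 c2
  simp only [cub, one_pow, mul_one, coeff_add, coeff_C_mul, coeff_X_pow, coeff_X, coeff_C] at c1 c2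
  norm_num at c1 c2
  have h3 : IsUnit (3 : R) := by
    have : IsUnit ((3 : ℕ) : R) := unit_of p (fun h => by
      have := Nat.le_of_dvd (by norm_num) h; omega)
    simpa using this
  have hβ : β = 0 := (h3.mul_right_eq_zero).1 c2.symm
  rw [hβ] at c1
  rw [← hc] at uΨ'
  have uc : IsUnit c := isUnit_C.1 uΨ'
  have hz : a * (c ^ 4 - a ^ (p * p - 1)) = 0 := by
    have hpp : a ^ (p * p) = a * a ^ (p * p - 1) := by
      rw [← pow_succ', Nat.sub_add_cancel (Nat.mul_pos hp.out.pos hp.out.pos)]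
    rw [← pow_mul, hpp] at c1
    linear_combination -c1
  have hu : IsUnit (c ^ 4 - a ^ (p * p - 1)) := by
    rw [sub_eq_neg_add]
    have hn : IsNilpotent (-(a ^ (p * p - 1))) := (ha.pow_of_pos (by
      have : 2 * 2 ≤ p * p := Nat.mul_le_mul (by omega) (by omega)
      omega)).neg
    exact hn.isUnit_add_right_of_commute (uc.pow 4) (Commute.all _ _)
  exact (hu.mul_left_eq_zero).1 hz

end CharPAlg


namespace Ultra
variable {Ω : Type*} [NormedField Ω] [IsUltrametricDist Ω]

theorem add_le {x y : Ω} {r : ℝ} (hx : ‖x‖ ≤ r) (hy : ‖y‖ ≤ r) : ‖x + y‖ ≤ r :=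
  (IsUltrametricDist.norm_add_le_max x y).trans (max_le hx hy)
theorem add_lt {x y : Ω} {r : ℝ} (hx : ‖x‖ < r) (hy : ‖y‖ < r) : ‖x + y‖ < r :=
  (IsUltrametricDist.norm_add_le_max x y).trans_lt (max_lt hx hy)
theorem sub_le {x y : Ω} {r : ℝ} (hx : ‖x‖ ≤ r) (hy : ‖y‖ ≤ r) : ‖x - y‖ ≤ r := by
  rw [sub_eq_add_neg]; exact add_le hx (by rwa [norm_neg])
theorem sub_lt {x y : Ω} {r : ℝ} (hx : ‖x‖ < r) (hy : ‖y‖ < r) : ‖x - y‖ < r := by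
  rw [sub_eq_add_neg]; exact add_lt hx (by rwa [norm_neg])
theorem add_eq {x y : Ω} (h : ‖y‖ < ‖x‖) : ‖x + y‖ = ‖x‖ := by
  rw [IsUltrametricDist.norm_add_eq_max_of_norm_ne_norm h.ne', max_eq_left h.le]
theorem sub_eq {x y : Ω} (h : ‖y‖ < ‖x‖) : ‖x - y‖ = ‖x‖ := by
  rw [sub_eq_add_neg]; exact add_eq (by rwa [norm_neg])
theorem eq_of_sub_lt {x y : Ω} (h : ‖x - y‖ < ‖x‖) : ‖y‖ = ‖x‖ := by
  have := sub_eq h; rwa [sub_sub_cancel] at this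
theorem mul_le_one {x y : Ω} (hx : ‖x‖ ≤ 1) (hy : ‖y‖ ≤ 1) : ‖x * y‖ ≤ 1 := by
  rw [norm_mul]; exact mul_le_one₀ hx (norm_nonneg _) hy
theorem mul_lt_one {x y : Ω} (hx : ‖x‖ ≤ 1) (hy : ‖y‖ < 1) : ‖x * y‖ < 1 := by
  rw [norm_mul]; exact mul_lt_one_of_nonneg_of_lt_one_right hx (norm_nonneg _) hy
theorem nat_le (n : ℕ) : ‖(n : Ω)‖ ≤ 1 := IsUltrametricDist.norm_natCast_le_one Ω n

theorem nat_eq {p : ℕ} (hp : p.Prime) (hpn : ‖(p : Ω)‖ < 1) {n : ℕ} (hn : ¬ p ∣ n) :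
    ‖(n : Ω)‖ = 1 := by
  refine le_antisymm (nat_le n) ?_
  by_contra hlt
  push Not at hlt
  have hc : Nat.Coprime p n := (Nat.Prime.coprime_iff_not_dvd hp).2 hn
  have hb := Nat.gcd_eq_gcd_ab p n
  rw [hc] at hb
  have h1 : (1 : Ω) = (p : Ω) * (Nat.gcdA p n : Ω) + (n : Ω) * (Nat.gcdB p n : Ω) := by
    have := congrArg (Int.cast : ℤ → Ω) hb
    push_cast at this; exact this
  have hi : ∀ z : ℤ, ‖(z : Ω)‖ ≤ 1 := fun z => IsUltrametricDist.norm_intCast_le_one Ω z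
  have : ‖(1 : Ω)‖ < 1 := by
    rw [h1]
    exact add_lt (by rw [mul_comm]; exact mul_lt_one (hi _) hpn)
      (by rw [mul_comm]; exact mul_lt_one (hi _) hlt)
  simp at this

end Ultra

namespace WCrv
open Ultra
variable {Ω : Type*} [NormedField Ω] [IsUltrametricDist Ω] {a b : Ω} {G : Type*} [AddCommGroup G]
  {X Y : G → Ω}

theorem normY (h : WCrv a b X Y) (ha : ‖a‖ ≤ 1) (hb : ‖b‖ ≤ 1) {P : G} (hP : P ≠ 0)
    (h1 : 1 < ‖X P‖) : ‖Y P‖ ^ 2 = ‖X P‖ ^ 3 := by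
  rw [← norm_pow, h.eq P hP, ← norm_pow, add_assoc]
  apply add_eq
  rw [norm_pow]
  have hx2 : 1 < ‖X P‖ ^ 2 := by nlinarith
  have hx3 : ‖X P‖ < ‖X P‖ ^ 3 := by nlinarith
  refine (IsUltrametricDist.norm_add_le_max _ _).trans_lt (max_lt ?_ ?_)
  · rw [norm_mul]
    have : ‖a‖ * ‖X P‖ ≤ 1 * ‖X P‖ := by gcongr
    nlinarith
  · nlinarith

/-- doubling -/
theorem dbl_norm (h : WCrv a b X Y) (h2 : ‖(2 : Ω)‖ = 1) (ha : ‖a‖ ≤ 1) (hb : ‖b‖ ≤ 1) {P : G}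
    (hP : P ≠ 0) (h2P : P + P ≠ 0)
    (h1 : 1 < ‖X P‖) : ‖X (P + P)‖ = ‖X P‖ := by
  have e := h.BB_dbl P hP h2P 0
  have hy := h.normY ha hb hP h1
  have h4 : ‖(4 : Ω)‖ = 1 := by rw [show (4 : Ω) = 2 * 2 by norm_num, norm_mul, h2]; norm_num
  have h8 : ‖(8 : Ω)‖ = 1 := by rw [show (8 : Ω) = 2 * 4 by norm_num, norm_mul, h2, h4]; norm_num
  have e2 : ‖BB a b (X P) (X P) 0‖ = ‖X P‖ ^ 4 := by
    have : BB a b (X P) (X P) 0 = X P ^ 4 + (- 2 * a * X P ^ 2 + a ^ 2 - 8 * b * X P) := by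
      unfold BB; ring
    rw [this, ← norm_pow]
    apply add_eq
    rw [norm_pow]
    have hx2 : 1 < ‖X P‖ ^ 2 := by nlinarith
    refine Ultra.sub_lt (Ultra.add_lt ?_ ?_) ?_
    · simp only [norm_mul, norm_neg, h2, norm_pow]
      nlinarith [mul_le_mul_of_nonneg_right ha (by positivity : 0 ≤ ‖X P‖ ^ 2)]
    · rw [norm_pow]; nlinarith [norm_nonneg a]
    · simp only [norm_mul, h8]
      nlinarith [mul_le_mul_of_nonneg_right hb (by positivity : 0 ≤ ‖X P‖)]
  rw [e] at e2
  simp only [norm_mul, h4, norm_pow, sub_zero, hy, one_mul] at e2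
  have : 0 < ‖X P‖ ^ 3 := by positivity
  nlinarith

theorem min_le (h : WCrv a b X Y) (h2 : ‖(2 : Ω)‖ = 1) (ha : ‖a‖ ≤ 1) (hb : ‖b‖ ≤ 1) {P Q : G}
    (hP : P ≠ 0) (hQ : Q ≠ 0) (hPQ : P + Q ≠ 0) (h1 : 1 < ‖X Q‖) (hle : ‖X Q‖ ≤ ‖X P‖) :
    ‖X Q‖ ≤ ‖X (P + Q)‖ := by
  by_cases he : X P = X Q
  · rcases h.inj P Q hP hQ he with rfl | rfl
    · rw [h.dbl_norm h2 ha hb hP hPQ h1]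
    · simp at hPQ
  have h4 : ‖(4 : Ω)‖ = 1 := by rw [show (4 : Ω) = 2 * 2 by norm_num, norm_mul, h2]; norm_num
  have e1 := h.BB_eq P Q hP hQ he 0
  have e2 := h.add_add_sub P Q hP hQ he
  simp only [sub_zero] at e1
  have hd : X P - X Q ≠ 0 := sub_ne_zero.2 he
  have hD : 0 < ‖X P - X Q‖ := norm_pos_iff.2 hd
  have hDs : ‖X P - X Q‖ ≤ ‖X P‖ := sub_le le_rfl hle
  generalize X P = q at *
  generalize X Q = r at *
  generalize X (P + Q) = u at *
  generalize X (P - Q) = v at *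
  have hs : 1 < ‖q‖ := h1.trans_le hle
  have hst : 1 < ‖q‖ * ‖r‖ := by nlinarith
  have n1 : ‖u‖ * ‖v‖ * ‖q - r‖ ^ 2 = (‖q‖ * ‖r‖) ^ 2 := by
    have := congrArg norm e1
    rw [norm_mul, norm_mul, norm_pow] at this
    rw [this]
    have : BB a b q r 0 = (q * r) ^ 2 + (-2 * (a * (q * r)) + a ^ 2 - 4 * b * (q + r)) := by
      unfold BB; ring
    rw [this, ← norm_mul, ← norm_pow]
    apply add_eq
    rw [norm_pow, norm_mul]
    have hbq : ‖b‖ * ‖q + r‖ ≤ 1 * ‖q‖ := mul_le_mul hb (add_le le_rfl hle) (norm_nonneg _) zero_le_one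
    have haq : ‖a‖ * (‖q‖ * ‖r‖) ≤ 1 * (‖q‖ * ‖r‖) := by gcongr
    refine Ultra.sub_lt (Ultra.add_lt ?_ ?_) ?_
    · simp only [norm_mul, norm_neg, h2, norm_pow]
      nlinarith
    · rw [norm_pow]; nlinarith [norm_nonneg a]
    · rw [norm_mul, norm_mul, h4]
      have : ‖q‖ < ‖q‖ * ‖r‖ := by nlinarith
      nlinarith
  have n2 : ‖u + v‖ * ‖q - r‖ ^ 2 ≤ ‖q‖ * ‖r‖ * ‖q‖ := by
    have := congrArg norm e2
    rw [norm_mul, norm_pow] at this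
    rw [this, norm_mul, h2, one_mul]
    refine add_le ?_ ?_
    · rw [norm_mul]
      exact mul_le_mul (add_le (by rw [norm_mul]) (ha.trans hst.le)) (add_le le_rfl hle)
        (norm_nonneg _) (by positivity)
    · rw [norm_mul, h2]; nlinarith
  by_contra hlt
  push Not at hlt
  have hD2 : 0 < ‖q - r‖ ^ 2 := by positivity
  have hv : ‖q‖ * ‖r‖ * ‖q‖ < ‖v‖ * ‖q - r‖ ^ 2 := by
    by_contra hc
    push Not at hc
    have h5 : ‖u‖ * (‖v‖ * ‖q - r‖ ^ 2) ≤ ‖u‖ * (‖q‖ * ‖r‖ * ‖q‖) := by gcongr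
    have h6 : ‖u‖ * (‖q‖ * ‖r‖ * ‖q‖) < ‖r‖ * (‖q‖ * ‖r‖ * ‖q‖) := by
      apply mul_lt_mul_of_pos_right hlt; positivity
    nlinarith
  have huv : ‖u‖ < ‖v‖ := by
    refine hlt.trans ?_
    by_contra hc
    push Not at hc
    have : ‖v‖ * ‖q - r‖ ^ 2 ≤ ‖r‖ * ‖q‖ ^ 2 := by gcongr
    nlinarith
  rw [add_comm, add_eq huv] at n2
  linarith

/-- subgroup of points near the origin -/
def near (h : WCrv a b X Y) (h2 : ‖(2 : Ω)‖ = 1) (ha : ‖a‖ ≤ 1) (hb : ‖b‖ ≤ 1) (S : Set ℝ)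
    (hS : ∀ r ∈ S, 1 < r) (hS2 : ∀ r ∈ S, ∀ s, r ≤ s → s ∈ S) : AddSubgroup G where
  carrier := {P | P = 0 ∨ ‖X P‖ ∈ S}
  zero_mem' := Or.inl rfl
  neg_mem' := by
    rintro P (hP | hP)
    · left; simpa using hP
    · right; rwa [h.negX]
  add_mem' := by
    rintro P Q hP hQ
    rcases eq_or_ne P 0 with rfl | hP0
    · simpa using hQ
    rcases eq_or_ne Q 0 with rfl | hQ0
    · simpa using hP
    have hP := hP.resolve_left hP0
    have hQ := hQ.resolve_left hQ0
    by_cases h0 : P + Q = 0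
    · exact Or.inl h0
    right
    rcases le_total ‖X Q‖ ‖X P‖ with hle | hle
    · exact hS2 _ hQ _ (h.min_le h2 ha hb hP0 hQ0 h0 (hS _ hQ) hle)
    · rw [add_comm] at h0 ⊢
      exact hS2 _ hP _ (h.min_le h2 ha hb hQ0 hP0 h0 (hS _ hP) hle)

theorem smul_norm_le (h : WCrv a b X Y) (h2 : ‖(2 : Ω)‖ = 1) (ha : ‖a‖ ≤ 1) (hb : ‖b‖ ≤ 1)
    {P : G} (h1 : 1 < ‖X P‖) (n : ℕ) (hn : n • P ≠ 0) : ‖X P‖ ≤ ‖X (n • P)‖ := by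
  have : n • P ∈ h.near h2 ha hb (Set.Ici ‖X P‖) (fun r hr => h1.trans_le hr)
      (fun r hr s hs => le_trans hr hs) := 
    AddSubgroup.nsmul_mem _ (show P = 0 ∨ ‖X P‖ ∈ Set.Ici ‖X P‖ from Or.inr Set.self_mem_Ici) n
  exact this.resolve_left hn

theorem smul_norm (h : WCrv a b X Y) (h2 : ‖(2 : Ω)‖ = 1) (ha : ‖a‖ ≤ 1) (hb : ‖b‖ ≤ 1)
    {P : G} (h1 : 1 < ‖X P‖) (hP : P ≠ 0) {p : ℕ} (hp : p.Prime) (hpP : p • P = 0) {n : ℕ}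
    (hn : ¬ p ∣ n) : ‖X (n • P)‖ = ‖X P‖ := by
  haveI := Fact.mk hp
  have ho : addOrderOf P = p := addOrderOf_eq_prime hpP hP
  have hn0 : n • P ≠ 0 := fun h => hn (ho ▸ addOrderOf_dvd_of_nsmul_eq_zero h)
  have h3 := h.smul_norm_le h2 ha hb h1 n hn0
  refine le_antisymm ?_ h3
  have hc : Nat.Coprime n p := ((Nat.Prime.coprime_iff_not_dvd hp).2 hn).symm
  obtain ⟨m, -, hm⟩ := Nat.exists_mul_mod_eq_one_of_coprime hc hp.one_lt
  have : m • (n • P) = P := by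
    rw [← mul_smul, mul_comm, ← Nat.mod_add_div (n * m) p, hm, add_smul, one_smul, mul_comm, mul_smul, hpP,
      smul_zero, add_zero]
  have h4 := h.smul_norm_le h2 ha hb (P := n • P) (h1.trans_le h3) m (by rwa [this])
  rwa [this] at h4

end WCrv


namespace sW
open Polynomial

theorem odd_ne {k : Type*} [CommRing k] [IsDomain k] (a b e : k) (h0 : e ^ 3 + a * e + b = 0)
    (h1 : 3 * e ^ 2 + a ≠ 0) (n : ℕ) (hn : Odd n) : ((sW a b).preΨ' n).eval e ≠ 0 := by
  induction n using Nat.strong_induction_on with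
  | _ n ih =>
  have e2 : ((sW a b).Ψ₂Sq).eval e = 0 := by rw [eval_two, h0, mul_zero]
  rcases hn with ⟨m, rfl⟩
  rcases m with _ | _ | m
  · simp
  · have : ((sW a b).preΨ' (2 * (0 + 1) + 1)).eval e = - (3 * e ^ 2 + a) ^ 2 := by
      rw [show 2 * (0 + 1) + 1 = 3 from rfl, preΨ'_three, eval_three]
      linear_combination 12 * e * h0
    rw [this]
    exact neg_ne_zero.2 (pow_ne_zero _ h1)
  · rw [show m + 1 + 1 = m + 2 from rfl, preΨ'_odd]
    by_cases hm : Even m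
    · simp only [hm, if_true, eval_sub, eval_mul, eval_pow, e2]
      have i1 := ih (m + 1) (by omega) (hm.add_one)
      have i3 := ih (m + 3) (by omega) (hm.add_odd (by decide))
      simp [i1, i3]
    · have hm' := Nat.not_even_iff_odd.1 hm
      simp only [hm, if_false, eval_sub, eval_mul, eval_pow, e2]
      have i1 := ih (m + 2) (by omega) (hm'.add_even (by decide))
      have i3 := ih (m + 4) (by omega) (hm'.add_even (by decide))
      simp [i1, i3]

theorem node_zero {k : Type*} [CommRing k] (a b t : k) (h0 : t ^ 3 + a * t + b = 0)
    (h1 : 3 * t ^ 2 + a = 0) (n : ℕ) (hn : 3 ≤ n) : ((sW a b).preΨ' n).eval t = 0 := by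
  induction n using Nat.strong_induction_on with
  | _ n ih =>
  have e2 : ((sW a b).Ψ₂Sq).eval t = 0 := by rw [eval_two, h0, mul_zero]
  have ha : a = -3 * t ^ 2 := by linear_combination h1
  have hb : b = 2 * t ^ 3 := by rw [ha] at h0; linear_combination h0
  rcases Nat.even_or_odd' n with ⟨m, rfl | rfl⟩
  · rcases m with _ | _ | _ | m
    · omega
    · omega
    · rw [show 2 * (0 + 1 + 1) = 4 from rfl, preΨ'_four, eval_four, ha, hb]; ring
    · rw [show m + 1 + 1 + 1 = m + 3 from rfl, preΨ'_even]
      have i1 := ih (m + 3) (by omega) (by omega)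
      simp [i1]
  · rcases m with _ | _ | m
    · omega
    · rw [show 2 * (0 + 1) + 1 = 3 from rfl, preΨ'_three, eval_three, ha, hb]; ring
    · rw [show m + 1 + 1 = m + 2 from rfl, preΨ'_odd]
      have i1 := ih (m + 3) (by omega) (by omega)
      have i2 := ih (m + 4) (by omega) (by omega)
      split_ifs <;> simp [i1, i2, e2]

end sW

namespace Ultra
variable (Ω : Type*) [NormedField Ω] [IsUltrametricDist Ω]

/-- ring of integers -/
def O : Subring Ω where
  carrier := {x | ‖x‖ ≤ 1}
  mul_mem' := mul_le_one
  one_mem' := by simp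
  add_mem' := add_le
  zero_mem' := by simp
  neg_mem' := by simp

variable {Ω}
theorem mem_O {x : Ω} : x ∈ O Ω ↔ ‖x‖ ≤ 1 := Iff.rfl

variable (Ω)
/-- maximal ideal -/
def mm : Ideal (O Ω) where
  carrier := {x | ‖(x : Ω)‖ < 1}
  add_mem' := fun {x y} hx hy => by
    show ‖((x + y : O Ω) : Ω)‖ < 1
    rw [Subring.coe_add]; exact add_lt hx hy
  zero_mem' := by simp
  smul_mem' := fun c x hx => by
    show ‖((c * x : O Ω) : Ω)‖ < 1
    rw [Subring.coe_mul]; exact mul_lt_one c.2 hx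

/-- closed ball ideal -/
def ball (r : ℝ) (hr : 0 ≤ r) : Ideal (O Ω) where
  carrier := {x | ‖(x : Ω)‖ ≤ r}
  add_mem' := fun {x y} hx hy => by
    show ‖((x + y : O Ω) : Ω)‖ ≤ r
    rw [Subring.coe_add]; exact add_le hx hy
  zero_mem' := by simpa using hr
  smul_mem' := fun c x hx => by
    show ‖((c * x : O Ω) : Ω)‖ ≤ r
    rw [Subring.coe_mul, norm_mul]
    exact (mul_le_of_le_one_left (norm_nonneg _) c.2).trans hx

variable {Ω}
theorem mem_mm {x : O Ω} : x ∈ mm Ω ↔ ‖(x : Ω)‖ < 1 := Iff.rfl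
theorem mem_ball {x : O Ω} {r : ℝ} {hr : 0 ≤ r} : x ∈ ball Ω r hr ↔ ‖(x : Ω)‖ ≤ r := Iff.rfl

instance : (mm Ω).IsPrime where
  ne_top' := by
    rw [Ne, Ideal.eq_top_iff_one, mem_mm]; simp
  mem_or_mem' := by
    intro x y hxy
    rw [mem_mm, mem_mm]
    rw [mem_mm, Subring.coe_mul, norm_mul] at hxy
    by_contra hc
    push Not at hc
    nlinarith [hc.1, hc.2]

open Polynomial

theorem psi_map (a b : O Ω) (n : ℕ) : (sW (a : Ω) (b : Ω)).preΨ' n =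
    ((sW a b).preΨ' n).map (O Ω).subtype := by
  rw [← WeierstrassCurve.map_preΨ']
  congr 1

theorem Phi_map (a b : O Ω) (n : ℤ) : (sW (a : Ω) (b : Ω)).Φ n =
    ((sW a b).Φ n).map (O Ω).subtype := by
  rw [← WeierstrassCurve.map_Φ]
  congr 1

theorem psi_eval_coe (a b e : O Ω) (n : ℕ) : ((((sW a b).preΨ' n).eval e : O Ω) : Ω) =
    ((sW (a : Ω) (b : Ω)).preΨ' n).eval (e : Ω) := by
  rw [psi_map, eval_map]; exact (eval₂_at_apply (O Ω).subtype e).symm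

theorem psi_coeff_le {a b : Ω} (ha : ‖a‖ ≤ 1) (hb : ‖b‖ ≤ 1) (n i : ℕ) :
    ‖((sW a b).preΨ' n).coeff i‖ ≤ 1 := by
  have := psi_map ⟨a, ha⟩ ⟨b, hb⟩ n
  simp only at this
  rw [this, coeff_map]
  exact (((sW (⟨a, ha⟩ : O Ω) ⟨b, hb⟩).preΨ' n).coeff i).2

/-- evaluation in the residue ring -/
theorem psi_eval_mk {a b e : Ω} (ha : ‖a‖ ≤ 1) (hb : ‖b‖ ≤ 1) (he : ‖e‖ ≤ 1) (n : ℕ) :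
    ‖((sW a b).preΨ' n).eval e‖ < 1 ↔ ((sW (Ideal.Quotient.mk (mm Ω) ⟨a, ha⟩)
      (Ideal.Quotient.mk (mm Ω) ⟨b, hb⟩)).preΨ' n).eval (Ideal.Quotient.mk (mm Ω) ⟨e, he⟩) = 0 := by
  have h1 := psi_eval_coe (⟨a, ha⟩ : O Ω) ⟨b, hb⟩ ⟨e, he⟩ n
  simp only at h1
  rw [← h1, ← mem_mm, ← Ideal.Quotient.eq_zero_iff_mem]
  have : sW (Ideal.Quotient.mk (mm Ω) ⟨a, ha⟩) (Ideal.Quotient.mk (mm Ω) ⟨b, hb⟩) =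
    (sW (⟨a, ha⟩ : O Ω) ⟨b, hb⟩).map (Ideal.Quotient.mk (mm Ω)) := by simp [sW, WeierstrassCurve.map]
  rw [this, WeierstrassCurve.map_preΨ', eval_map, eval₂_at_apply]

theorem psi_unit {a b e : Ω} (ha : ‖a‖ ≤ 1) (hb : ‖b‖ ≤ 1) (he : ‖e‖ ≤ 1)
    (h0 : e ^ 3 + a * e + b = 0) (h1 : ‖3 * e ^ 2 + a‖ = 1) (n : ℕ) (hn : Odd n) :
    ‖((sW a b).preΨ' n).eval e‖ = 1 := by
  refine le_antisymm ?_ (not_lt.1 ?_)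
  · have h1 := psi_eval_coe (⟨a, ha⟩ : O Ω) ⟨b, hb⟩ ⟨e, he⟩ n
    simp only at h1
    rw [← h1]; exact mem_O.1 (SetLike.coe_mem _)
  · rw [psi_eval_mk ha hb he]
    refine sW.odd_ne _ _ _ ?_ ?_ n hn
    · simp only [← map_pow, ← map_mul, ← map_add]
      rw [Ideal.Quotient.eq_zero_iff_mem, mem_mm]
      simp [h0]
    · rw [show (3 : O Ω ⧸ mm Ω) = Ideal.Quotient.mk (mm Ω) 3 from rfl]
      simp only [← map_pow, ← map_mul, ← map_add]
      rw [Ne, Ideal.Quotient.eq_zero_iff_mem, mem_mm]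
      exact not_lt.2 h1.ge

theorem psi_node {a b t : Ω} (ha : ‖a‖ ≤ 1) (hb : ‖b‖ ≤ 1) (ht : ‖t‖ ≤ 1)
    (h0 : ‖t ^ 3 + a * t + b‖ < 1) (h1 : ‖3 * t ^ 2 + a‖ < 1) (n : ℕ) (hn : 3 ≤ n) :
    ‖((sW a b).preΨ' n).eval t‖ < 1 := by
  rw [psi_eval_mk ha hb ht]
  refine sW.node_zero _ _ _ ?_ ?_ n hn
  · simp only [← map_pow, ← map_mul, ← map_add]
    rw [Ideal.Quotient.eq_zero_iff_mem, mem_mm]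
    simpa using h0
  · rw [show (3 : O Ω ⧸ mm Ω) = Ideal.Quotient.mk (mm Ω) 3 from rfl]
    simp only [← map_pow, ← map_mul, ← map_add]
    rw [Ideal.Quotient.eq_zero_iff_mem, mem_mm]
    exact h1

end Ultra


/-- local data -/
structure Loc (p : ℕ) {Ω : Type*} [NormedField Ω] [IsUltrametricDist Ω] (a b : Ω) {G : Type*}
    [AddCommGroup G] (X Y : G → Ω) : Prop where
  crv : WCrv a b X Y
  hp : p.Prime
  hp37 : 37 < p
  np : ‖(p : Ω)‖ = (p : ℝ)⁻¹
  ha : ‖a‖ ≤ 1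
  hb : ‖b‖ = 1
  card : Nat.card {P : G // p • P = 0} = p ^ 2
  inf : (Set.range X).Infinite

namespace Loc
open Ultra
variable {p : ℕ} {Ω : Type*} [NormedField Ω] [IsUltrametricDist Ω] [CharZero Ω] {a b : Ω}
  {G : Type*} [AddCommGroup G] {X Y : G → Ω}

theorem hp0 (h : Loc p a b X Y) : (0 : ℝ) < p := by exact_mod_cast h.hp.pos

theorem np1 (h : Loc p a b X Y) : ‖(p : Ω)‖ < 1 := by
  rw [h.np]; apply inv_lt_one_of_one_lt₀; exact_mod_cast h.hp.one_lt

theorem nnat (h : Loc p a b X Y) {n : ℕ} (hn : 0 < n) (hn2 : n < p) : ‖(n : Ω)‖ = 1 :=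
  nat_eq h.hp h.np1 (Nat.not_dvd_of_pos_of_lt hn hn2)

theorem n2 (h : Loc p a b X Y) : ‖(2 : Ω)‖ = 1 := by
  have := h.nnat (n := 2) (by norm_num) (by have := h.hp37; omega); exact_mod_cast this

theorem n3 (h : Loc p a b X Y) : ‖(3 : Ω)‖ = 1 := by
  have := h.nnat (n := 3) (by norm_num) (by have := h.hp37; omega); exact_mod_cast this

theorem fin (h : Loc p a b X Y) : {P : G | P ≠ 0 ∧ p • P = 0}.Finite := by
  have h1 : Finite {P : G // p • P = 0} := Nat.finite_of_card_ne_zero (by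
    rw [h.card]; exact pow_ne_zero _ h.hp.ne_zero)
  have h2 : {P : G | p • P = 0}.Finite := h1
  exact h2.subset (fun P hP => hP.2)

/-- nonzero torsion points -/
noncomputable def T (h : Loc p a b X Y) : Finset G := h.fin.toFinset

theorem mem_T (h : Loc p a b X Y) {P : G} : P ∈ h.T ↔ P ≠ 0 ∧ p • P = 0 := by simp [T]

theorem card_T (h : Loc p a b X Y) : h.T.card = p ^ 2 - 1 := by
  classical
  have h2 : {P : G | p • P = 0}.Finite := Nat.finite_of_card_ne_zero (α := {P : G // p • P = 0}) (by
    rw [h.card]; exact pow_ne_zero _ h.hp.ne_zero)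
  have h3 : h2.toFinset.card = p ^ 2 := by
    rw [← h.card, ← Set.ncard_eq_toFinset_card _ h2]; rfl
  have : h.T = h2.toFinset.erase 0 := by
    ext P; simp [mem_T]
  rw [this, Finset.card_erase_of_mem (by simp), h3]

theorem podd (h : Loc p a b X Y) : Odd p := h.hp.odd_of_ne_two (by have := h.hp37; omega)

theorem ne_neg (h : Loc p a b X Y) {P : G} (hP : P ∈ h.T) : P ≠ -P := by
  intro he
  rw [h.mem_T] at hP
  have h2 : 2 • P = 0 := by rw [two_smul]; nth_rewrite 1 [he]; simp
  haveI := Fact.mk h.hp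
  have ho := addOrderOf_eq_prime hP.2 hP.1
  have := Nat.le_of_dvd (by norm_num) (ho ▸ addOrderOf_dvd_of_nsmul_eq_zero h2)
  have := h.hp37; omega

theorem fiber (h : Loc p a b X Y) [DecidableEq Ω] [DecidableEq G] {P : G} (hP : P ∈ h.T) :
    (h.T.filter (fun Q => X Q = X P)).card = 2 := by
  have : h.T.filter (fun Q => X Q = X P) = {P, -P} := by
    ext Q
    simp only [Finset.mem_filter, Finset.mem_insert, Finset.mem_singleton]
    constructor
    · rintro ⟨hQ, he⟩
      exact h.crv.inj Q P (h.mem_T.1 hQ).1 (h.mem_T.1 hP).1 he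
    · rintro (rfl | rfl)
      · exact ⟨hP, rfl⟩
      · refine ⟨?_, h.crv.negX P⟩
        rw [mem_T] at hP ⊢
        exact ⟨neg_ne_zero.2 hP.1, by rw [smul_neg, hP.2, neg_zero]⟩
  rw [this, Finset.card_pair (h.ne_neg hP)]

open Polynomial in
theorem psi_sq (h : Loc p a b X Y) : ((sW a b).preΨ' p) ^ 2 =
    C ((p : Ω) ^ 2) * ∏ P ∈ h.T, (Polynomial.X - C (X P)) := by
  classical
  set ψ := (sW a b).preΨ' p with hψ
  have hp0 : (p : Ω) ≠ 0 := by exact_mod_cast h.hp.ne_zero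
  have hne : ¬ Even p := Nat.not_even_iff_odd.2 h.podd
  have hl : ψ.leadingCoeff = p := by rw [hψ, leadingCoeff_preΨ' _ hp0, if_neg hne]
  have hd : ψ.natDegree = (p ^ 2 - 1) / 2 := by rw [hψ, natDegree_preΨ' _ hp0, if_neg hne]
  have h0 : ψ ≠ 0 := preΨ'_ne_zero _ hp0
  set S := h.T.image X with hS
  have hpr : ∀ g : Ω → Polynomial Ω, ∏ P ∈ h.T, g (X P) = (∏ x ∈ S, g x) ^ 2 := by
    intro g
    rw [Finset.prod_comp, ← Finset.prod_pow]
    apply Finset.prod_congr rfl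
    intro x hx
    obtain ⟨P, hP, rfl⟩ := Finset.mem_image.1 hx
    rw [h.fiber hP]
  have hcS : S.card * 2 = p ^ 2 - 1 := by
    rw [← h.card_T, Finset.card_eq_sum_card_image X h.T, Finset.sum_congr rfl (g := fun _ => 2)]
    · simp [hS]
    · intro x hx
      obtain ⟨P, hP, rfl⟩ := Finset.mem_image.1 hx
      rw [h.fiber hP]
  have hsub : S.val ≤ ψ.roots := by
    rw [Multiset.le_iff_subset S.nodup]
    intro x hx
    obtain ⟨P, hP, rfl⟩ := Finset.mem_image.1 (show x ∈ S from hx)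
    rw [mem_roots h0]
    exact sW.torsion_root h.crv h.hp (by have := h.hp37; omega) P (h.mem_T.1 hP).1 (h.mem_T.1 hP).2
  have hcard : Multiset.card ψ.roots ≤ Multiset.card S.val := by
    refine (card_roots' ψ).trans ?_
    rw [hd, Finset.card_val]; omega
  have hr := Multiset.eq_of_le_of_card_le hsub hcard
  have hfac := C_leadingCoeff_mul_prod_multiset_X_sub_C (p := ψ) (by
    rw [← hr, hd, Finset.card_val]; omega)
  rw [← hr, hl] at hfac
  rw [hpr (fun x => Polynomial.X - C x), ← hfac]
  rw [mul_pow, C_pow]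
  rfl

/-- the norm as an absolute value -/
noncomputable def nv (Ω : Type*) [NormedField Ω] : AbsoluteValue Ω ℝ where
  toFun := norm
  map_mul' := norm_mul
  nonneg' := norm_nonneg
  eq_zero' := fun _ => norm_eq_zero
  add_le' := norm_add_le

theorem nv_na : IsNonarchimedean (nv Ω) := fun x y => IsUltrametricDist.norm_add_le_max x y

open Polynomial in
theorem gauss_lin (x : Ω) {c : ℝ} (hc : 0 < c) :
    (Polynomial.X - C x).gaussNorm (nv Ω) c = max ‖x‖ c := by
  apply le_antisymm
  · obtain ⟨i, hi⟩ := exists_eq_gaussNorm (nv Ω) c (Polynomial.X - C x)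
    rw [hi]
    rcases i with _ | _ | i
    · simp [nv]
    · simp [nv, coeff_C]
    · simp [coeff_X, coeff_C]
  · apply max_le
    · have := le_gaussNorm (nv Ω) (Polynomial.X - C x) hc.le 0
      simpa [nv] using this
    · have := le_gaussNorm (nv Ω) (Polynomial.X - C x) hc.le 1
      simpa [nv, coeff_C] using this

open Polynomial in
theorem gauss_psi (h : Loc p a b X Y) {c : ℝ} (hc : 0 < c) :
    ((sW a b).preΨ' p).gaussNorm (nv Ω) c ^ 2 = (p : ℝ)⁻¹ ^ 2 * ∏ P ∈ h.T, max ‖X P‖ c := by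
  rw [sq, ← gaussNorm_mul nv_na hc, ← sq, h.psi_sq, gaussNorm_mul nv_na hc, gaussNorm_C]
  congr 1
  · show ‖(p : Ω) ^ 2‖ = _
    rw [norm_pow, h.np]
  · have : ∀ s : Finset G, (∏ P ∈ s, (Polynomial.X - C (X P))).gaussNorm (nv Ω) c =
        ∏ P ∈ s, max ‖X P‖ c := by
      classical
      intro s
      induction s using Finset.induction_on with
      | empty =>
        rw [Finset.prod_empty, Finset.prod_empty, ← C_1, gaussNorm_C]; simp
      | insert P s hP ih =>
        rw [Finset.prod_insert hP, Finset.prod_insert hP, gaussNorm_mul nv_na hc, ih, gauss_lin _ hc]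
    exact this _

theorem psi_eval (h : Loc p a b X Y) (e : Ω) :
    ‖((sW a b).preΨ' p).eval e‖ ^ 2 = (p : ℝ)⁻¹ ^ 2 * ∏ P ∈ h.T, ‖e - X P‖ := by
  have := congrArg (fun q => ‖Polynomial.eval e q‖) h.psi_sq
  simp only [Polynomial.eval_pow, norm_pow, Polynomial.eval_mul, norm_mul, Polynomial.eval_C,
    Polynomial.eval_prod, Polynomial.eval_sub, Polynomial.eval_X, norm_prod, h.np] at this
  exact this

open Polynomial in
theorem prod_max (h : Loc p a b X Y) {e : Ω} (he : ‖e‖ ≤ 1) (h0 : e ^ 3 + a * e + b = 0)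
    (h1 : ‖3 * e ^ 2 + a‖ = 1) : ∏ P ∈ h.T, max ‖X P‖ 1 = (p : ℝ) ^ 2 := by
  have hu := psi_unit h.ha h.hb.le he h0 h1 p h.podd
  have hg := h.gauss_psi zero_lt_one
  have hg1 : ((sW a b).preΨ' p).gaussNorm (nv Ω) 1 = 1 := by
    apply le_antisymm
    · obtain ⟨i, hi⟩ := exists_eq_gaussNorm (nv Ω) 1 ((sW a b).preΨ' p)
      rw [hi, one_pow, mul_one]
      exact psi_coeff_le h.ha h.hb.le p i
    · by_contra hlt
      push Not at hlt
      have : ‖((sW a b).preΨ' p).eval e‖ < 1 := by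
        rw [eval_eq_sum_range]
        obtain ⟨i, hi, hle⟩ := IsUltrametricDist.exists_norm_finset_sum_le_of_nonempty
          (t := Finset.range (((sW a b).preΨ' p).natDegree + 1)) (by simp)
          (fun i => ((sW a b).preΨ' p).coeff i * e ^ i)
        refine hle.trans_lt ?_
        rw [norm_mul, norm_pow]
        have h5 := le_gaussNorm (nv Ω) ((sW a b).preΨ' p) zero_le_one i
        rw [one_pow, mul_one] at h5
        have h6 : ‖e‖ ^ i ≤ 1 := pow_le_one₀ (norm_nonneg _) he
        have h7 : ‖((sW a b).preΨ' p).coeff i‖ < 1 := lt_of_le_of_lt h5 hlt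
        calc _ ≤ ‖((sW a b).preΨ' p).coeff i‖ * 1 := by gcongr
          _ < 1 := by rwa [mul_one]
      linarith
  rw [hg1, one_pow] at hg
  have := h.hp0
  field_simp at hg
  linarith

end Loc


/-- Galois data -/
structure LocGal (p : ℕ) {Ω : Type*} [NormedField Ω] [IsUltrametricDist Ω] (a b : Ω) {G : Type*}
    [AddCommGroup G] (X Y : G → Ω) {H : Type*} [Group H] [MulSemiringAction H Ω]
    [DistribMulAction H G] (C : Subgroup H) : Prop extends Loc p a b X Y where
  isom : ∀ (σ : H) (z : Ω), ‖σ • z‖ = ‖z‖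
  res : ∀ (σ : H) (z : Ω), ‖z‖ ≤ 1 → ‖σ • z - z‖ < 1
  fix : ∀ z : Ω, z ≠ 0 → (∀ σ : H, σ • z = z) → ∃ k : ℤ, ‖z‖ ^ 6 = (p : ℝ) ^ k
  eqv : ∀ (σ : H) (P : G), X (σ • P) = σ • X P
  fa : ∀ σ : H, σ • a = a
  fb : ∀ σ : H, σ • b = b
  c1 : ∀ σ τ : H, σ ∉ C → τ ∉ C → σ⁻¹ * τ ∈ C
  c2 : ∀ σ ∈ C, ∀ P : G, P ≠ 0 → p • P = 0 → ∀ n : ℕ, σ • P = n • P →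
    ∀ Q : G, p • Q = 0 → σ • Q = n • Q

namespace LocGal
open Ultra
variable {p : ℕ} {Ω : Type*} [NormedField Ω] [IsUltrametricDist Ω] [CharZero Ω] {a b : Ω}
  {G : Type*} [AddCommGroup G] {X Y : G → Ω} {H : Type*} [Group H] [MulSemiringAction H Ω]
    [DistribMulAction H G] {C : Subgroup H}

theorem norm2 (h : LocGal p a b X Y C) {x : Ω} (hx : x ≠ 0) (hf : ∀ σ ∈ C, σ • x = x) :
    ∃ k : ℤ, ‖x‖ ^ 12 = (p : ℝ) ^ k := by
  by_cases hC : ∀ τ : H, τ ∈ C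
  · obtain ⟨k, hk⟩ := h.fix x hx (fun σ => hf σ (hC σ))
    refine ⟨k * 2, ?_⟩
    rw [show 12 = 6 * 2 from rfl, pow_mul, hk, _root_.zpow_mul]; rfl
  · push Not at hC
    obtain ⟨τ, hτ⟩ := hC
    have hz : ∀ σ : H, σ • (x * τ • x) = x * τ • x := by
      intro σ
      rw [smul_mul']
      by_cases hσ : σ ∈ C
      · rw [hf σ hσ]
        congr 1
        have h1 : σ * τ ∉ C := fun hc => hτ (by
          have := C.mul_mem (C.inv_mem hσ) hc
          rwa [inv_mul_cancel_left] at this)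
        have h2 := hf _ (h.c1 τ (σ * τ) hτ h1)
        have h3 := congrArg (fun y => τ • y) h2
        simp only [← mul_smul, mul_inv_cancel_left] at h3
        rw [← mul_smul]; exact h3
      · have h2 := hf _ (h.c1 τ σ hτ hσ)
        have h3 := congrArg (fun y => τ • y) h2
        simp only [← mul_smul, mul_inv_cancel_left] at h3
        have h4 : σ⁻¹ ∉ C := fun hc => hσ (by simpa using C.inv_mem hc)
        have h5 := hf _ (h.c1 σ⁻¹ τ h4 hτ)
        rw [inv_inv] at h5
        rw [h3, ← mul_smul, h5, mul_comm]
    have hτx : τ • x ≠ 0 := fun h0 => hx ((smul_eq_zero_iff_eq τ).1 h0)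
    obtain ⟨k, hk⟩ := h.fix _ (mul_ne_zero hx hτx) hz
    refine ⟨k, ?_⟩
    rw [← hk, norm_mul, h.isom]; ring

theorem sT (h : LocGal p a b X Y C) {P : G} (σ : H) (hP : P ∈ h.T) : σ • P ∈ h.T := by
  rw [Loc.mem_T] at hP ⊢
  refine ⟨fun h0 => hP.1 ((smul_eq_zero_iff_eq σ).1 h0), ?_⟩
  rw [smul_comm, hP.2, smul_zero]

theorem smulT (h : Loc p a b X Y) {P : G} (hP : P ∈ h.T) {n : ℕ} (hn : ¬ p ∣ n) : n • P ∈ h.T := by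
  rw [Loc.mem_T] at hP ⊢
  haveI := Fact.mk h.hp
  refine ⟨fun h0 => hn ?_, ?_⟩
  · rw [← addOrderOf_eq_prime hP.2 hP.1]; exact addOrderOf_dvd_of_nsmul_eq_zero h0
  · rw [smul_comm, hP.2, smul_zero]

theorem ndvd (h : Loc p a b X Y) {P : G} (hP : P ∈ h.T) {n : ℕ} (hn : n • P ≠ 0) : ¬ p ∣ n := by
  rintro ⟨m, rfl⟩
  rw [Loc.mem_T] at hP
  apply hn
  rw [mul_comm, mul_smul, hP.2, smul_zero]

theorem norm_smul (h : Loc p a b X Y) {P : G} (hP : P ∈ h.T) (h1 : 1 < ‖X P‖) {n : ℕ}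
    (hn : ¬ p ∣ n) : ‖X (n • P)‖ = ‖X P‖ :=
  h.crv.smul_norm h.n2 h.ha h.hb.le h1 (h.mem_T.1 hP).1 h.hp (h.mem_T.1 hP).2 hn

/-- if a multiple is near zero then so is the point -/
theorem norm_smul' (h : Loc p a b X Y) {P : G} (hP : P ∈ h.T) {n : ℕ}
    (hn : ¬ p ∣ n) (h1 : 1 < ‖X (n • P)‖) : 1 < ‖X P‖ := by
  have hc : Nat.Coprime n p := ((Nat.Prime.coprime_iff_not_dvd h.hp).2 hn).symm
  obtain ⟨m, -, hm⟩ := Nat.exists_mul_mod_eq_one_of_coprime hc h.hp.one_lt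
  have : m • (n • P) = P := by
    rw [← mul_smul, mul_comm, ← Nat.mod_add_div (n * m) p, hm, add_smul, one_smul, mul_comm, mul_smul,
      (h.mem_T.1 hP).2, smul_zero, add_zero]
  have h2 := h.crv.smul_norm_le h.n2 h.ha h.hb.le h1 m (by rw [this]; exact (h.mem_T.1 hP).1)
  rw [this] at h2
  exact h1.trans_le h2

theorem k_pos (h : Loc p a b X Y) {r : ℝ} (hr : 1 < r) {k : ℤ} (hk : r = (p : ℝ) ^ k) :
    (p : ℝ) ≤ r := by
  have hp1 : (1 : ℝ) < p := by exact_mod_cast h.hp.one_lt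
  rw [hk] at hr ⊢
  have : 0 < k := by
    by_contra hc
    push Not at hc
    exact absurd hr (not_lt.2 (zpow_le_one_of_nonpos₀ hp1.le hc))
  calc (p : ℝ) = (p : ℝ) ^ (1 : ℤ) := (zpow_one _).symm
    _ ≤ _ := zpow_le_zpow_right₀ hp1.le (by omega)

/-- scalars case: F = T -/
theorem scal_all (h : LocGal p a b X Y C)
    (hprod : ∏ P ∈ h.T, max ‖X P‖ 1 = (p : ℝ) ^ 2) (hall : ∀ P ∈ h.T, 1 < ‖X P‖)
    (hsc : ∀ σ ∈ C, ∃ n : ℕ, ∀ Q : G, p • Q = 0 → σ • Q = n • Q) : False := by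
  classical
  have hp1 : (1 : ℝ) < p := by exact_mod_cast h.hp.one_lt
  have hp37 := h.hp37
  have key : ∀ P ∈ h.T, (p : ℝ) ≤ ‖X P‖ ^ (12 * (p - 1)) := by
    intro P hP
    have hz : ∀ n ∈ Finset.Ico 1 p, ‖X (n • P)‖ = ‖X P‖ := fun n hn =>
      norm_smul h.toLoc hP (hall P hP) (Nat.not_dvd_of_pos_of_lt (Finset.mem_Ico.1 hn).1
        (Finset.mem_Ico.1 hn).2)
    have hX0 : ∀ n ∈ Finset.Ico 1 p, X (n • P) ≠ 0 := fun n hn h0 => by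
      have := hz n hn
      rw [h0, norm_zero] at this
      linarith [hall P hP]
    have hf : ∀ σ ∈ C, σ • (∏ n ∈ Finset.Ico 1 p, X (n • P)) = ∏ n ∈ Finset.Ico 1 p, X (n • P) := by
      intro σ hσ
      obtain ⟨m, hm⟩ := hsc σ hσ
      have hmP := hm P (h.mem_T.1 hP).2
      have hpm : ¬ p ∣ m := ndvd h.toLoc hP (by
        rw [← hmP]; exact (h.mem_T.1 (h.sT σ hP)).1)
      rw [Finset.smul_prod']
      have hmem : ∀ n ∈ Finset.Ico 1 p, (n * m) % p ∈ Finset.Ico 1 p := by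
        intro n hn
        rw [Finset.mem_Ico] at hn ⊢
        refine ⟨Nat.pos_of_ne_zero (fun h0 => ?_), Nat.mod_lt _ h.hp.pos⟩
        rcases (Nat.Prime.dvd_mul h.hp).1 (Nat.dvd_of_mod_eq_zero h0) with h1 | h1
        · exact Nat.not_dvd_of_pos_of_lt hn.1 hn.2 h1
        · exact hpm h1
      have hinj : ∀ n n' (hn : n ∈ Finset.Ico 1 p) (hn' : n' ∈ Finset.Ico 1 p),
          (n * m) % p = (n' * m) % p → n = n' := by
        intro n n' hn hn' he
        rw [Finset.mem_Ico] at hn hn'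
        have : n * m ≡ n' * m [MOD p] := he
        have hc : Nat.gcd p m = 1 := (Nat.Prime.coprime_iff_not_dvd h.hp).2 hpm
        have := Nat.ModEq.cancel_right_of_coprime hc this
        exact Nat.ModEq.eq_of_lt_of_lt this hn.2 hn'.2
      refine Finset.prod_bij (fun n _ => (n * m) % p) hmem (fun n hn n' hn' => hinj n n' hn hn') ?_ ?_
      · intro b hb
        obtain ⟨a', ha', e'⟩ := Finset.surj_on_of_inj_on_of_card_le (s := Finset.Ico 1 p)
          (t := Finset.Ico 1 p) (fun n _ => (n * m) % p) hmem hinj le_rfl b hb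
        exact ⟨a', ha', e'.symm⟩
      · intro n hn
        rw [← h.eqv, smul_comm, hmP, ← mul_smul]
        congr 1
        conv_lhs => rw [← Nat.mod_add_div (n * m) p]
        rw [add_smul, mul_comm p, mul_smul, (h.mem_T.1 hP).2, smul_zero, add_zero]
    obtain ⟨k, hk⟩ := h.norm2 (Finset.prod_ne_zero_iff.2 hX0) hf
    rw [norm_prod, Finset.prod_congr rfl hz, Finset.prod_const, Nat.card_Ico, ← pow_mul,
      mul_comm] at hk
    exact k_pos h.toLoc (one_lt_pow₀ (hall P hP) (by omega)) hk
  have h1 : (∏ P ∈ h.T, max ‖X P‖ 1) ^ (12 * (p - 1)) = ∏ P ∈ h.T, ‖X P‖ ^ (12 * (p - 1)) := by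
    rw [← Finset.prod_pow]
    exact Finset.prod_congr rfl (fun P hP => by rw [max_eq_left (hall P hP).le])
  have h2 : (p : ℝ) ^ (p ^ 2 - 1) ≤ ∏ P ∈ h.T, ‖X P‖ ^ (12 * (p - 1)) := by
    rw [← h.card_T, ← Finset.prod_const]
    exact Finset.prod_le_prod (fun _ _ => h.hp0.le) key
  rw [← h1, hprod, ← pow_mul] at h2
  have h3 := (pow_le_pow_iff_right₀ hp1).1 h2
  have h4 : p ^ 2 ≤ 24 * p := by omega
  have h5 : 38 * p ≤ p ^ 2 := by rw [sq]; exact Nat.mul_le_mul_right p hp37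
  omega

/-- sign case: F = L -/
theorem sign_line (h : LocGal p a b X Y C)
    (hprod : ∏ P ∈ h.T, max ‖X P‖ 1 = (p : ℝ) ^ 2)
    (hcard : (h.T.filter (fun P => 1 < ‖X P‖)).card = p - 1)
    (hsc : ∀ σ ∈ C, ∀ Q ∈ h.T, X (σ • Q) = X Q) : False := by
  have hp1 : (1 : ℝ) < p := by exact_mod_cast h.hp.one_lt
  have hp37 := h.hp37
  have key : ∀ P ∈ h.T.filter (fun P => 1 < ‖X P‖), (p : ℝ) ≤ (max ‖X P‖ 1) ^ 12 := by
    intro P hP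
    rw [Finset.mem_filter] at hP
    rw [max_eq_left hP.2.le]
    have hx : X P ≠ 0 := fun h0 => by
      have := hP.2
      rw [h0, norm_zero] at this; linarith
    obtain ⟨k, hk⟩ := h.norm2 hx (fun σ hσ => by rw [← h.eqv]; exact hsc σ hσ P hP.1)
    exact k_pos h.toLoc (one_lt_pow₀ hP.2 (by omega)) hk
  have h2 : (p : ℝ) ^ (p - 1) ≤ ∏ P ∈ h.T.filter (fun P => 1 < ‖X P‖), (max ‖X P‖ 1) ^ 12 := by
    rw [← hcard, ← Finset.prod_const]
    exact Finset.prod_le_prod (fun _ _ => h.hp0.le) key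
  have h1 : ∏ P ∈ h.T.filter (fun P => 1 < ‖X P‖), max ‖X P‖ 1 = ∏ P ∈ h.T, max ‖X P‖ 1 := by
    apply Finset.prod_filter_of_ne
    intro P _ hne
    by_contra hc
    exact hne (max_eq_right (not_lt.1 hc))
  rw [Finset.prod_pow, h1, hprod, ← pow_mul] at h2
  have h3 := (pow_le_pow_iff_right₀ hp1).1 h2
  omega

/-- torsion near -/
def nearT (h : Loc p a b X Y) (S : Set ℝ)
    (hS : ∀ r ∈ S, 1 < r) (hS2 : ∀ r ∈ S, ∀ s, r ≤ s → s ∈ S) : AddSubgroup G :=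
  h.crv.near h.n2 h.ha h.hb.le S hS hS2 ⊓ (nsmulAddMonoidHom (α := G) p).ker

theorem mem_nearT (h : Loc p a b X Y) (S : Set ℝ)
    (hS : ∀ r ∈ S, 1 < r) (hS2 : ∀ r ∈ S, ∀ s, r ≤ s → s ∈ S) {P : G} (hP : P ∈ h.T) :
    P ∈ nearT h S hS hS2 ↔ ‖X P‖ ∈ S := by
  constructor
  · rintro ⟨h1, h2⟩
    exact Or.resolve_left h1 (h.mem_T.1 hP).1
  · intro h1
    exact ⟨Or.inr h1, (h.mem_T.1 hP).2⟩

theorem nearT_T (h : Loc p a b X Y) (S : Set ℝ)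
    (hS : ∀ r ∈ S, 1 < r) (hS2 : ∀ r ∈ S, ∀ s, r ≤ s → s ∈ S) {P : G}
    (hP : P ∈ nearT h S hS hS2) (h0 : P ≠ 0) : P ∈ h.T := h.mem_T.2 ⟨h0, hP.2⟩

theorem card_nearT (h : Loc p a b X Y) (S : Set ℝ)
    (hS : ∀ r ∈ S, 1 < r) (hS2 : ∀ r ∈ S, ∀ s, r ≤ s → s ∈ S)
    {P Q : G} (hP : P ∈ h.T) (hPS : ‖X P‖ ∈ S) (hQ : Q ∈ h.T) (hQS : ‖X Q‖ ∉ S) :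
    Nat.card (nearT h S hS hS2) = p := by
  set K := (nsmulAddMonoidHom (α := G) p).ker with hK
  have hKc : Nat.card K = p ^ 2 := h.card
  have hle : nearT h S hS hS2 ≤ K := inf_le_right
  have hd : Nat.card (nearT h S hS hS2) ∣ p ^ 2 := hKc ▸ AddSubgroup.card_dvd_of_le hle
  have hfin : Finite K := Nat.finite_of_card_ne_zero (by rw [hKc]; exact pow_ne_zero _ h.hp.ne_zero)
  have hfin2 : Finite (nearT h S hS hS2) := Finite.of_injective _ (AddSubgroup.inclusion_injective hle)
  obtain ⟨k, hk, he⟩ := (Nat.dvd_prime_pow h.hp).1 hd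
  have hPm := (mem_nearT h S hS hS2 hP).2 hPS
  have hQm : Q ∉ nearT h S hS hS2 := fun hc => hQS ((mem_nearT h S hS hS2 hQ).1 hc)
  interval_cases k
  · exfalso
    have := (AddSubgroup.card_eq_one).1 (by simpa using he)
    rw [this] at hPm
    exact (h.mem_T.1 hP).1 (by simpa using hPm)
  · simpa using he
  · exfalso
    have := AddSubgroup.eq_of_le_of_card_ge hle (by rw [he, hKc])
    rw [this] at hQm
    exact hQm (h.mem_T.1 hQ).2

theorem stab (h : LocGal p a b X Y C) (S : Set ℝ)
    (hS : ∀ r ∈ S, 1 < r) (hS2 : ∀ r ∈ S, ∀ s, r ≤ s → s ∈ S)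
    {P Q : G} (hP : P ∈ h.T) (hPS : ‖X P‖ ∈ S) (hQ : Q ∈ h.T) (hQS : ‖X Q‖ ∉ S) :
    ∀ σ ∈ C, ∃ n : ℕ, ∀ Q : G, p • Q = 0 → σ • Q = n • Q := by
  intro σ hσ
  haveI := Fact.mk h.hp
  have hc := card_nearT h.toLoc S hS hS2 hP hPS hQ hQS
  have h1 := (mem_nearT h.toLoc S hS hS2 hP).2 hPS
  have h2 := (mem_nearT h.toLoc S hS hS2 (h.sT σ hP)).2 (by rwa [h.eqv, h.isom])
  have h3 := mem_zmultiples_of_prime_card hc (g := (⟨P, h1⟩ : nearT h.toLoc S hS hS2)) (g' := ⟨σ • P, h2⟩)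
    (fun h0 => (h.mem_T.1 hP).1 (congrArg Subtype.val h0))
  obtain ⟨m, hm⟩ := AddSubgroup.mem_zmultiples_iff.1 h3
  have hm' : m • P = σ • P := congrArg Subtype.val hm
  refine ⟨(m % p).toNat, h.c2 σ hσ P (h.mem_T.1 hP).1 (h.mem_T.1 hP).2 _ ?_⟩
  rw [← hm', ← natCast_zsmul, Int.toNat_of_nonneg (Int.emod_nonneg _ (by exact_mod_cast h.hp.ne_zero))]
  conv_lhs => rw [← Int.emod_add_mul_ediv m p]
  rw [add_smul, mul_comm (p : ℤ), mul_smul, natCast_zsmul, (h.mem_T.1 hP).2, smul_zero, add_zero]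

end LocGal


namespace Loc
open Ultra
variable {p : ℕ} {Ω : Type*} [NormedField Ω] [IsUltrametricDist Ω] [CharZero Ω] {a b : Ω}
  {G : Type*} [AddCommGroup G] {X Y : G → Ω}

open Polynomial in
theorem exists_w (h : Loc p a b X Y) (a' b' : O Ω) (ha : (a' : Ω) = a) (hb : (b' : Ω) = b) :
    ∃ w : Polynomial (O Ω), w.Monic ∧ 2 * w.natDegree + 3 = 3 * p ^ 2 ∧
      CharPAlg.cub a' b' * w ^ 2 = ((sW a' b').Φ p) ^ 3
        + C a' * (sW a' b').Φ p * ((sW a' b').preΨ' p) ^ 4 + C b' * ((sW a' b').preΨ' p) ^ 6 := by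
  subst ha hb
  have hp37 := h.hp37
  have hid : CharPAlg.cub a' b' * (sW.omg a' b' p) ^ 2 = ((sW a' b').Φ p) ^ 3
        + C a' * (sW a' b').Φ p * ((sW a' b').preΨ' p) ^ 4 + C b' * ((sW a' b').preΨ' p) ^ 6 := by
    apply Polynomial.map_injective (O Ω).subtype Subtype.val_injective
    have := sW.curve_identity h.crv h.inf (n := p) (by omega) h.podd
    simp only [sW.omg, psi_map, Phi_map] at this
    simpa [CharPAlg.cub, sW.omg] using this
  have hdψ : ((sW a' b').preΨ' p).natDegree ≤ (p ^ 2 - 1) / 2 := by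
    have := (sW a' b').natDegree_preΨ'_le p
    rwa [if_neg (Nat.not_even_iff_odd.2 h.podd)] at this
  have hdφ : ((sW a' b').Φ p).natDegree = p ^ 2 := by
    simpa using (sW a' b').natDegree_Φ (p : ℤ)
  have hφ : ((sW a' b').Φ p).Monic := (sW a' b').leadingCoeff_Φ p
  set φ := (sW a' b').Φ p
  set ψ := (sW a' b').preΨ' p
  have hpp : 38 * 38 ≤ p ^ 2 := by rw [sq]; exact Nat.mul_le_mul hp37 hp37
  have hd1 : (C a' * φ * ψ ^ 4).natDegree < 3 * p ^ 2 := by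
    refine lt_of_le_of_lt (natDegree_mul_le.trans (add_le_add (natDegree_C_mul_le _ _)
      (natDegree_pow_le (p := ψ) (n := 4)))) ?_
    rw [hdφ]
    omega
  have hd2 : (C b' * ψ ^ 6).natDegree < 3 * p ^ 2 := by
    refine lt_of_le_of_lt ((natDegree_C_mul_le _ _).trans (natDegree_pow_le (p := ψ) (n := 6))) ?_
    omega
  have hd3 : (φ ^ 3).natDegree = 3 * p ^ 2 := by rw [hφ.natDegree_pow, hdφ]
  have hlt : (C a' * φ * ψ ^ 4 + C b' * ψ ^ 6).degree < (φ ^ 3).degree := by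
    apply degree_lt_degree
    rw [hd3]
    exact lt_of_le_of_lt (natDegree_add_le _ _) (max_lt hd1 hd2)
  have hm : (φ ^ 3 + (C a' * φ * ψ ^ 4 + C b' * ψ ^ 6)).Monic := (hφ.pow 3).add_of_left hlt
  have hn : (φ ^ 3 + (C a' * φ * ψ ^ 4 + C b' * ψ ^ 6)).natDegree = 3 * p ^ 2 := by
    rw [natDegree_add_eq_left_of_degree_lt hlt, hd3]
  rw [← add_assoc, ← hid] at hm hn
  have hcm := CharPAlg.cub_monic a' b'
  have hcd : (CharPAlg.cub a' b').natDegree = 3 := by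
    unfold CharPAlg.cub; compute_degree!
  have hlc : (sW.omg a' b' p).leadingCoeff ^ 2 = 1 := by
    have : (CharPAlg.cub a' b' * (sW.omg a' b' p) ^ 2).leadingCoeff = 1 := hm
    rwa [leadingCoeff_mul, hcm.leadingCoeff, one_mul, leadingCoeff_pow] at this
  have hdeg : 2 * (sW.omg a' b' p).natDegree + 3 = 3 * p ^ 2 := by
    have h0 : sW.omg a' b' p ≠ 0 := by
      intro h0; rw [h0] at hlc; simp at hlc
    rw [natDegree_mul hcm.ne_zero (pow_ne_zero _ h0), natDegree_pow, hcd] at hn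
    omega
  have hor : (sW.omg a' b' p).leadingCoeff = 1 ∨ (sW.omg a' b' p).leadingCoeff = -1 := by
    apply sq_eq_sq_iff_eq_or_eq_neg.1; rw [hlc, one_pow]
  rcases hor with h1 | h1
  · exact ⟨_, h1, hdeg, hid⟩
  · refine ⟨-sW.omg a' b' p, ?_, ?_, ?_⟩
    · rw [Monic, leadingCoeff_neg, h1, neg_neg]
    · rw [natDegree_neg]; exact hdeg
    · rw [← hid]; ring

open Polynomial in
theorem equal_case (h : Loc p a b X Y) (hdisc : ‖4 * a ^ 3 + 27 * b ^ 2‖ = 1) (ha1 : ‖a‖ < 1)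
    (ha3 : (p : ℝ)⁻¹ ^ 2 ≤ ‖a‖ ^ 3) {ρ : ℝ} (hρ : 1 < ρ) (heq : ∀ P ∈ h.T, ‖X P‖ = ρ)
    (hprod : ∏ P ∈ h.T, max ‖X P‖ 1 = (p : ℝ) ^ 2) : False := by
  have hp37 := h.hp37
  haveI := Fact.mk h.hp
  obtain ⟨m, hm⟩ := h.podd
  have hρ0 : 0 < ρ := by linarith
  have hpow : ρ ^ (p ^ 2 - 1) = (p : ℝ) ^ 2 := by
    rw [← hprod, ← h.card_T, ← Finset.prod_const]
    exact Finset.prod_congr rfl (fun P hP => by rw [heq P hP, max_eq_left hρ.le])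
  have hp2 : p ^ 2 - 1 = (m * (p + 1)) * 2 := by
    have : p ^ 2 = (m * (p + 1)) * 2 + 1 := by rw [hm]; ring
    omega
  have hpow1 : ρ ^ (m * (p + 1)) = p := by
    rw [hp2, pow_mul] at hpow
    exact (pow_left_inj₀ (by positivity) h.hp0.le two_ne_zero).1 hpow
  set r : ℝ := (ρ ^ (p * m))⁻¹ with hr
  have hm0 : 0 < m := by omega
  have hM0 : p * m ≠ 0 := Nat.mul_ne_zero h.hp.ne_zero hm0.ne'
  have hr0 : 0 < r := by positivity
  have hr1 : r < 1 := inv_lt_one_of_one_lt₀ (one_lt_pow₀ hρ hM0)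
  have hpr : ‖(p : Ω)‖ ≤ r := by
    rw [h.np, ← hpow1, hr]
    apply inv_anti₀ (by positivity)
    exact pow_le_pow_right₀ hρ.le (by rw [mul_comm]; exact Nat.mul_le_mul_left m (by omega))
  -- coefficients
  have hg : ((sW a b).preΨ' p).gaussNorm (nv Ω) ρ = 1 := by
    have h1 := h.gauss_psi hρ0
    have h2 : ∏ P ∈ h.T, max ‖X P‖ ρ = (p : ℝ) ^ 2 := by
      rw [← hprod]
      exact Finset.prod_congr rfl (fun P hP => by rw [heq P hP, max_self, max_eq_left hρ.le])
    rw [h2, ← mul_pow, inv_mul_cancel₀ h.hp0.ne', one_pow] at h1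
    exact (pow_eq_one_iff_of_nonneg (gaussNorm_nonneg _ _ hρ0.le) two_ne_zero).1 h1
  have hc : ∀ i, ‖((sW a b).preΨ' p).coeff i‖ ≤ (ρ ^ i)⁻¹ := by
    intro i
    have := le_gaussNorm (nv Ω) ((sW a b).preΨ' p) hρ0.le i
    rw [hg] at this
    have h2 : ‖((sW a b).preΨ' p).coeff i‖ * ρ ^ i ≤ 1 := this
    rw [← one_div, le_div_iff₀ (by positivity)]; exact h2
  have hc0 : ‖((sW a b).preΨ' p).coeff 0‖ = 1 := by
    have h1 := h.psi_eval 0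
    have h2 : ∏ P ∈ h.T, ‖0 - X P‖ = (p : ℝ) ^ 2 := by
      rw [← hprod]
      exact Finset.prod_congr rfl (fun P hP => by rw [zero_sub, norm_neg, heq P hP, max_eq_left hρ.le])
    rw [h2, ← mul_pow, inv_mul_cancel₀ h.hp0.ne', one_pow] at h1
    rw [coeff_zero_eq_eval_zero]
    exact (pow_eq_one_iff_of_nonneg (norm_nonneg _) two_ne_zero).1 h1
  let a' : O Ω := ⟨a, h.ha⟩
  let b' : O Ω := ⟨b, h.hb.le⟩
  obtain ⟨w, hw, hdw, hid⟩ := h.exists_w a' b' rfl rfl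
  let I := ball Ω r hr0.le
  let R := O Ω ⧸ I
  let π : O Ω →+* R := Ideal.Quotient.mk I
  have hπ : ∀ x : O Ω, π x = 0 ↔ ‖(x : Ω)‖ ≤ r := fun x => Ideal.Quotient.eq_zero_iff_mem
  have hu : ∀ x : O Ω, ‖(x : Ω)‖ = 1 → IsUnit (π x) := by
    intro x hx
    apply IsUnit.map
    have hx0 : (x : Ω) ≠ 0 := fun h0 => by rw [h0] at hx; simp at hx
    refine IsUnit.of_mul_eq_one (⟨(x : Ω)⁻¹, by rw [mem_O, norm_inv, hx, inv_one]⟩ : O Ω) ?_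
    exact Subtype.ext (mul_inv_cancel₀ hx0)
  haveI : Nontrivial R := by
    apply Ideal.Quotient.nontrivial_iff.2
    rw [Ne, Ideal.eq_top_iff_one]
    intro h1
    have : ‖((1 : O Ω) : Ω)‖ ≤ r := h1
    simp at this
    linarith
  haveI : CharP R p := by
    have h0 : (p : R) = 0 := by
      have := (hπ (p : O Ω)).2 (by simpa using hpr)
      simpa using this
    obtain ⟨q, hq⟩ := CharP.exists R
    have hd := (CharP.cast_eq_zero_iff R q p).1 h0
    rcases (Nat.dvd_prime h.hp).1 hd with rfl | rfl
    · exact absurd ‹CharP R 1› (by intro h1; exact (CharP.char_ne_one R 1) rfl)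
    · exact hq
  have hcψ : ∀ i, ((((sW a' b').preΨ' p).coeff i : O Ω) : Ω) = ((sW a b).preΨ' p).coeff i := by
    intro i
    have := psi_map a' b' p
    rw [show ((sW a b).preΨ' p) = _ from this, coeff_map]; rfl
  have key := CharPAlg.final (R := R) p (by omega) (π a') (π b') (by
      have := hu (4 * a' ^ 3 + 27 * b' ^ 2) hdisc
      rw [map_add, map_mul, map_mul, map_pow, map_pow] at this
      exact this) (w.map π) (((sW a' b').Φ p).map π) (((sW a' b').preΨ' p).map π)
    (hw.map π) (Monic.map π ((sW a' b').leadingCoeff_Φ p)) (by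
      rw [Polynomial.isUnit_iff_coeff_isUnit_isNilpotent]
      constructor
      · rw [coeff_map]; exact hu _ (by rw [hcψ]; exact hc0)
      · intro i hi
        rw [coeff_map]
        refine ⟨p * m, ?_⟩
        rw [← map_pow, hπ]
        push_cast
        rw [hcψ, norm_pow, hr, ← inv_pow]
        gcongr
        refine (hc i).trans ?_
        gcongr
        exact le_self_pow₀ hρ.le hi)
    (by
      have := congrArg (Polynomial.map π) hid
      simpa [CharPAlg.cub] using this)
    (by
      rw [Monic.natDegree_map ((sW a' b').leadingCoeff_Φ p)]
      simpa using (sW a' b').natDegree_Φ (p : ℤ))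
    (by rw [hw.natDegree_map]; exact hdw)
    (by
      have e1 : (p - 1) / 2 = m := by omega
      rw [e1]
      refine lt_of_le_of_lt (b := p * m - 1) ?_ (by omega)
      rw [natDegree_le_iff_coeff_eq_zero]
      intro i hi
      rw [coeff_map, hπ, hcψ]
      refine (hc i).trans ?_
      rw [hr]
      gcongr
      · exact hρ.le
      · omega)
    (by
      obtain ⟨n, hn⟩ := exists_pow_lt_of_lt_one hr0 ha1
      refine ⟨n, ?_⟩
      rw [← map_pow, hπ]
      push_cast
      rw [norm_pow]; exact hn.le)
  have ha2 : ‖a‖ ≤ r := (hπ a').1 key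
  have h3 : ‖a‖ ^ 3 ≤ r ^ 3 := by gcongr
  have h4 := ha3.trans h3
  rw [← hpow1, hr, ← inv_pow, ← inv_pow, ← pow_mul, ← pow_mul,
    pow_le_pow_iff_right_of_lt_one₀ (by positivity) (inv_lt_one_of_one_lt₀ hρ)] at h4
  nlinarith

end Loc


namespace LocGal
open Ultra
variable {p : ℕ} {Ω : Type*} [NormedField Ω] [IsUltrametricDist Ω] [CharZero Ω] {a b : Ω}
  {G : Type*} [AddCommGroup G] {X Y : G → Ω} {H : Type*} [Group H] [MulSemiringAction H Ω]
    [DistribMulAction H G] {C : Subgroup H}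

theorem mult_le (h : Loc p a b X Y) {P : G} (hP : P ∈ h.T) (h1 : ‖X P‖ ≤ 1) {m : ℕ}
    (hm : m • P ≠ 0) : ‖X (m • P)‖ ≤ 1 := by
  by_contra hc
  push Not at hc
  exact absurd (norm_smul' h hP (ndvd h hP hm) hc) (not_lt.2 h1)

theorem Yle (h : Loc p a b X Y) {P : G} (hP : P ∈ h.T) (h1 : ‖X P‖ ≤ 1) : ‖Y P‖ ≤ 1 := by
  have e := h.crv.eq P (h.mem_T.1 hP).1
  have : ‖Y P ^ 2‖ ≤ 1 := by
    rw [e]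
    refine add_le (add_le ?_ (mul_le_one h.ha h1)) h.hb.le
    rw [norm_pow]; exact pow_le_one₀ (norm_nonneg _) h1
  rw [norm_pow] at this
  exact (pow_le_one_iff_of_nonneg (norm_nonneg _) two_ne_zero).1 this

theorem subP (h : Loc p a b X Y) {P : G} (hP : P ∈ h.T) (n : ℕ) :
    n • P - P = (n + (p - 1)) • P := by
  have h1 := (h.mem_T.1 hP).2
  have hp : p = (p - 1) + 1 := by have := h.hp.pos; omega
  rw [hp, add_smul, one_smul] at h1
  rw [add_smul, eq_neg_of_add_eq_zero_left h1, sub_eq_add_neg]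

theorem Xeq_of (h : Loc p a b X Y) {P : G} (hP : P ∈ h.T) {n m : ℕ} (hm : ¬ p ∣ m)
    (hn : n • P ≠ 0)
    (he : X (n • (m • P)) = X (m • P)) : X (n • P) = X P := by
  have hm0 := smulT h hP hm
  have hnm : n • (m • P) ≠ 0 := (h.mem_T.1 (smulT h hm0 (ndvd h hP hn))).1
  haveI := Fact.mk h.hp
  have ho : addOrderOf P = p := addOrderOf_eq_prime (h.mem_T.1 hP).2 (h.mem_T.1 hP).1
  have canc : ∀ Q : G, p • Q = 0 → m • Q = 0 → Q = 0 := by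
    intro Q h1 h2
    by_contra h3
    exact (h.mem_T.1 (smulT h (h.mem_T.2 ⟨h3, h1⟩) hm)).1 h2
  have hpP := (h.mem_T.1 hP).2
  have hpn : p • n • P = 0 := by rw [smul_comm, hpP, smul_zero]
  rcases h.crv.inj _ _ hnm (h.mem_T.1 hm0).1 he with h1 | h1
  · have : n • P - P = 0 := canc _ (by rw [smul_sub, hpn, hpP, sub_zero]) (by
      rw [smul_sub, smul_comm, h1, sub_self])
    rw [sub_eq_zero.1 this]
  · have : n • P + P = 0 := canc _ (by rw [smul_add, hpn, hpP, add_zero]) (by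
      rw [smul_add, smul_comm, h1, neg_add_cancel])
    rw [eq_neg_of_add_eq_zero_left this, h.crv.negX]

theorem smooth (h : LocGal p a b X Y C) {P : G} (hP : P ∈ h.T) (h1 : ‖X P‖ ≤ 1)
    (hs : ‖Y P‖ = 1 ∨ ‖3 * X P ^ 2 + a‖ = 1) {σ : H} {n : ℕ} (hσ : σ • P = n • P) :
    X (n • P) = X P := by
  by_contra hne
  have hP0 := (h.mem_T.1 hP).1
  have hP' : n • P ∈ h.T := hσ ▸ h.sT σ hP
  have hP'0 := (h.mem_T.1 hP').1
  have hxx : ‖X (n • P) - X P‖ < 1 := by rw [← hσ, h.eqv]; exact h.res σ _ h1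
  have h1' : ‖X (n • P)‖ ≤ 1 := mult_le h.toLoc hP h1 hP'0
  have h2P : P + P ≠ 0 := fun h0 => h.ne_neg hP (eq_neg_of_add_eq_zero_left h0)
  have hd : X (n • P) - X P ≠ 0 := sub_ne_zero.2 hne
  have hd0 : 0 < ‖X (n • P) - X P‖ := norm_pos_iff.2 hd
  rcases (Yle h.toLoc hP h1).lt_or_eq with hy | hy
  · have hf := hs.resolve_left hy.ne
    have hY0 := h.crv.dblY P hP0 h2P
    have h3 := h.crv.dbl P hP0 h2P
    have h4 : 1 < ‖((3 * X P ^ 2 + a) / (2 * Y P)) ^ 2‖ := by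
      rw [norm_pow, norm_div, hf, norm_mul, h.n2, one_mul, one_div]
      exact one_lt_pow₀ ((one_lt_inv₀ (norm_pos_iff.2 hY0)).2 hy) two_ne_zero
    have h5 : ‖2 * X P‖ ≤ 1 := mul_le_one h.n2.le h1
    have h6 : 1 < ‖X (2 • P)‖ := by
      rw [two_smul, h3, sub_eq (h5.trans_lt h4)]; exact h4
    exact absurd h6 (not_lt.2 (mult_le h.toLoc hP h1 (by rwa [two_smul])))
  · have e1 := h.crv.eq P hP0
    have e2 := h.crv.eq _ hP'0
    set x := X P
    set x' := X (n • P)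
    set y := Y P
    set y' := Y (n • P)
    have hprod : ‖(y' - y) * (y' + y)‖ < 1 := by
      have : (y' - y) * (y' + y) = (x' ^ 2 + x' * x + x ^ 2 + a) * (x' - x) := by
        linear_combination e2 - e1
      rw [this]
      refine mul_lt_one ?_ hxx
      refine add_le (add_le (add_le ?_ (mul_le_one h1' h1)) ?_) h.ha
      · rw [sq]; exact mul_le_one h1' h1'
      · rw [sq]; exact mul_le_one h1 h1
    have h2y : ‖2 * y‖ = 1 := by rw [norm_mul, h.n2, hy, one_mul]
    have big : ∀ z : Ω, ‖z‖ = 1 → 1 < ‖(z / (x' - x)) ^ 2 - x' - x‖ := by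
      intro z hz
      have h4 : 1 < ‖(z / (x' - x)) ^ 2‖ := by
        rw [norm_pow, norm_div, hz, one_div]
        exact one_lt_pow₀ ((one_lt_inv₀ hd0).2 hxx) two_ne_zero
      rw [sub_sub, sub_eq ((add_le h1' h1).trans_lt h4)]
      exact h4
    rw [norm_mul] at hprod
    by_cases hc : ‖y' + y‖ < 1
    · have hz : ‖y' - y‖ = 1 := by
        have : ‖2 * y - (y' + y)‖ = 1 := by rw [sub_eq (by rwa [h2y]), h2y]
        rw [← this, ← norm_neg]; congr 1; ring
      have h5 := h.crv.add (n • P) P hP'0 hP0 hne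
      have h6 := big _ hz
      rw [← h5] at h6
      have h7 : n • P + P = (n + 1) • P := by rw [add_smul, one_smul]
      rw [h7] at h6
      refine absurd h6 (not_lt.2 (mult_le h.toLoc hP h1 ?_))
      rw [← h7]
      intro h0
      apply hne
      show X (n • P) = X P
      rw [eq_neg_of_add_eq_zero_left h0, h.crv.negX]
    · push Not at hc
      have hz' : ‖y' - y‖ < 1 := by
        by_contra hcc
        push Not at hcc
        nlinarith
      have hz : ‖y' + y‖ = 1 := by
        have : ‖2 * y + (y' - y)‖ = 1 := by rw [add_eq (by rwa [h2y]), h2y]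
        rw [← this]; congr 1; ring
      have h5 := h.crv.sub (n • P) P hP'0 hP0 hne
      have h6 := big _ hz
      rw [← h5, subP h.toLoc hP] at h6
      refine absurd h6 (not_lt.2 (mult_le h.toLoc hP h1 ?_))
      rw [← subP h.toLoc hP]
      intro h0
      apply hne
      show X (n • P) = X P
      rw [sub_eq_zero.1 h0]

/-- singular points are near `t` -/
theorem sing (h : Loc p a b X Y) (ha : ‖a‖ = 1) {P : G} (hP : P ∈ h.T) (h1 : ‖X P‖ ≤ 1)
    (hy : ‖Y P‖ < 1) (hf : ‖3 * X P ^ 2 + a‖ < 1) : ‖X P - -3 * b / (2 * a)‖ < 1 := by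
  have e := h.crv.eq P (h.mem_T.1 hP).1
  have ha0 : a ≠ 0 := by intro h0; rw [h0] at ha; simp at ha
  have h2 : ‖2 * a‖ = 1 := by rw [norm_mul, h.n2, ha, one_mul]
  have e2 : X P - -3 * b / (2 * a) = (3 * (Y P * Y P) - X P * (3 * X P ^ 2 + a)) / (2 * a) := by
    field_simp
    linear_combination (-3) * e
  rw [e2, norm_div, h2, div_one]
  exact sub_lt (mul_lt_one h.n3.le (mul_lt_one hy.le hy)) (mul_lt_one h1 hf)

theorem red (h : LocGal p a b X Y C) (ha : ‖a‖ = 1) {P : G} (hP : P ∈ h.T) (h1 : ‖X P‖ ≤ 1)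
    {σ : H} {n : ℕ} (hσ : ∀ Q ∈ h.T, σ • Q = n • Q) {m : ℕ} (hm : m • P ≠ 0)
    (ht : 1 ≤ ‖X (m • P) - -3 * b / (2 * a)‖) : X (n • P) = X P := by
  have hpm := ndvd h.toLoc hP hm
  have hR := smulT h.toLoc hP hpm
  have hR1 := mult_le h.toLoc hP h1 hm
  refine Xeq_of h.toLoc hP hpm ?_ (h.smooth hR hR1 ?_ (hσ _ hR))
  · rw [← hσ P hP]; exact (h.mem_T.1 (h.sT σ hP)).1
  · by_contra hc
    push Not at hc
    have hy := (Yle h.toLoc hR hR1).lt_of_ne hc.1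
    have hf : ‖3 * X (m • P) ^ 2 + a‖ ≤ 1 :=
      add_le (mul_le_one h.n3.le (by rw [norm_pow]; exact pow_le_one₀ (norm_nonneg _) hR1)) h.ha
    exact absurd (sing h.toLoc ha hR hR1 hy (hf.lt_of_ne hc.2)) (not_lt.2 ht)

end LocGal


namespace LocGal
open Ultra
variable {p : ℕ} {Ω : Type*} [NormedField Ω] [IsUltrametricDist Ω] [CharZero Ω] {a b : Ω}
  {G : Type*} [AddCommGroup G] {X Y : G → Ω} {H : Type*} [Group H] [MulSemiringAction H Ω]
    [DistribMulAction H G] {C : Subgroup H}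

theorem node_alg {A e₁ e₀ q r y z : Ω} {δ : ℝ} (h2 : ‖(2 : Ω)‖ = 1) (hA : ‖A‖ = 1) (h1 : ‖e₁‖ = δ)
    (h0 : ‖e₀‖ = δ) (hδ1 : δ < 1) (hδ0 : 0 < δ) (hq1 : ‖q‖ < 1) (hqr : ‖r‖ = ‖q‖)
    (hqδ : δ < ‖q‖ ^ 2) (hyq : ‖y ^ 2 - A * q ^ 2‖ < ‖q‖ ^ 2) (hyz : ‖y * r - z * q‖ < ‖q‖ ^ 2) :
    ‖q * r * (q + r) + e₁ * (q + r) + 2 * e₀ + 2 * A * q * r + 2 * y * z‖ = ‖q‖ ^ 2 := by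
  have hq0 : 0 < ‖q‖ := by
    by_contra hc
    have : ‖q‖ = 0 := le_antisymm (not_lt.1 hc) (norm_nonneg _)
    rw [this] at hqδ; norm_num at hqδ; linarith
  have hq : q ≠ 0 := norm_pos_iff.1 hq0
  have hy1 : ‖y‖ = ‖q‖ := by
    have : ‖y ^ 2‖ = ‖q‖ ^ 2 := by
      have e : y ^ 2 = A * q ^ 2 + (y ^ 2 - A * q ^ 2) := by ring
      rw [e, add_eq (by rw [norm_mul, norm_pow, hA, one_mul]; exact hyq), norm_mul, norm_pow, hA, one_mul]
    rw [norm_pow] at this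
    exact (pow_left_inj₀ (norm_nonneg _) (norm_nonneg _) two_ne_zero).1 this
  have hyz2 : ‖y * z - A * q * r‖ < ‖q‖ ^ 2 := by
    have e : y * z - A * q * r = ((y ^ 2 - A * q ^ 2) * r - y * (y * r - z * q)) / q := by
      field_simp; ring
    rw [e, norm_div, div_lt_iff₀ hq0]
    apply sub_lt
    · rw [norm_mul, hqr]; gcongr
    · rw [norm_mul, hy1, mul_comm]; gcongr
  have hs : ‖q + r‖ ≤ ‖q‖ := add_le le_rfl hqr.le
  have e : q * r * (q + r) + e₁ * (q + r) + 2 * e₀ + 2 * A * q * r + 2 * y * z =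
      2 * 2 * A * q * r + (q * r * (q + r) + e₁ * (q + r) + 2 * e₀ + 2 * (y * z - A * q * r)) := by ring
  have hn : ‖2 * 2 * A * q * r‖ = ‖q‖ ^ 2 := by
    simp only [norm_mul, h2, hA, hqr]; ring
  rw [e, add_eq, hn]
  rw [hn]
  refine add_lt (add_lt (add_lt ?_ ?_) ?_) ?_
  · simp only [norm_mul, hqr]
    calc ‖q‖ * ‖q‖ * ‖q + r‖ ≤ ‖q‖ * ‖q‖ * ‖q‖ := by gcongr
      _ < ‖q‖ * ‖q‖ * 1 := by gcongr
      _ = ‖q‖ ^ 2 := by ring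
  · rw [norm_mul, h1]
    have : ‖q + r‖ < 1 := hs.trans_lt hq1
    nlinarith [norm_nonneg (q + r)]
  · rw [norm_mul, h2, h0, one_mul]; exact hqδ
  · rw [norm_mul, h2, one_mul]; exact hyz2

theorem node (h : LocGal p a b X Y C) (ha : ‖a‖ = 1) (hδ1 : ‖4 * a ^ 3 + 27 * b ^ 2‖ < 1)
    (hδ0 : 4 * a ^ 3 + 27 * b ^ 2 ≠ 0) {P : G} (hP : P ∈ h.T) (h1 : ‖X P‖ ≤ 1)
    (hy : ‖Y P‖ < 1) (hf : ‖3 * X P ^ 2 + a‖ < 1)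
    {σ : H} {n : ℕ} (hσ : ∀ Q ∈ h.T, σ • Q = n • Q) : X (n • P) = X P := by
  by_contra hne
  have ha0 : a ≠ 0 := by intro h0; rw [h0] at ha; simp at ha
  have hred := fun m hm ht => hne (h.red (m := m) ha hP h1 hσ hm ht)
  have hx := sing h.toLoc ha hP h1 hy hf
  have hP0 := (h.mem_T.1 hP).1
  have hP' : n • P ∈ h.T := hσ P hP ▸ h.sT σ hP
  have hP'0 := (h.mem_T.1 hP').1
  have h2P : P + P ≠ 0 := fun h0 => h.ne_neg hP (eq_neg_of_add_eq_zero_left h0)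
  set t := -3 * b / (2 * a) with ht
  have h20 : (2 : Ω) ≠ 0 := two_ne_zero
  have ht1 : ‖t‖ = 1 := by
    rw [ht, norm_div, norm_mul, norm_mul, norm_neg, h.n3, h.n2, h.hb, ha]; norm_num
  have hA : ‖3 * t‖ = 1 := by rw [norm_mul, h.n3, ht1, one_mul]
  have e1e : 3 * t ^ 2 + a = (4 * a ^ 3 + 27 * b ^ 2) / (2 * 2 * a * a) := by
    rw [ht]; field_simp; ring
  have e0e : t ^ 3 + a * t + b = - b * (4 * a ^ 3 + 27 * b ^ 2) / (2 * 2 * 2 * a * a * a) := by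
    rw [ht]; field_simp; ring
  have n1 : ‖3 * t ^ 2 + a‖ = ‖4 * a ^ 3 + 27 * b ^ 2‖ := by
    rw [e1e, norm_div]; simp only [norm_mul, h.n2, ha]; norm_num
  have n0 : ‖t ^ 3 + a * t + b‖ = ‖4 * a ^ 3 + 27 * b ^ 2‖ := by
    rw [e0e, norm_div]; simp only [norm_mul, norm_neg, h.n2, ha, h.hb]; norm_num
  have hδ : 0 < ‖4 * a ^ 3 + 27 * b ^ 2‖ := norm_pos_iff.2 hδ0
  generalize ‖4 * a ^ 3 + 27 * b ^ 2‖ = δ at *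
  have hσt : σ • t = t := by
    have h3 : σ • (3 : Ω) = 3 := map_ofNat (MulSemiringAction.toRingHom H Ω σ) 3
    have h2' : σ • (2 : Ω) = 2 := map_ofNat (MulSemiringAction.toRingHom H Ω σ) 2
    rw [ht, div_eq_mul_inv, smul_mul', smul_inv'', smul_mul', smul_mul', smul_neg, h3, h2', h.fa, h.fb]
  have e := h.crv.eq P hP0
  have eP : Y P ^ 2 = (X P - t) ^ 3 + 3 * t * (X P - t) ^ 2 + (3 * t ^ 2 + a) * (X P - t)
      + (t ^ 3 + a * t + b) := by rw [e]; ring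
  have e' := h.crv.eq (n • P) hP'0
  have eP' : Y (n • P) ^ 2 = (X (n • P) - t) ^ 3 + 3 * t * (X (n • P) - t) ^ 2
      + (3 * t ^ 2 + a) * (X (n • P) - t) + (t ^ 3 + a * t + b) := by rw [e']; ring
  have hqr : ‖X (n • P) - t‖ = ‖X P - t‖ := by
    rw [← hσ P hP, h.eqv, ← h.isom σ (X P - t), smul_sub, hσt]
  have hYP0 : Y P ≠ 0 := h.crv.dblY P hP0 h2P
  rcases le_or_gt (‖X P - t‖ ^ 2) δ with hle | hlt
  · -- doubling
    refine hred 2 (by rwa [two_smul]) ?_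
    have hd := h.crv.dbl P hP0 h2P
    rw [two_smul]
    have k1 : (X (P + P) - t) * (2 * Y P) ^ 2 = -(2 * 2 * (3 * t) * (t ^ 3 + a * t + b)) +
       ((3 * t ^ 2 + a) ^ 2 + (X P - t) ^ 4 - 2 * (3 * t ^ 2 + a) * (X P - t) ^ 2
        - 2 * 2 * 2 * (t ^ 3 + a * t + b) * (X P - t)) := by
      rw [hd]
      have : (((3 * X P ^ 2 + a) / (2 * Y P)) ^ 2 - 2 * X P - t) * (2 * Y P) ^ 2 =
        (3 * X P ^ 2 + a) ^ 2 - (2 * X P + t) * (4 * Y P ^ 2) := by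
        field_simp; ring
      rw [this, e]; ring
    set q := X P - t
    have hq2 : ‖q ^ 2‖ ≤ δ := by rw [norm_pow]; exact hle
    have hδδ : δ * δ < δ := by nlinarith
    have hn : ‖(X (P + P) - t) * (2 * Y P) ^ 2‖ = δ := by
      rw [k1]
      have hm : ‖-(2 * 2 * (3 * t) * (t ^ 3 + a * t + b))‖ = δ := by
        rw [norm_neg, norm_mul, norm_mul, norm_mul, h.n2, hA, n0]; ring
      rw [add_eq, hm]
      rw [hm]
      refine sub_lt (sub_lt (add_lt ?_ ?_) ?_) ?_
      · rw [norm_pow, n1, sq]; exact hδδ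
      · rw [show q ^ 4 = q ^ 2 * q ^ 2 by ring, norm_mul]
        refine lt_of_le_of_lt ?_ hδδ
        gcongr
      · rw [norm_mul, norm_mul, h.n2, one_mul, n1]
        refine lt_of_le_of_lt ?_ hδδ
        gcongr
      · simp only [norm_mul, h.n2, n0]
        nlinarith
    have hy2 : ‖(2 * Y P) ^ 2‖ ≤ δ := by
      rw [mul_pow, norm_mul, norm_pow, h.n2, one_pow, one_mul, eP]
      refine add_le (add_le (add_le ?_ ?_) ?_) n0.le
      · rw [show q ^ 3 = q * q ^ 2 by ring, norm_mul]
        nlinarith [norm_nonneg (q ^ 2)]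
      · rw [norm_mul, hA, one_mul]; exact hq2
      · rw [norm_mul, n1]; nlinarith
    have hy0 : 0 < ‖(2 * Y P) ^ 2‖ := norm_pos_iff.2 (pow_ne_zero _ (mul_ne_zero h20 hYP0))
    rw [norm_mul] at hn
    nlinarith
  · have key : ∀ (q y : Ω), ‖q‖ = ‖X P - t‖ → y ^ 2 = q ^ 3 + 3 * t * q ^ 2 + (3 * t ^ 2 + a) * q
      + (t ^ 3 + a * t + b) → ‖y ^ 2 - 3 * t * q ^ 2‖ < ‖X P - t‖ ^ 2 := by
      intro q y hq hy
      have : y ^ 2 - 3 * t * q ^ 2 = q ^ 3 + (3 * t ^ 2 + a) * q + (t ^ 3 + a * t + b) := by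
        rw [hy]; ring
      rw [this]
      have hp0 : 0 < ‖X P - t‖ ^ 2 := hδ.trans hlt
      refine add_lt (add_lt ?_ ?_) (n0.trans_lt hlt)
      · rw [norm_pow, hq, pow_succ]; nlinarith
      · rw [norm_mul, hq, n1]; nlinarith [norm_nonneg (X P - t)]
    have k1 := key _ _ rfl eP
    have k2 := key _ _ hqr eP'
    set q := X P - t with hq
    set r := X (n • P) - t with hr
    set y := Y P
    set y' := Y (n • P)
    have hq0 : 0 < ‖q‖ := by
      by_contra hc
      have : ‖q‖ = 0 := le_antisymm (not_lt.1 hc) (norm_nonneg _)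
      rw [this] at hlt; norm_num at hlt; linarith
    have hd : X (n • P) - X P ≠ 0 := sub_ne_zero.2 hne
    have hdqr : X (n • P) - X P = r - q := by rw [hq, hr]; ring
    have hdle : ‖X (n • P) - X P‖ ^ 2 ≤ ‖q‖ ^ 2 := by
      rw [hdqr]
      exact pow_le_pow_left₀ (norm_nonneg _) (sub_le hqr.le le_rfl) 2
    have hd0 : 0 < ‖X (n • P) - X P‖ ^ 2 := by have := norm_pos_iff.2 hd; positivity
    have big : ∀ z Z : Ω, ‖y * r - z * q‖ < ‖q‖ ^ 2 → z ^ 2 = y' ^ 2 →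
        Z = ((y + z) / (X (n • P) - X P)) ^ 2 - X (n • P) - X P → 1 ≤ ‖Z - t‖ := by
      intro z Z hz hz2 hZ
      have h5 := node_alg h.n2 hA n1 n0 hδ1 hδ hx hqr hlt k1 hz
      have h6 : (Z - t) * (X (n • P) - X P) ^ 2 = q * r * (q + r) + (3 * t ^ 2 + a) * (q + r)
          + 2 * (t ^ 3 + a * t + b) + 2 * (3 * t) * q * r + 2 * y * z := by
        have : (Z - t) * (X (n • P) - X P) ^ 2 = (y + z) ^ 2 - (r + q + 3 * t) * (r - q) ^ 2 := by
          rw [hZ, ← hdqr, hq, hr]; field_simp; ring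
        rw [this]
        linear_combination eP + hz2 + eP'
      have h7 := congrArg norm h6
      rw [h5, norm_mul, norm_pow] at h7
      by_contra hc
      push Not at hc
      nlinarith
    have hprod : ‖(y * r - y' * q) * (y * r + y' * q)‖ < ‖q‖ ^ 4 := by
      have : (y * r - y' * q) * (y * r + y' * q) = (y ^ 2 - 3 * t * q ^ 2) * r ^ 2
        - (y' ^ 2 - 3 * t * r ^ 2) * q ^ 2 := by ring
      rw [this, show ‖q‖ ^ 4 = ‖q‖ ^ 2 * ‖q‖ ^ 2 by ring]
      apply sub_lt
      · rw [norm_mul, norm_pow r, hqr]; gcongr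
      · rw [norm_mul, norm_pow q]; gcongr
    by_cases hc : ‖y * r - y' * q‖ < ‖q‖ ^ 2
    · have h5 := h.crv.sub (n • P) P hP'0 hP0 hne
      have h6 := big _ _ hc rfl (h5.trans (by rw [add_comm]))
      rw [subP h.toLoc hP] at h6
      refine hred _ ?_ h6
      rw [← subP h.toLoc hP]
      intro h0
      apply hne
      rw [sub_eq_zero.1 h0]
    · have hc' : ‖y * r - (-y') * q‖ < ‖q‖ ^ 2 := by
        rw [neg_mul, sub_neg_eq_add]
        by_contra hcc
        push Not at hc hcc
        rw [norm_mul] at hprod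
        have : ‖q‖ ^ 2 * ‖q‖ ^ 2 ≤ ‖y * r - y' * q‖ * ‖y * r + y' * q‖ := by gcongr
        nlinarith
      have h5 := h.crv.add (n • P) P hP'0 hP0 hne
      have h6 := big _ _ hc' (neg_sq _) (h5.trans (by
        rw [← neg_sub (Y P), neg_div, neg_sq, ← sub_eq_add_neg]))
      have h7 : n • P + P = (n + 1) • P := by rw [add_smul, one_smul]
      rw [h7] at h6
      refine hred _ ?_ h6
      rw [← h7]
      intro h0
      apply hne
      rw [eq_neg_of_add_eq_zero_left h0, h.crv.negX]

end LocGal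


namespace LocGal
open Ultra
variable {p : ℕ} {Ω : Type*} [NormedField Ω] [IsUltrametricDist Ω] [CharZero Ω] {a b : Ω}
  {G : Type*} [AddCommGroup G] {X Y : G → Ω} {H : Type*} [Group H] [MulSemiringAction H Ω]
    [DistribMulAction H G] {C : Subgroup H}

theorem root_le {e : Ω} (ha : ‖a‖ ≤ 1) (hb : ‖b‖ ≤ 1) (h0 : e ^ 3 + a * e + b = 0) : ‖e‖ ≤ 1 := by
  by_contra hc
  push Not at hc
  have h1 : e ^ 3 = -(a * e + b) := by linear_combination h0
  have h2 : ‖e‖ ^ 3 ≤ ‖e‖ := by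
    rw [← norm_pow, h1, norm_neg]
    refine add_le ?_ (hb.trans hc.le)
    rw [norm_mul]; exact mul_le_of_le_one_left (norm_nonneg _) ha
  nlinarith [mul_pos (sub_pos.2 hc) (by positivity : (0:ℝ) < ‖e‖)]

theorem int_comb {x : Ω} (ha : ‖a‖ ≤ 1) (hb : ‖b‖ ≤ 1) (hx : ‖x‖ ≤ 1) :
    ‖-18 * a * x + 27 * b‖ ≤ 1 ∧ ‖6 * a * x ^ 2 - 9 * b * x + 4 * a ^ 2‖ ≤ 1 := by
  let a' : O Ω := ⟨a, ha⟩
  let b' : O Ω := ⟨b, hb⟩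
  let x' : O Ω := ⟨x, hx⟩
  constructor
  · exact (-18 * a' * x' + 27 * b').2
  · exact (6 * a' * x' ^ 2 - 9 * b' * x' + 4 * a' ^ 2).2

theorem fd_le {x : Ω} (h : Loc p a b X Y) (hx : ‖x‖ ≤ 1) : ‖3 * x ^ 2 + a‖ ≤ 1 :=
  add_le (mul_le_one h.n3.le (by rw [norm_pow]; exact pow_le_one₀ (norm_nonneg _) hx)) h.ha

theorem disc_lt {x : Ω} (ha : ‖a‖ ≤ 1) (hb : ‖b‖ ≤ 1) (hx : ‖x‖ ≤ 1)
    (hf : ‖x ^ 3 + a * x + b‖ < 1) (hf' : ‖3 * x ^ 2 + a‖ < 1) : ‖4 * a ^ 3 + 27 * b ^ 2‖ < 1 := by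
  have e : 4 * a ^ 3 + 27 * b ^ 2 = (-18 * a * x + 27 * b) * (x ^ 3 + a * x + b)
     + (6 * a * x ^ 2 - 9 * b * x + 4 * a ^ 2) * (3 * x ^ 2 + a) := by ring
  rw [e]
  exact add_lt (mul_lt_one (int_comb ha hb hx).1 hf) (mul_lt_one (int_comb ha hb hx).2 hf')

theorem exists_good [IsAlgClosed Ω] (h : Loc p a b X Y)
    (hcase : ‖4 * a ^ 3 + 27 * b ^ 2‖ = 1 ∨ ‖a‖ = 1) :
    ∃ e : Ω, ‖e‖ ≤ 1 ∧ e ^ 3 + a * e + b = 0 ∧ ‖3 * e ^ 2 + a‖ = 1 := by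
  obtain ⟨r, hr⟩ : ∃ r : Ω, r ^ 3 + a * r + b = 0 := by
    obtain ⟨r, hr⟩ := IsAlgClosed.exists_root
      (Polynomial.X ^ 3 + Polynomial.C a * Polynomial.X + Polynomial.C b) (by
        have : (Polynomial.X ^ 3 + Polynomial.C a * Polynomial.X + Polynomial.C b).degree = 3 := by
          compute_degree!
        rw [this]; norm_num)
    exact ⟨r, by simpa [Polynomial.IsRoot] using hr⟩
  rcases hcase with hd | ha
  · have hr1 := root_le h.ha h.hb.le hr
    refine ⟨r, hr1, hr, le_antisymm (fd_le h hr1) (not_lt.1 (fun hc => ?_))⟩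
    exact absurd hd (disc_lt h.ha h.hb.le hr1 (by rw [hr]; simp) hc).ne
  · obtain ⟨s, hs⟩ : ∃ s : Ω, s ^ 2 + r * s + (r ^ 2 + a) = 0 := by
      obtain ⟨s, hs⟩ := IsAlgClosed.exists_root
        (Polynomial.X ^ 2 + Polynomial.C r * Polynomial.X + Polynomial.C (r ^ 2 + a)) (by
          have : (Polynomial.X ^ 2 + Polynomial.C r * Polynomial.X
            + Polynomial.C (r ^ 2 + a)).degree = 2 := by
            compute_degree!
          rw [this]; norm_num)
      exact ⟨s, by simpa [Polynomial.IsRoot] using hs⟩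
    have ha0 : a ≠ 0 := by intro h0; rw [h0] at ha; simp at ha
    have h2 : ‖2 * a‖ = 1 := by rw [norm_mul, h.n2, ha, one_mul]
    set t := -3 * b / (2 * a) with ht
    have ht1 : ‖t‖ = 1 := by
      rw [ht, norm_div, norm_mul, norm_mul, norm_neg, h.n3, h.n2, h.hb, ha]; norm_num
    have key : ∀ e : Ω, e ^ 3 + a * e + b = 0 → 1 ≤ ‖e - t‖ →
        ∃ e : Ω, ‖e‖ ≤ 1 ∧ e ^ 3 + a * e + b = 0 ∧ ‖3 * e ^ 2 + a‖ = 1 := by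
      intro e he het
      have he1 := root_le h.ha h.hb.le he
      refine ⟨e, he1, he, le_antisymm (fd_le h he1) (not_lt.1 (fun hc => ?_))⟩
      have e2 : e - t = -(e * (3 * e ^ 2 + a)) / (2 * a) := by
        rw [ht]; field_simp; linear_combination (3) * he
      rw [e2, norm_div, h2, norm_neg, div_one] at het
      exact absurd het (not_le.2 (mul_lt_one he1 hc))
    by_contra hc
    have k1 := not_le.1 (fun hh => hc (key r hr hh))
    have k2 := not_le.1 (fun hh => hc (key s (by linear_combination hr + (s - r) * hs) hh))
    have k3 := not_le.1 (fun hh => hc (key (-r - s) (by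
      linear_combination hr - (2 * r + s) * hs) hh))
    have : ‖(r - t) + (s - t) + (-r - s - t)‖ < 1 := add_lt (add_lt k1 k2) k3
    rw [show (r - t) + (s - t) + (-r - s - t) = -(3 * t) by ring, norm_neg, norm_mul, h.n3, ht1] at this
    norm_num at this

theorem pm_all (h : Loc p a b X Y) {Q Q' : G} (hQ : Q ∈ h.T) (hQ' : Q' ∈ h.T) {n : ℕ}
    (hn : n • Q ≠ 0) (he : X (n • Q) = X Q) : X (n • Q') = X Q' := by
  obtain ⟨m, hm⟩ : ∃ m : ℕ, True := ⟨0, trivial⟩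
  have dv : ∀ k : ℕ, k • Q = 0 → k • Q' = 0 := by
    intro k hk
    by_contra hc
    exact (h.mem_T.1 (smulT h hQ (ndvd h hQ' hc))).1 hk
  rcases h.crv.inj _ _ hn (h.mem_T.1 hQ).1 he with h1 | h1
  · have h2 := dv (n + (p - 1)) (by rw [← subP h hQ, h1, sub_self])
    rw [← subP h hQ'] at h2
    rw [sub_eq_zero.1 h2]
  · have h2 := dv (n + 1) (by rw [add_smul, one_smul, h1, neg_add_cancel])
    rw [add_smul, one_smul] at h2
    rw [eq_neg_of_add_eq_zero_left h2, h.crv.negX]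

theorem local_false [IsAlgClosed Ω] (h : LocGal p a b X Y C) (hd0 : 4 * a ^ 3 + 27 * b ^ 2 ≠ 0)
    (hcase : (‖4 * a ^ 3 + 27 * b ^ 2‖ = 1 ∧ ‖a‖ < 1 ∧ (p : ℝ)⁻¹ ^ 2 ≤ ‖a‖ ^ 3) ∨
      (‖a‖ = 1 ∧ ‖4 * a ^ 3 + 27 * b ^ 2‖ < 1)) : False := by
  classical
  have hp37 := h.hp37
  have hp1 : (1 : ℝ) < p := by exact_mod_cast h.hp.one_lt
  obtain ⟨e, he, he0, he1⟩ := exists_good h.toLoc (hcase.imp (fun x => x.1) (fun x => x.1))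
  have hprod := h.prod_max he he0 he1
  obtain ⟨P₀, hP₀, hP₀1⟩ : ∃ P ∈ h.T, 1 < ‖X P‖ := by
    by_contra hc
    push Not at hc
    rw [Finset.prod_congr rfl (fun P hP => max_eq_right (hc P hP)), Finset.prod_const_one] at hprod
    nlinarith
  by_cases hB : ∃ Q ∈ h.T, ‖X Q‖ ≤ 1
  · obtain ⟨Q, hQ, hQ1⟩ := hB
    have hS : ∀ r ∈ Set.Ioi (1 : ℝ), 1 < r := fun r hr => hr
    have hS2 : ∀ r ∈ Set.Ioi (1 : ℝ), ∀ s, r ≤ s → s ∈ Set.Ioi (1 : ℝ) :=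
      fun r hr s hs => lt_of_lt_of_le hr hs
    have sc := h.stab (Set.Ioi 1) hS hS2 hP₀ hP₀1 hQ (not_lt.2 hQ1)
    have cn := card_nearT h.toLoc (Set.Ioi 1) hS hS2 hP₀ hP₀1 hQ (not_lt.2 hQ1)
    refine h.sign_line hprod ?_ ?_
    · have hset : (nearT h.toLoc (Set.Ioi 1) hS hS2 : Set G) =
          (insert 0 (h.T.filter (fun P => 1 < ‖X P‖)) : Finset G) := by
        ext P
        simp only [SetLike.mem_coe, Finset.coe_insert, Set.mem_insert_iff, Finset.mem_filter]
        constructor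
        · intro hP
          by_cases h0 : P = 0
          · exact Or.inl h0
          · have hT := nearT_T h.toLoc _ hS hS2 hP h0
            exact Or.inr ⟨hT, (mem_nearT h.toLoc _ hS hS2 hT).1 hP⟩
        · rintro (rfl | ⟨hT, h1⟩)
          · exact zero_mem _
          · exact (mem_nearT h.toLoc _ hS hS2 hT).2 h1
      have h3 : Nat.card (nearT h.toLoc (Set.Ioi 1) hS hS2 : Set G) = p := cn
      rw [hset, Nat.card_coe_set_eq, Set.ncard_coe_finset, Finset.card_insert_of_notMem] at h3
      · omega
      · intro hc
        rw [Finset.mem_filter] at hc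
        exact (h.mem_T.1 hc.1).1 rfl
    · intro σ hσ Q' hQ'
      obtain ⟨n, hn⟩ := sc σ hσ
      have hnT : ∀ Q ∈ h.T, σ • Q = n • Q := fun Q hQ => hn Q (h.mem_T.1 hQ).2
      rw [hnT Q' hQ']
      refine pm_all h.toLoc hQ hQ' ?_ ?_
      · rw [← hnT Q hQ]; exact (h.mem_T.1 (h.sT σ hQ)).1
      · by_cases hsm : ‖Y Q‖ = 1 ∨ ‖3 * X Q ^ 2 + a‖ = 1
        · exact h.smooth hQ hQ1 hsm (hnT Q hQ)
        · push Not at hsm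
          have hy := (Yle h.toLoc hQ hQ1).lt_of_ne hsm.1
          have hf := (fd_le h.toLoc hQ1).lt_of_ne hsm.2
          rcases hcase with hc | hc
          · exfalso
            refine absurd hc.1 (disc_lt h.ha h.hb.le hQ1 ?_ hf).ne
            rw [← h.crv.eq Q (h.mem_T.1 hQ).1, sq]
            exact mul_lt_one hy.le hy
          · exact h.node hc.1 hc.2 hd0 hQ hQ1 hy hf hnT
  · push Not at hB
    rcases hcase with hc | hc
    · by_cases hall : ∀ P ∈ h.T, ‖X P‖ = ‖X P₀‖
      · exact h.equal_case hc.1 hc.2.1 hc.2.2 hP₀1 hall hprod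
      · push Not at hall
        obtain ⟨P₁, hP₁, hne⟩ := hall
        have main : ∀ P ∈ h.T, ∀ Q ∈ h.T, ‖X Q‖ < ‖X P‖ → False := by
          intro P hP Q hQ hlt
          exact h.scal_all hprod hB (h.stab (Set.Ici ‖X P‖) (fun r hr => (hB P hP).trans_le hr)
            (fun r hr s hs => le_trans hr hs) hP Set.self_mem_Ici hQ (not_le.2 hlt))
        rcases lt_or_gt_of_ne hne with hl | hl
        · exact main P₀ hP₀ P₁ hP₁ hl
        · exact main P₁ hP₁ P₀ hP₀ hl
    · have ha0 : a ≠ 0 := by intro h0; have := hc.1; rw [h0] at this; simp at this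
      set t := -3 * b / (2 * a) with ht
      have ht1 : ‖t‖ = 1 := by
        rw [ht, norm_div, norm_mul, norm_mul, norm_neg, h.n3, h.n2, h.hb, hc.1]; norm_num
      have e1e : 3 * t ^ 2 + a = (4 * a ^ 3 + 27 * b ^ 2) / (2 * 2 * a * a) := by
        rw [ht]; field_simp; ring
      have e0e : t ^ 3 + a * t + b = - b * (4 * a ^ 3 + 27 * b ^ 2) / (2 * 2 * 2 * a * a * a) := by
        rw [ht]; field_simp; ring
      have n1 : ‖3 * t ^ 2 + a‖ = ‖4 * a ^ 3 + 27 * b ^ 2‖ := by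
        rw [e1e, norm_div]; simp only [norm_mul, h.n2, hc.1]; norm_num
      have n0 : ‖t ^ 3 + a * t + b‖ = ‖4 * a ^ 3 + 27 * b ^ 2‖ := by
        rw [e0e, norm_div]; simp only [norm_mul, norm_neg, h.n2, hc.1, h.hb]; norm_num
      have h1 := psi_node h.ha h.hb.le ht1.le (n0.trans_lt hc.2) (n1.trans_lt hc.2) p (by omega)
      have h2 := h.psi_eval t
      have h3 : ∏ P ∈ h.T, ‖t - X P‖ = (p : ℝ) ^ 2 := by
        rw [← hprod]
        refine Finset.prod_congr rfl (fun P hP => ?_)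
        rw [norm_sub_rev, sub_eq (ht1.trans_lt (hB P hP)), max_eq_left (hB P hP).le]
      rw [h3, ← mul_pow, inv_mul_cancel₀ h.hp0.ne', one_pow] at h2
      nlinarith [norm_nonneg (((sW a b).preΨ' p).eval t)]

end LocGal


namespace ResExt

open Polynomial IntermediateField

variable {K Ω : Type*} [Field K] [NormedField Ω] [IsUltrametricDist Ω] [Algebra K Ω]

/-- value group condition -/
def Gam (p : ℕ) (W : IntermediateField K Ω) : Prop :=
  ∀ w ∈ W, w ≠ 0 → ∃ k : ℤ, ‖w‖ ^ 6 = (p : ℝ) ^ k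

/-- normalised polynomials -/
def Nrm {W : IntermediateField K Ω} (g : Polynomial W) : Prop :=
  (∀ i, ‖((g.coeff i : W) : Ω)‖ ≤ 1) ∧ ∃ i, ‖((g.coeff i : W) : Ω)‖ = 1

theorem exists_nrm {W : IntermediateField K Ω} (q : Polynomial W) (hq : q ≠ 0) :
    ∃ c : W, c ≠ 0 ∧ Nrm (C c * q) := by
  obtain ⟨i, hi, hmax⟩ := Finset.exists_max_image q.support (fun i => ‖((q.coeff i : W) : Ω)‖)
    (Polynomial.support_nonempty.2 hq)
  have hi0 : q.coeff i ≠ 0 := Polynomial.mem_support_iff.1 hi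
  have hn : (0 : ℝ) < ‖((q.coeff i : W) : Ω)‖ := by
    rw [norm_pos_iff]; simpa using hi0
  refine ⟨(q.coeff i)⁻¹, inv_ne_zero hi0, fun j => ?_, i, ?_⟩
  · rw [Polynomial.coeff_C_mul]
    push_cast
    rw [norm_mul, norm_inv, inv_mul_le_iff₀ hn, mul_one]
    by_cases hj : j ∈ q.support
    · exact hmax j hj
    · rw [Polynomial.notMem_support_iff.1 hj]; simp
  · rw [Polynomial.coeff_C_mul]
    push_cast
    rw [norm_mul, norm_inv, inv_mul_cancel₀ hn.ne']

theorem aeval_le {W : IntermediateField K Ω} (g : Polynomial W)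
    (hg : ∀ i, ‖((g.coeff i : W) : Ω)‖ ≤ 1) (z : Ω) (hz : ‖z‖ ≤ 1) : ‖aeval z g‖ ≤ 1 := by
  rw [aeval_eq_sum_range]
  refine IsUltrametricDist.norm_sum_le_of_forall_le_of_nonneg zero_le_one (fun i _ => ?_)
  rw [Algebra.smul_def, norm_mul, norm_pow]
  exact mul_le_one₀ (hg i) (by positivity) (pow_le_one₀ (norm_nonneg _) hz)

theorem pow_sub_lt (θ z : Ω) (hz : ‖z‖ ≤ 1) (hd : ‖θ - z‖ < 1) (i : ℕ) : ‖θ ^ i - z ^ i‖ < 1 := by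
  have hθ : ‖θ‖ ≤ 1 := by
    have : θ = (θ - z) + z := by ring
    rw [this]
    exact (IsUltrametricDist.norm_add_le_max _ _).trans (max_le hd.le hz)
  have := (Commute.all θ z).mul_geom_sum₂ i
  rw [← this, norm_mul]
  have h2 : ‖∑ j ∈ Finset.range i, θ ^ j * z ^ (i - 1 - j)‖ ≤ 1 := by
    refine IsUltrametricDist.norm_sum_le_of_forall_le_of_nonneg zero_le_one (fun j _ => ?_)
    rw [norm_mul, norm_pow, norm_pow]
    exact mul_le_one₀ (pow_le_one₀ (norm_nonneg _) hθ) (by positivity)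
      (pow_le_one₀ (norm_nonneg _) hz)
  calc _ ≤ ‖θ - z‖ * 1 := by gcongr
    _ < 1 := by simpa using hd

theorem sum_lt {ι : Type*} (s : Finset ι) (f : ι → Ω) (h : ∀ i ∈ s, ‖f i‖ < 1) :
    ‖∑ i ∈ s, f i‖ < 1 := by
  classical
  induction s using Finset.induction_on with
  | empty => simp
  | insert a s ha ih =>
    rw [Finset.sum_insert ha]
    refine (IsUltrametricDist.norm_add_le_max _ _).trans_lt (max_lt (h a (by simp)) ?_)
    exact ih fun i hi => h i (by simp [hi])

theorem aeval_sub_lt {W : IntermediateField K Ω} (g : Polynomial W)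
    (hg : ∀ i, ‖((g.coeff i : W) : Ω)‖ ≤ 1) (θ z : Ω) (hz : ‖z‖ ≤ 1) (hd : ‖θ - z‖ < 1) :
    ‖aeval θ g - aeval z g‖ < 1 := by
  rw [aeval_eq_sum_range, aeval_eq_sum_range, ← Finset.sum_sub_distrib]
  refine sum_lt _ _ (fun i _ => ?_)
  rw [← smul_sub, Algebra.smul_def, norm_mul]
  calc _ ≤ 1 * ‖θ ^ i - z ^ i‖ := by gcongr; exact hg i
    _ < 1 := by simpa using pow_sub_lt θ z hz hd i

theorem exists_root [IsAlgClosed Ω] {W : IntermediateField K Ω} [Algebra.IsAlgebraic W Ω]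
    (z : Ω) (hz : ‖z‖ ≤ 1) : ∃ (g : Polynomial W) (θ : Ω), g.Monic ∧ aeval θ g = 0 ∧ ‖θ - z‖ < 1 ∧
      ∀ q : Polynomial W, q.natDegree < g.natDegree → Nrm q → ‖aeval z q‖ = 1 := by
  classical
  let S : Set ℕ := {d | ∃ g : Polynomial W, Nrm g ∧ ‖aeval z g‖ < 1 ∧ g.natDegree = d}
  have hS : S.Nonempty := by
    have hIntg := Algebra.IsIntegral.isIntegral (R := W) z
    obtain ⟨c, hc, hn⟩ := exists_nrm (minpoly W z) (minpoly.ne_zero hIntg)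
    exact ⟨_, _, hn, by simp, rfl⟩
  obtain ⟨g, hg, hgz, hgd⟩ := Nat.sInf_mem hS
  have hmin : ∀ q : Polynomial W, q.natDegree < g.natDegree → Nrm q → ‖aeval z q‖ = 1 := by
    intro q hq hn
    refine le_antisymm (aeval_le q hn.1 z hz) ?_
    by_contra hlt
    push Not at hlt
    exact absurd (Nat.sInf_le (show q.natDegree ∈ S from ⟨q, hn, hlt, rfl⟩)) (by omega)
  have hlc : ‖((g.leadingCoeff : W) : Ω)‖ = 1 := by
    by_contra hne
    have hlt : ‖((g.leadingCoeff : W) : Ω)‖ < 1 := lt_of_le_of_ne (hg.1 _) hne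
    have hcoef : ∀ i, i ≠ g.natDegree → g.eraseLead.coeff i = g.coeff i := fun i hi =>
      Polynomial.eraseLead_coeff_of_ne i hi
    obtain ⟨i0, hi0⟩ := hg.2
    have hi0' : i0 ≠ g.natDegree := by rintro rfl; exact hne hi0
    have hne0 : g.eraseLead ≠ 0 := by
      intro h0
      have := hcoef i0 hi0'
      rw [h0] at this
      rw [← this] at hi0
      simp at hi0
    have hn : Nrm g.eraseLead := by
      refine ⟨fun i => ?_, i0, by rw [hcoef i0 hi0', hi0]⟩
      by_cases hi : i = g.natDegree
      · rw [hi, Polynomial.eraseLead_coeff_natDegree]; simp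
      · rw [hcoef i hi]; exact hg.1 i
    have h1 := hmin g.eraseLead ((Polynomial.eraseLead_natDegree_lt_or_eraseLead_eq_zero g).resolve_right hne0) hn
    have h2 : aeval z g.eraseLead = aeval z g - (g.leadingCoeff : Ω) * z ^ g.natDegree := by
      have := congrArg (aeval z) g.eraseLead_add_C_mul_X_pow
      rw [map_add, map_mul, map_pow, aeval_C, aeval_X] at this
      rw [← this]; simp [IntermediateField.algebraMap_apply]
    rw [h2] at h1
    have h3 : ‖aeval z g - (g.leadingCoeff : Ω) * z ^ g.natDegree‖ < 1 := by
      refine Ultra.sub_lt hgz ?_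
      rw [norm_mul, norm_pow]
      calc _ ≤ ‖((g.leadingCoeff : W) : Ω)‖ * 1 := by gcongr; exact pow_le_one₀ (norm_nonneg _) hz
        _ < 1 := by simpa using hlt
    linarith
  have hl0 : g.leadingCoeff ≠ 0 := by
    intro h; rw [h] at hlc; simp at hlc
  set g1 := C g.leadingCoeff⁻¹ * g with hg1
  have hmon : g1.Monic := by
    rw [hg1, mul_comm]; exact Polynomial.monic_mul_leadingCoeff_inv (by rintro rfl; simp at hl0)
  have hdeg : g1.natDegree = g.natDegree := Polynomial.natDegree_C_mul (inv_ne_zero hl0)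
  have hz1 : ‖aeval z g1‖ < 1 := by
    rw [hg1, map_mul, aeval_C, norm_mul]
    have : ‖algebraMap W Ω g.leadingCoeff⁻¹‖ = 1 := by
      rw [map_inv₀, norm_inv]
      simp [IntermediateField.algebraMap_apply, hlc]
    rw [this, one_mul]; exact hgz
  have hspl : (g1.map (algebraMap W Ω)).Splits := IsAlgClosed.splits _
  have hprod := hspl.eq_prod_roots_of_monic (hmon.map _)
  have : ∃ θ ∈ (g1.map (algebraMap W Ω)).roots, ‖θ - z‖ < 1 := by
    by_contra hall
    push Not at hall
    have h4 : aeval z g1 = ((g1.map (algebraMap W Ω)).roots.map (fun θ => z - θ)).prod := by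
      rw [← eval_map_algebraMap]
      conv_lhs => rw [hprod]
      rw [Polynomial.eval_multiset_prod, Multiset.map_map]
      simp
    have h5 : ∀ s : Multiset Ω, (∀ θ ∈ s, 1 ≤ ‖θ - z‖) → 1 ≤ ‖(s.map (fun θ => z - θ)).prod‖ := by
      intro s
      induction s using Multiset.induction_on with
      | empty => simp
      | cons a s ih =>
        intro h
        rw [Multiset.map_cons, Multiset.prod_cons, norm_mul, norm_sub_rev]
        have h6 := h a (by simp)
        have h7 := ih (fun θ hθ => h θ (by simp [hθ]))
        nlinarith
    have := h5 _ hall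
    rw [← h4] at this
    linarith
  obtain ⟨θ, hθ, hθz⟩ := this
  refine ⟨g1, θ, hmon, ?_, hθz, fun q hq => hmin q (hdeg ▸ hq)⟩
  have := (Polynomial.mem_roots'.1 hθ).2
  rwa [IsRoot, eval_map_algebraMap] at this

theorem gam_adjoin (p : ℕ) {W : IntermediateField K Ω} (hW : Gam p W)
    (g : Polynomial W) (θ z : Ω) (hm : g.Monic) (h0 : aeval θ g = 0) (hz : ‖z‖ ≤ 1)
    (hd : ‖θ - z‖ < 1)
    (hq : ∀ q : Polynomial W, q.natDegree < g.natDegree → Nrm q → ‖aeval z q‖ = 1) :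
    Gam p ((W⟮θ⟯).restrictScalars K) := by
  intro w hw hw0
  rw [IntermediateField.mem_restrictScalars] at hw
  have hIntg : IsIntegral W θ := ⟨g, hm, h0⟩
  rw [← IntermediateField.mem_toSubalgebra,
    IntermediateField.adjoin_simple_toSubalgebra_of_isAlgebraic hIntg.isAlgebraic,
    Algebra.adjoin_singleton_eq_range_aeval] at hw
  obtain ⟨q0, rfl⟩ := hw
  set q := q0 %ₘ g with hqd
  have hqθ : aeval θ q0 = aeval θ q := by
    have := congrArg (aeval θ) (Polynomial.modByMonic_add_div q0 g)
    rw [map_add, map_mul, h0, zero_mul, add_zero] at this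
    exact this.symm
  change aeval θ q0 ≠ 0 at hw0
  change ∃ k : ℤ, ‖aeval θ q0‖ ^ 6 = _
  rw [hqθ] at hw0 ⊢
  have hqne : q ≠ 0 := by intro h; rw [h] at hw0; simp at hw0
  have hg1 : g ≠ 1 := by rintro rfl; simp at h0
  have hdeg : q.natDegree < g.natDegree := Polynomial.natDegree_modByMonic_lt q0 hm hg1
  obtain ⟨c, hc, hn⟩ := exists_nrm q hqne
  have h1 := hq (C c * q) (by rwa [Polynomial.natDegree_C_mul hc]) hn
  have h2 := aeval_sub_lt (C c * q) hn.1 θ z hz hd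
  have h3 : ‖aeval θ (C c * q)‖ = 1 := by
    have h4 : aeval θ (C c * q) = (aeval θ (C c * q) - aeval z (C c * q)) + aeval z (C c * q) := by
      ring
    rw [h4, IsUltrametricDist.norm_add_eq_max_of_norm_ne_norm (by rw [h1]; exact h2.ne), h1]
    exact max_eq_right h2.le
  rw [map_mul, aeval_C, norm_mul] at h3
  obtain ⟨k, hk⟩ := hW (c : Ω) c.2 (by simpa using hc)
  refine ⟨-k, ?_⟩
  have hc' : ‖algebraMap W Ω c‖ = ‖(c : Ω)‖ := rfl
  rw [hc'] at h3
  rw [_root_.zpow_neg, ← hk, ← inv_pow, eq_inv_of_mul_eq_one_right h3]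

end ResExt


namespace ResExt

open Polynomial IntermediateField

variable {p : ℕ} [Fact p.Prime]

theorem pnorm_minpoly (x : PadicAlgCl p) (hx : x ≠ 0) :
    ∃ k : ℤ, ‖x‖ ^ (minpoly ℚ_[p] x).natDegree = (p : ℝ) ^ k := by
  have hIntg : IsIntegral ℚ_[p] x := Algebra.IsIntegral.isIntegral x
  have h := spectralNorm.spectralNorm_eq_norm_coeff_zero_rpow (K := ℚ_[p]) (L := PadicAlgCl p) x
  rw [PadicAlgCl.spectralNorm_eq] at h
  have hd : (minpoly ℚ_[p] x).natDegree ≠ 0 := (minpoly.natDegree_pos hIntg).ne'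
  rw [h, one_div, Real.rpow_inv_natCast_pow (norm_nonneg _) hd]
  have hc : (minpoly ℚ_[p] x).coeff 0 ≠ 0 := by
    rw [Ne, minpoly.coeff_zero_eq_zero hIntg]; exact hx
  refine ⟨-((minpoly ℚ_[p] x).coeff 0).valuation, ?_⟩
  rw [Padic.norm_eq_zpow_neg_valuation hc]

theorem norm_p : ‖(p : PadicAlgCl p)‖ = (p : ℝ)⁻¹ := by
  have := PadicAlgCl.norm_extends p (p : ℚ_[p])
  rw [Padic.norm_p] at this
  rw [← this]; simp

theorem base (π : PadicAlgCl p) (hπ : π ^ 6 = (p : PadicAlgCl p)) : Gam p (ℚ_[p]⟮π⟯) := by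
  have hp1 : (1 : ℝ) < p := by exact_mod_cast (Fact.out : p.Prime).one_lt
  have hp0 : (p : PadicAlgCl p) ≠ 0 := by exact_mod_cast (Fact.out : p.Prime).ne_zero
  have hπ0 : π ≠ 0 := by rintro rfl; simp at hπ; exact hp0 hπ.symm
  have hIntg : IsIntegral ℚ_[p] π := Algebra.IsIntegral.isIntegral π
  have hn : ‖π‖ ^ 6 = (p : ℝ)⁻¹ := by rw [← norm_pow, hπ, norm_p]
  set d := (minpoly ℚ_[p] π).natDegree with hd
  have hd0 : 0 < d := minpoly.natDegree_pos hIntg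
  have hd6 : d ≤ 6 := by
    have h1 : (X ^ 6 - C (p : ℚ_[p])).natDegree = 6 := natDegree_X_pow_sub_C
    have h2 : minpoly ℚ_[p] π ∣ (X ^ 6 - C (p : ℚ_[p])) := by
      apply minpoly.dvd; simp [hπ]
    rw [← h1]
    exact Polynomial.natDegree_le_of_dvd h2 (X_pow_sub_C_ne_zero (by norm_num) _)
  obtain ⟨k, hk⟩ := pnorm_minpoly π hπ0
  have hkd : 6 * k = -(d : ℤ) := by
    apply zpow_right_injective₀ (by positivity) hp1.ne'
    change (p : ℝ) ^ (6 * k) = (p : ℝ) ^ (-(d : ℤ))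
    rw [mul_comm, _root_.zpow_mul, ← hk, _root_.zpow_neg, zpow_natCast, ← inv_pow, ← hn]
    norm_cast
    rw [← pow_mul, ← pow_mul, mul_comm]
  have hd6' : d = 6 := by omega
  intro w hw hw0
  obtain ⟨m, hm⟩ := pnorm_minpoly w hw0
  have : FiniteDimensional ℚ_[p] ℚ_[p]⟮π⟯ := IntermediateField.adjoin.finiteDimensional hIntg
  have hdv := minpoly.degree_dvd (K := ℚ_[p]) (L := ℚ_[p]⟮π⟯) (x := ⟨w, hw⟩)
    (Algebra.IsIntegral.isIntegral _)
  rw [IntermediateField.adjoin.finrank hIntg, ← hd, hd6', IntermediateField.minpoly_eq] at hdv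
  obtain ⟨r, hr⟩ := hdv
  refine ⟨m * r, ?_⟩
  rw [hr, pow_mul, _root_.zpow_mul, ← hm]; norm_cast

theorem exists_max (π : PadicAlgCl p) (hπ : π ^ 6 = (p : PadicAlgCl p)) :
    ∃ W : IntermediateField ℚ_[p] (PadicAlgCl p), π ∈ W ∧
      Maximal (fun W => Gam p W) W := by
  obtain ⟨W, h1, h2⟩ := zorn_le_nonempty₀ {W : IntermediateField ℚ_[p] (PadicAlgCl p) | Gam p W}
    (by
      intro c hc hch y hy
      have : Nonempty c := ⟨⟨y, hy⟩⟩
      have hdir : Directed (· ≤ ·) (fun i : c => (i : IntermediateField ℚ_[p] (PadicAlgCl p))) :=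
        hch.directedOn.directed_val
      refine ⟨⨆ i : c, (i : IntermediateField ℚ_[p] (PadicAlgCl p)), ?_, fun z hz =>
        le_iSup (fun i : c => (i : IntermediateField ℚ_[p] (PadicAlgCl p))) ⟨z, hz⟩⟩
      intro w hw hw0
      rw [← SetLike.mem_coe, coe_iSup_of_directed hdir, Set.mem_iUnion] at hw
      obtain ⟨i, hi⟩ := hw
      exact hc i.2 w hi hw0) (ℚ_[p]⟮π⟯) (base π hπ)
  exact ⟨W, h1 (mem_adjoin_simple_self _ _), h2⟩

theorem res {W : IntermediateField ℚ_[p] (PadicAlgCl p)} (hW : Maximal (fun W => Gam p W) W)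
    (z : PadicAlgCl p) (hz : ‖z‖ ≤ 1) : ∃ w ∈ W, ‖w - z‖ < 1 := by
  have : Algebra.IsAlgebraic W (PadicAlgCl p) := Algebra.IsAlgebraic.tower_top (K := ℚ_[p]) W
  obtain ⟨g, θ, hm, h0, hd, hq⟩ := exists_root (W := W) z hz
  have hG := gam_adjoin p hW.1 g θ z hm h0 hz hd hq
  have hle : W ≤ (W⟮θ⟯).restrictScalars ℚ_[p] := by
    intro x hx
    rw [IntermediateField.mem_restrictScalars]
    exact (W⟮θ⟯).algebraMap_mem ⟨x, hx⟩
  refine ⟨θ, hW.2 hG hle ?_, hd⟩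
  rw [IntermediateField.mem_restrictScalars]
  exact mem_adjoin_simple_self _ _

theorem isom {W : IntermediateField ℚ_[p] (PadicAlgCl p)}
    (σ : PadicAlgCl p ≃ₐ[W] PadicAlgCl p) (z : PadicAlgCl p) : ‖σ z‖ = ‖z‖ :=
  (spectralNorm_eq_of_equiv (K := ℚ_[p]) (σ.restrictScalars ℚ_[p]) z).symm

theorem res' {W : IntermediateField ℚ_[p] (PadicAlgCl p)} (hW : Maximal (fun W => Gam p W) W)
    (σ : PadicAlgCl p ≃ₐ[W] PadicAlgCl p) (z : PadicAlgCl p) (hz : ‖z‖ ≤ 1) : ‖σ z - z‖ < 1 := by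
  obtain ⟨w, hw, hwz⟩ := res hW z hz
  have h1 : σ w = w := σ.commutes ⟨w, hw⟩
  have : σ z - z = (w - z) - σ (w - z) := by rw [map_sub, h1]; ring
  rw [this]
  exact Ultra.sub_lt hwz (by rwa [isom])

theorem fix {W : IntermediateField ℚ_[p] (PadicAlgCl p)} (hW : Maximal (fun W => Gam p W) W)
    (z : PadicAlgCl p) (hz : z ≠ 0) (h : ∀ σ : PadicAlgCl p ≃ₐ[W] PadicAlgCl p, σ z = z) :
    ∃ k : ℤ, ‖z‖ ^ 6 = (p : ℝ) ^ k := by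
  have : Algebra.IsAlgebraic W (PadicAlgCl p) := Algebra.IsAlgebraic.tower_top (K := ℚ_[p]) W
  have : Normal W (PadicAlgCl p) := normal_iff.2 fun x =>
    ⟨Algebra.IsIntegral.isIntegral x, IsAlgClosed.splits _⟩
  have : IsGalois W (PadicAlgCl p) := { }
  obtain ⟨w, rfl⟩ := (InfiniteGalois.mem_range_algebraMap_iff_fixed (k := W) z).2 h
  exact hW.1 _ w.2 hz

end ResExt


namespace CnsM

variable {p : ℕ} [Fact p.Prime]

theorem eps_nonres (h2 : p ≠ 2) (x : ZMod p) : x ^ 2 ≠ nsEps p := by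
  have hne : {n : ℕ | 0 < n ∧ ¬∃ x : ZMod p, x ^ 2 = (n : ZMod p)}.Nonempty := by
    obtain ⟨a, ha⟩ := FiniteField.exists_nonsquare (F := ZMod p) (by rwa [ZMod.ringChar_zmod_n])
    refine ⟨a.val, Nat.pos_of_ne_zero fun h => ?_, ?_⟩
    · rw [ZMod.val_eq_zero] at h
      exact ha (h ▸ IsSquare.zero)
    · rintro ⟨x, hx⟩
      rw [ZMod.natCast_zmod_val] at hx
      exact ha ⟨x, by rw [← hx, sq]⟩
  have := (Nat.sInf_mem hne).2
  intro hx
  exact this ⟨x, hx⟩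

theorem eps_ne (h2 : p ≠ 2) : nsEps p ≠ 0 := fun h => eps_nonres h2 0 (by rw [h]; ring)

/-- the generator -/
noncomputable def J (h2 : p ≠ 2) : GL (Fin 2) (ZMod p) :=
  Matrix.GeneralLinearGroup.mkOfDetNeZero !![0, nsEps p; 1, 0] (by
    rw [Matrix.det_fin_two_of]; simpa using eps_ne h2)

theorem J_coe (h2 : p ≠ 2) :
    (J h2 : Matrix (Fin 2) (Fin 2) (ZMod p)) = !![0, nsEps p; 1, 0] := rfl

theorem two_ne (h2 : p ≠ 2) : (2 : ZMod p) ≠ 0 := by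
  have : Fact (2 < p) := ⟨lt_of_le_of_ne (Fact.out : p.Prime).two_le h2.symm⟩
  exact Ring.two_ne_zero (by rwa [ZMod.ringChar_zmod_n])

theorem dich (h2 : p ≠ 2) (A : GL (Fin 2) (ZMod p)) (hA : A ∈ CnsPlus p) :
    A * J h2 = J h2 * A ∨ A * J h2 = -(J h2 * A) := by
  have hJ : J h2 ∈ Cns p := ⟨0, 1, by rw [J_coe]; simp⟩
  have hN : A * J h2 * A⁻¹ ∈ Cns p := by
    exact (hA (J h2)).1 hJ
  obtain ⟨c, d, hcd⟩ := hN
  have htr : Matrix.trace ((A * J h2 * A⁻¹ : GL (Fin 2) (ZMod p)) : Matrix (Fin 2) (Fin 2) (ZMod p))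
      = 0 := by
    rw [Units.val_mul, Matrix.trace_mul_comm, ← Units.val_mul, ← mul_assoc, inv_mul_cancel,
      one_mul, J_coe, Matrix.trace_fin_two_of]
    simp
  have hdet : Matrix.det ((A * J h2 * A⁻¹ : GL (Fin 2) (ZMod p)) : Matrix (Fin 2) (Fin 2) (ZMod p))
      = - nsEps p := by
    rw [Units.val_mul, Matrix.det_mul_comm, ← Units.val_mul, ← mul_assoc, inv_mul_cancel,
      one_mul, J_coe, Matrix.det_fin_two_of]
    ring
  rw [hcd, Matrix.trace_fin_two_of] at htr
  rw [hcd, Matrix.det_fin_two_of] at hdet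
  have hc : c = 0 := by
    have : 2 * c = 0 := by linear_combination htr
    exact (mul_eq_zero.1 this).resolve_left (two_ne h2)
  have hd : (d - 1) * (d + 1) = 0 := by
    have : nsEps p * ((d - 1) * (d + 1)) = 0 := by rw [hc] at hdet; linear_combination -hdet
    exact (mul_eq_zero.1 this).resolve_left (eps_ne h2)
  rcases mul_eq_zero.1 hd with h | h
  · left
    have : A * J h2 * A⁻¹ = J h2 := by
      apply Units.ext
      rw [hcd, J_coe, hc, show d = 1 by linear_combination h]; simp
    rw [mul_inv_eq_iff_eq_mul] at this
    exact this
  · right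
    have : A * J h2 * A⁻¹ = -J h2 := by
      apply Units.ext
      rw [hcd, Units.val_neg, J_coe, hc, show d = -1 by linear_combination h]
      ext i j; fin_cases i <;> fin_cases j <;> simp
    rw [mul_inv_eq_iff_eq_mul] at this
    rw [this, neg_mul]

theorem c1 (h2 : p ≠ 2) (A B : GL (Fin 2) (ZMod p)) (hA : A ∈ CnsPlus p) (hB : B ∈ CnsPlus p)
    (hA' : A * J h2 ≠ J h2 * A) (hB' : B * J h2 ≠ J h2 * B) :
    (A⁻¹ * B) * J h2 = J h2 * (A⁻¹ * B) := by
  have h1 := (dich h2 A hA).resolve_left hA'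
  have h3 := (dich h2 B hB).resolve_left hB'
  have h4 : J h2 * A⁻¹ = -(A⁻¹ * J h2) := by
    have : A⁻¹ * (A * J h2) * A⁻¹ = A⁻¹ * (-(J h2 * A)) * A⁻¹ := by rw [h1]
    rw [mul_neg, neg_mul] at this
    calc J h2 * A⁻¹ = A⁻¹ * (A * J h2) * A⁻¹ := by group
      _ = _ := by rw [this]; group
  rw [mul_assoc, h3, ← mul_assoc (J h2), h4, mul_neg, neg_mul, mul_assoc]

theorem c2 (h2 : p ≠ 2) (A : GL (Fin 2) (ZMod p)) (hA : A * J h2 = J h2 * A) (n : ZMod p)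
    (v : Fin 2 → ZMod p) (hv : v ≠ 0)
    (h : (A : Matrix (Fin 2) (Fin 2) (ZMod p)) *ᵥ v = n • v) (w : Fin 2 → ZMod p) :
    (A : Matrix (Fin 2) (Fin 2) (ZMod p)) *ᵥ w = n • w := by
  have hm := congrArg (fun M : GL (Fin 2) (ZMod p) => (M : Matrix (Fin 2) (Fin 2) (ZMod p))) hA
  simp only [Units.val_mul, J_coe] at hm
  set M := (A : Matrix (Fin 2) (Fin 2) (ZMod p)) with hM
  have e1 : M 0 1 = nsEps p * M 1 0 := by
    have := congrFun (congrFun hm 0) 0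
    simpa [Matrix.mul_apply, Fin.sum_univ_two] using this
  have e2 : M 1 1 = M 0 0 := by
    have := congrFun (congrFun hm 1) 0
    simpa [Matrix.mul_apply, Fin.sum_univ_two] using this
  have f1 : (M 0 0 - n) * v 0 + nsEps p * M 1 0 * v 1 = 0 := by
    have := congrFun h 0
    simp only [Matrix.mulVec, dotProduct, Fin.sum_univ_two, Pi.smul_apply, smul_eq_mul, e1] at this
    linear_combination this
  have f2 : M 1 0 * v 0 + (M 0 0 - n) * v 1 = 0 := by
    have := congrFun h 1
    simp only [Matrix.mulVec, dotProduct, Fin.sum_univ_two, Pi.smul_apply, smul_eq_mul, e2] at this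
    linear_combination this
  have hd : (M 0 0 - n) ^ 2 = nsEps p * M 1 0 ^ 2 := by
    by_contra hne
    have hne' : (M 0 0 - n) ^ 2 - nsEps p * M 1 0 ^ 2 ≠ 0 := sub_ne_zero.2 hne
    apply hv
    have g0 : ((M 0 0 - n) ^ 2 - nsEps p * M 1 0 ^ 2) * v 0 = 0 := by
      linear_combination (M 0 0 - n) * f1 - nsEps p * M 1 0 * f2
    have g1 : ((M 0 0 - n) ^ 2 - nsEps p * M 1 0 ^ 2) * v 1 = 0 := by
      linear_combination (M 0 0 - n) * f2 - M 1 0 * f1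
    ext i
    fin_cases i
    · exact (mul_eq_zero.1 g0).resolve_left hne'
    · exact (mul_eq_zero.1 g1).resolve_left hne'
  have hz : M 1 0 = 0 := by
    by_contra hz
    apply eps_nonres h2 ((M 0 0 - n) / M 1 0)
    rw [div_pow, hd]; field_simp
  have hx : M 0 0 - n = 0 := by
    rw [hz] at hd
    exact pow_eq_zero_iff (two_ne_zero) |>.1 (by rw [hd]; ring)
  ext i
  fin_cases i
  · simp only [Matrix.mulVec, dotProduct, Fin.sum_univ_two, Pi.smul_apply, smul_eq_mul,
      Fin.zero_eta, e1, hz]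
    linear_combination w 0 * hx
  · simp only [Matrix.mulVec, dotProduct, Fin.sum_univ_two, Pi.smul_apply, smul_eq_mul,
      Fin.mk_one, e2, hz]
    linear_combination w 1 * hx

end CnsM


namespace PtCrd

variable {F : Type*} [Field F]

/-- short Weierstrass x -/
def xs (W : WeierstrassCurve F) : W.toAffine.Point → F
  | .zero => 0
  | .some x _ _ => 36 * x + 3 * W.b₂

/-- short Weierstrass y -/
def ys (W : WeierstrassCurve F) : W.toAffine.Point → F
  | .zero => 0
  | .some x y _ => 108 * (2 * y + W.a₁ * x + W.a₃)

theorem xs_some (W : WeierstrassCurve F) (x y : F) (h) :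
  xs W (Affine.Point.some x y h) = 36 * x + 3 * W.b₂ := rfl
theorem ys_some (W : WeierstrassCurve F) (x y : F) (h) :
  ys W (Affine.Point.some x y h) = 108 * (2 * y + W.a₁ * x + W.a₃) := rfl

theorem wcrv [CharZero F] [DecidableEq F] (W : WeierstrassCurve F) :
    WCrv (-27 * W.c₄) (-54 * W.c₆) (xs W) (ys W) where
  two := two_ne_zero
  eq P hP := by
    rcases P with _ | ⟨x, y, h⟩
    · exact absurd rfl hP
    · have h1 := (W.toAffine.equation_iff x y).1 h.1
      simp only [xs, ys, c₄, c₆, b₂, b₄, b₆]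
      linear_combination (108 ^ 2 * 4) * h1
  negX P := by
    rcases P with _ | ⟨x, y, h⟩
    · rfl
    · rw [Point.neg_some]; rfl
  negY P hP := by
    rcases P with _ | ⟨x, y, h⟩
    · exact absurd rfl hP
    · rw [Point.neg_some]
      simp only [ys, negY]; ring
  add P Q hP hQ hne := by
    rcases P with _ | ⟨x, y, h⟩
    · exact absurd rfl hP
    rcases Q with _ | ⟨x', y', h'⟩
    · exact absurd rfl hQ
    have hx : x ≠ x' := by rintro rfl; exact hne rfl
    rw [Point.add_of_X_ne hx]
    have hx' : x - x' ≠ 0 := sub_ne_zero.2 hx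
    have e : (36 * x + 3 * W.b₂ - (36 * x' + 3 * W.b₂)) = 36 * (x - x') := by ring
    simp only [xs_some, ys_some, addX, slope_of_X_ne hx, e]
    simp only [b₂]
    field_simp
    ring
  dblY P hP hPP h0 := by
    rcases P with _ | ⟨x, y, h⟩
    · exact absurd rfl hP
    apply hPP
    apply Point.add_self_of_Y_eq
    rw [ys_some] at h0
    have := (mul_eq_zero.1 h0).resolve_left (by norm_num)
    rw [negY]; linear_combination this
  dbl P hP hPP := by
    rcases P with _ | ⟨x, y, h⟩
    · exact absurd rfl hP
    have hy : y ≠ W.toAffine.negY x y := fun hy => hPP (Point.add_self_of_Y_eq hy)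
    rw [Point.add_self_of_Y_ne hy]
    have hd : 2 * y + W.a₁ * x + W.a₃ ≠ 0 := by
      intro h; apply hy; rw [negY]; linear_combination h
    have h1 := (W.toAffine.equation_iff x y).1 h.1
    have e : y - W.toAffine.negY x y = 2 * y + W.a₁ * x + W.a₃ := by rw [negY]; ring
    simp only [xs_some, ys_some, addX, slope_of_Y_ne rfl hy, e]
    generalize hη : 2 * y + W.a₁ * x + W.a₃ = η at *
    have hy' : y = (η - W.a₁ * x - W.a₃) / 2 := by rw [← hη]; ring
    simp only [b₂, c₄, b₄]
    subst hy'
    field_simp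
    ring
  inj P Q hP hQ hX := by
    rcases P with _ | ⟨x, y, h⟩
    · exact absurd rfl hP
    rcases Q with _ | ⟨x', y', h'⟩
    · exact absurd rfl hQ
    rw [xs_some, xs_some] at hX
    have hx : x = x' := by
      have : 36 * (x - x') = 0 := by linear_combination hX
      exact sub_eq_zero.1 ((mul_eq_zero.1 this).resolve_left (by norm_num))
    subst hx
    rcases Y_eq_of_X_eq h.1 h'.1 rfl with h2 | h2
    · left; subst h2; rfl
    · right; rw [Point.neg_some]; subst h2; rfl

theorem xs_surj [CharZero F] [IsAlgClosed F] (W : WeierstrassCurve F) [W.IsElliptic] (t : F) :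
    ∃ P, xs W P = t := by
  set x := (t - 3 * W.b₂) / 36 with hx
  obtain ⟨y, hy⟩ : ∃ y, (Polynomial.C 1 * Polynomial.X ^ 2
      + Polynomial.C (W.a₁ * x + W.a₃) * Polynomial.X +
      Polynomial.C (-(x ^ 3 + W.a₂ * x ^ 2 + W.a₄ * x + W.a₆))).IsRoot y := by
    apply IsAlgClosed.exists_root
    rw [Polynomial.degree_quadratic one_ne_zero]
    norm_num
  have he : W.toAffine.Equation x y := by
    rw [equation_iff]
    simp at hy
    linear_combination hy
  refine ⟨.some x y (equation_iff_nonsingular.1 he), ?_⟩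
  rw [xs_some, hx]
  field_simp; ring

theorem wcrv_scale {F Ω G : Type*} [Field F] [Field Ω] [AddCommGroup G] {a b : F} {X Y : G → F}
    (h : WCrv a b X Y) (ι : F →+* Ω) (u : Ω) (hu : u ≠ 0) :
    WCrv (ι a / u ^ 4) (ι b / u ^ 6) (fun P => ι (X P) / u ^ 2) (fun P => ι (Y P) / u ^ 3) where
  two := by
    have := (map_ne_zero ι).2 h.two
    rwa [map_ofNat] at this
  eq P hP := by
    have := congrArg ι (h.eq P hP)
    simp only [map_add, map_pow, map_mul] at this
    field_simp
    linear_combination this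
  negX P := by simp only [h.negX]
  negY P hP := by simp only [h.negY P hP, map_neg, neg_div]
  add P Q hP hQ hne := by
    have hne' : X P ≠ X Q := fun h => hne (by simp only [h])
    have h1 : ι (X P) - ι (X Q) ≠ 0 := by
      rw [← map_sub]; exact (map_ne_zero ι).2 (sub_ne_zero.2 hne')
    have := congrArg ι (h.add P Q hP hQ hne')
    simp only [map_sub, map_pow, map_div₀] at this
    simp only [this, ← sub_div]
    field_simp
  dblY P hP hPP := div_ne_zero ((map_ne_zero ι).2 (h.dblY P hP hPP)) (pow_ne_zero _ hu)
  dbl P hP hPP := by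
    have h1 := (map_ne_zero ι).2 (h.dblY P hP hPP)
    have := congrArg ι (h.dbl P hP hPP)
    simp only [map_sub, map_pow, map_div₀, map_add, map_mul, map_ofNat] at this
    have h2 : (2 : Ω) ≠ 0 := by
      have := (map_ne_zero ι).2 h.two
      rwa [map_ofNat] at this
    simp only [this]
    field_simp
  inj P Q hP hQ hX := by
    apply h.inj P Q hP hQ
    apply ι.injective
    simpa [div_left_inj' (pow_ne_zero 2 hu)] using hX

end PtCrd


namespace Glob

open scoped Classical in
theorem galAct_one (E : WeierstrassCurve ℚ) (P : (E⁄Qbar).Point) : galAct E 1 P = P := by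
  rcases P with _ | ⟨x, y, h⟩
  · rfl
  · rfl

open scoped Classical in
theorem galAct_mul (E : WeierstrassCurve ℚ) (s t : Qbar ≃ₐ[ℚ] Qbar) (P : (E⁄Qbar).Point) :
    galAct E (s * t) P = galAct E s (galAct E t P) := by
  rcases P with _ | ⟨x, y, h⟩
  · rfl
  · rfl

open scoped Classical in
theorem xs_galAct (E : WeierstrassCurve ℚ) (s : Qbar ≃ₐ[ℚ] Qbar) (P : (E⁄Qbar).Point) :
    PtCrd.xs (E⁄Qbar) (galAct E s P) = s (PtCrd.xs (E⁄Qbar) P) := by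
  rcases P with _ | ⟨x, y, h⟩
  · exact (map_zero s).symm
  · change 36 * s x + 3 * (E⁄Qbar).b₂ = s (36 * x + 3 * (E⁄Qbar).b₂)
    have : s (E⁄Qbar).b₂ = (E⁄Qbar).b₂ := by
      have h1 : (E⁄Qbar).b₂ = algebraMap ℚ Qbar E.b₂ := WeierstrassCurve.map_b₂ ..
      rw [h1, s.commutes]
    rw [map_add, map_mul, map_mul, this, map_ofNat, map_ofNat]

theorem normal_Qbar : Normal ℚ Qbar := by
  have h : ∀ (k : Type) [Field k], Normal k (AlgebraicClosure k) := fun k _ =>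
    IsAlgClosure.normal k (AlgebraicClosure k)
  have h2 := h ℚ
  convert h2
  exact Subsingleton.elim _ _

theorem exists_res {K Ω : Type*} [Field K] [Field Ω] [CharZero Ω] [Algebra K Ω]
    (ι : Qbar →+* Ω) :
    ∃ r : (Ω ≃ₐ[K] Ω) →* (Qbar ≃ₐ[ℚ] Qbar), ∀ σ x, ι (r σ x) = σ (ι x) := by
  letI : Algebra Qbar Ω := ι.toAlgebra
  have : IsScalarTower ℚ Qbar Ω := IsScalarTower.of_algebraMap_eq (fun q => by simp)
  let r0 : (Ω ≃ₐ[K] Ω) →* (Ω ≃ₐ[ℚ] Ω) :=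
    { toFun := fun σ => AlgEquiv.ofRingEquiv (f := σ.toRingEquiv) (fun q => by simp)
      map_one' := by ext; rfl
      map_mul' := fun σ τ => by ext; rfl }
  have : Normal ℚ Qbar := normal_Qbar
  refine ⟨(AlgEquiv.restrictNormalHom Qbar).comp r0, fun σ x => ?_⟩
  exact AlgEquiv.restrictNormal_commutes (r0 σ) Qbar x

open scoped Classical in
/-- the action -/
@[reducible] noncomputable def act {H : Type*} [Group H] (E : WeierstrassCurve ℚ)
    (r : H →* (Qbar ≃ₐ[ℚ] Qbar)) : DistribMulAction H (E⁄Qbar).Point where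
  smul σ P := galAct E (r σ) P
  one_smul P := by
    change galAct E (r 1) P = P
    rw [map_one, galAct_one]
  mul_smul σ τ P := by
    change galAct E (r (σ * τ)) P = galAct E (r σ) (galAct E (r τ) P)
    rw [map_mul, galAct_mul]
  smul_zero σ := map_zero (galAct E (r σ))
  smul_add σ P Q := map_add (galAct E (r σ)) P Q

open scoped Classical in
theorem card_tors (E : WeierstrassCurve ℚ) (p : ℕ) [Fact p.Prime]
    (e : pTorsion E p ≃+ (Fin 2 → ZMod p)) :
    Nat.card {P : (E⁄Qbar).Point // p • P = 0} = p ^ 2 := by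
  have h1 : Nat.card {P : (E⁄Qbar).Point // p • P = 0} = Nat.card (pTorsion E p) := rfl
  rw [h1, Nat.card_congr e.toEquiv]
  simp

/-- conjugated representation -/
noncomputable def rr {H : Type*} [Group H] {p : ℕ} (r : H →* (Qbar ≃ₐ[ℚ] Qbar))
    (ρ : (Qbar ≃ₐ[ℚ] Qbar) →* GL (Fin 2) (ZMod p)) (g : GL (Fin 2) (ZMod p)) :
    H →* GL (Fin 2) (ZMod p) :=
  (MulAut.conj g⁻¹).toMonoidHom.comp (ρ.comp r)

theorem rr_apply {H : Type*} [Group H] {p : ℕ} (r : H →* (Qbar ≃ₐ[ℚ] Qbar))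
    (ρ : (Qbar ≃ₐ[ℚ] Qbar) →* GL (Fin 2) (ZMod p)) (g : GL (Fin 2) (ZMod p)) (σ : H) :
    rr r ρ g σ = g⁻¹ * ρ (r σ) * g := by
  simp [rr, MulAut.conj_apply]

theorem rr_mem {H : Type*} [Group H] {p : ℕ} (r : H →* (Qbar ≃ₐ[ℚ] Qbar))
    (ρ : (Qbar ≃ₐ[ℚ] Qbar) →* GL (Fin 2) (ZMod p)) (g : GL (Fin 2) (ZMod p)) 
    (hg : Set.range ρ ⊆ (fun x => g * x * g⁻¹) '' (CnsPlus p : Set (GL (Fin 2) (ZMod p))))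
    (σ : H) : rr r ρ g σ ∈ CnsPlus p := by
  obtain ⟨x, hx, hx'⟩ := hg ⟨r σ, rfl⟩
  rw [rr_apply, ← hx']
  simpa [mul_assoc] using hx

/-- the Cartan subgroup of H -/
noncomputable def CC {H : Type*} [Group H] {p : ℕ} [Fact p.Prime] (h2 : p ≠ 2)
    (R : H →* GL (Fin 2) (ZMod p)) : Subgroup H :=
  (Subgroup.centralizer {CnsM.J h2}).comap R

theorem mem_CC {H : Type*} [Group H] {p : ℕ} [Fact p.Prime] (h2 : p ≠ 2)
    (R : H →* GL (Fin 2) (ZMod p)) (σ : H) :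
    σ ∈ CC h2 R ↔ R σ * CnsM.J h2 = CnsM.J h2 * R σ := by
  rw [CC, Subgroup.mem_comap, Subgroup.mem_centralizer_iff]
  simp [eq_comm]

theorem CC_c1 {H : Type*} [Group H] {p : ℕ} [Fact p.Prime] (h2 : p ≠ 2)
    (R : H →* GL (Fin 2) (ZMod p)) (hR : ∀ σ, R σ ∈ CnsPlus p) (σ τ : H) (hσ : σ ∉ CC h2 R)
    (hτ : τ ∉ CC h2 R) : σ⁻¹ * τ ∈ CC h2 R := by
  rw [mem_CC] at *
  rw [map_mul, map_inv]
  exact CnsM.c1 h2 _ _ (hR σ) (hR τ) hσ hτ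

open scoped Classical in
theorem CC_c2 {H : Type*} [Group H] {p : ℕ} [Fact p.Prime] (h2 : p ≠ 2) (E : WeierstrassCurve ℚ)
    (r : H →* (Qbar ≃ₐ[ℚ] Qbar)) (ρ : (Qbar ≃ₐ[ℚ] Qbar) →* GL (Fin 2) (ZMod p))
    (e : pTorsion E p ≃+ (Fin 2 → ZMod p))
    (he : ∀ (σ : Qbar ≃ₐ[ℚ] Qbar) (P : pTorsion E p) (hP : galAct E σ P.1 ∈ pTorsion E p),
      e ⟨galAct E σ P.1, hP⟩ = Matrix.mulVec (ρ σ : Matrix (Fin 2) (Fin 2) (ZMod p)) (e P))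
    (g : GL (Fin 2) (ZMod p)) (σ : H) (hσ : σ ∈ CC h2 (rr r ρ g)) (P : (E⁄Qbar).Point) (hP : P ≠ 0)
    (hPt : p • P = 0) (n : ℕ) (hn : galAct E (r σ) P = n • P) (Q : (E⁄Qbar).Point)
    (hQ : p • Q = 0) : galAct E (r σ) Q = n • Q := by
  rw [mem_CC, rr_apply] at hσ
  have hst : ∀ P : (E⁄Qbar).Point, p • P = 0 → galAct E (r σ) P ∈ pTorsion E p := by
    intro P hP
    change p • galAct E (r σ) P = 0
    rw [← map_nsmul, hP, map_zero]
  set A : Matrix (Fin 2) (Fin 2) (ZMod p) := (ρ (r σ) : Matrix (Fin 2) (Fin 2) (ZMod p)) with hA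
  have hgg : ∀ v : Fin 2 → ZMod p, (g : Matrix (Fin 2) (Fin 2) (ZMod p)) *ᵥ
      (((g⁻¹ : GL (Fin 2) (ZMod p)) : Matrix (Fin 2) (Fin 2) (ZMod p)) *ᵥ v) = v := by
    intro v
    rw [Matrix.mulVec_mulVec, ← Units.val_mul, mul_inv_cancel, Units.val_one, Matrix.one_mulVec]
  have hgg' : ∀ v : Fin 2 → ZMod p, ((g⁻¹ : GL (Fin 2) (ZMod p)) : Matrix (Fin 2) (Fin 2) (ZMod p))
      *ᵥ ((g : Matrix (Fin 2) (Fin 2) (ZMod p)) *ᵥ v) = v := by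
    intro v
    rw [Matrix.mulVec_mulVec, ← Units.val_mul, inv_mul_cancel, Units.val_one, Matrix.one_mulVec]
  have hP' := he (r σ) ⟨P, hPt⟩ (hst P hPt)
  have e1 : (⟨galAct E (r σ) P, hst P hPt⟩ : pTorsion E p) = n • ⟨P, hPt⟩ := Subtype.ext hn
  simp only [e1, map_nsmul] at hP'
  have hv : e ⟨P, hPt⟩ ≠ 0 := by
    intro h
    rw [map_eq_zero_iff e e.injective] at h
    exact hP (congrArg Subtype.val h)
  set v := e ⟨P, hPt⟩ with hvdef
  have hw : ((g⁻¹ : GL (Fin 2) (ZMod p)) : Matrix (Fin 2) (Fin 2) (ZMod p)) *ᵥ v ≠ 0 := by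
    intro h
    apply hv
    rw [← hgg v, h, Matrix.mulVec_zero]
  have key := CnsM.c2 h2 _ hσ (n : ZMod p) _ hw (by
    rw [Units.val_mul, Units.val_mul, ← Matrix.mulVec_mulVec, hgg, ← Matrix.mulVec_mulVec, ← hP',
      ← Matrix.mulVec_smul, Nat.cast_smul_eq_nsmul])
  have hQ' := he (r σ) ⟨Q, hQ⟩ (hst Q hQ)
  have k2 := key (((g⁻¹ : GL (Fin 2) (ZMod p)) : Matrix (Fin 2) (Fin 2) (ZMod p)) *ᵥ e ⟨Q, hQ⟩)
  rw [Units.val_mul, Units.val_mul, ← Matrix.mulVec_mulVec, hgg, ← Matrix.mulVec_mulVec,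
    ← Matrix.mulVec_smul] at k2
  have k3 := congrArg (fun w => (g : Matrix (Fin 2) (Fin 2) (ZMod p)) *ᵥ w) k2
  simp only [hgg] at k3
  rw [← hA, k3, Nat.cast_smul_eq_nsmul, ← map_nsmul] at hQ'
  exact congrArg Subtype.val (e.injective hQ')

end Glob


namespace Glob

theorem norm_rat {p : ℕ} [Fact p.Prime] (q : ℚ) (hq : q ≠ 0) :
    ‖(q : PadicAlgCl p)‖ = (p : ℝ) ^ (-padicValRat p q) := by
  have h1 := PadicAlgCl.norm_extends p (q : ℚ_[p])
  rw [Padic.eq_padicNorm, padicNorm.eq_zpow_of_nonzero hq] at h1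
  have h2 : (algebraMap ℚ_[p] (PadicAlgCl p)) (q : ℚ_[p]) = (q : PadicAlgCl p) := map_ratCast _ _
  rw [← h2, h1]; push_cast; rfl

theorem norm_nat {p : ℕ} [Fact p.Prime] (m : ℕ) (hm : Nat.Coprime p m) :
    ‖(m : PadicAlgCl p)‖ = 1 := by
  have hp : p.Prime := Fact.out
  have hm0 : m ≠ 0 := by
    rintro rfl; rw [Nat.coprime_zero_right] at hm; exact hp.one_lt.ne' hm
  have h := norm_rat (p := p) (m : ℚ) (by exact_mod_cast hm0)
  have h0 : padicValNat p m = 0 := padicValNat.eq_zero_of_not_dvd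
    (fun hd => (Nat.Prime.coprime_iff_not_dvd hp).1 hm hd)
  rw [padicValRat.of_nat, h0] at h
  simpa using h

theorem cop {p : ℕ} (hp : p.Prime) (h37 : 37 < p) (i j : ℕ) : Nat.Coprime p (2 ^ i * 3 ^ j) := by
  refine Nat.Coprime.mul_right (Nat.Coprime.pow_right _ ?_) (Nat.Coprime.pow_right _ ?_)
  · exact (Nat.coprime_primes hp Nat.prime_two).2 (by omega)
  · exact (Nat.coprime_primes hp Nat.prime_three).2 (by omega)

/-- The numerical part. -/
theorem numerics {p : ℕ} [Fact p.Prime] (h37 : 37 < p) (c4 c6 D j : ℚ) (h4 : c4 ≠ 0) (h6 : c6 ≠ 0)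
    (hD : D ≠ 0) (hrel : 1728 * D = c4 ^ 3 - c6 ^ 2) (hj : j * D = c4 ^ 3)
    (hv0 : padicValRat p j ≠ 0) (hv3 : padicValRat p j < 3) (u : PadicAlgCl p) (hu0 : u ≠ 0)
    (hu : ‖u‖ ^ 6 = ‖(c6 : PadicAlgCl p)‖) (a b : PadicAlgCl p)
    (ha : a = ((-27 * c4 : ℚ) : PadicAlgCl p) / u ^ 4)
    (hb : b = ((-54 * c6 : ℚ) : PadicAlgCl p) / u ^ 6) :
    ‖a‖ ≤ 1 ∧ ‖b‖ = 1 ∧ 4 * a ^ 3 + 27 * b ^ 2 ≠ 0 ∧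
      ((‖4 * a ^ 3 + 27 * b ^ 2‖ = 1 ∧ ‖a‖ < 1 ∧ (p : ℝ)⁻¹ ^ 2 ≤ ‖a‖ ^ 3) ∨
        (‖a‖ = 1 ∧ ‖4 * a ^ 3 + 27 * b ^ 2‖ < 1)) := by
  have hp : p.Prime := Fact.out
  have hp1 : (1 : ℝ) < p := by exact_mod_cast hp.one_lt
  have n27 : ‖(27 : PadicAlgCl p)‖ = 1 := by
    have := norm_nat (p := p) _ (cop hp h37 0 3); norm_num at this; exact this
  have n54 : ‖(54 : PadicAlgCl p)‖ = 1 := by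
    have := norm_nat (p := p) _ (cop hp h37 1 3); norm_num at this; exact this
  have n1728 : ‖(1728 : PadicAlgCl p)‖ = 1 := by
    have := norm_nat (p := p) _ (cop hp h37 6 3); norm_num at this; exact this
  have hj0 : j ≠ 0 := by rintro rfl; rw [zero_mul] at hj; exact pow_ne_zero 3 h4 hj.symm
  have nj := norm_rat (p := p) j hj0
  -- casts
  have hrel' : (c6 : PadicAlgCl p) ^ 2 = c4 ^ 3 - 1728 * D := by
    have := congrArg (fun q : ℚ => (q : PadicAlgCl p)) hrel
    push_cast at this
    linear_combination this
  have hj' : ‖(j : PadicAlgCl p)‖ * ‖(D : PadicAlgCl p)‖ = ‖(c4 : PadicAlgCl p)‖ ^ 3 := by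
    have := congrArg (fun q : ℚ => ‖(q : PadicAlgCl p)‖) hj
    push_cast at this
    rwa [norm_mul, norm_pow] at this
  have c6n : ‖(c6 : PadicAlgCl p) ^ 2‖ = ‖u‖ ^ 12 := by
    rw [norm_pow, ← hu]; ring
  have hup : 0 < ‖u‖ := norm_pos_iff.2 hu0
  have D0 : 0 < ‖(D : PadicAlgCl p)‖ := norm_pos_iff.2 (by exact_mod_cast hD)
  have na : ‖a‖ ^ 3 = ‖(c4 : PadicAlgCl p)‖ ^ 3 / ‖u‖ ^ 12 := by
    rw [ha]; push_cast
    rw [norm_div, norm_mul, norm_neg, n27, norm_pow, one_mul, div_pow]; ring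
  have nb : ‖b‖ = 1 := by
    rw [hb]; push_cast
    rw [norm_div, norm_mul, norm_neg, n54, norm_pow, one_mul, hu]
    exact div_self (norm_ne_zero_iff.2 (by exact_mod_cast h6))
  have hd : 4 * a ^ 3 + 27 * b ^ 2 = -(27 * 54 ^ 2 * 1728 * D) / u ^ 12 := by
    rw [ha, hb]; push_cast
    field_simp
    linear_combination 2916 * hrel'
  have nd : ‖4 * a ^ 3 + 27 * b ^ 2‖ = ‖(D : PadicAlgCl p)‖ / ‖u‖ ^ 12 := by
    rw [hd, norm_div, norm_neg, norm_mul, norm_mul, norm_mul, norm_pow, norm_pow, n27, n54, n1728]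
    simp
  have hd0 : 4 * a ^ 3 + 27 * b ^ 2 ≠ 0 := by
    rw [← norm_pos_iff, nd]; positivity
  rcases lt_or_gt_of_ne hv0 with hv | hv
  · have hj1 : 1 < ‖(j : PadicAlgCl p)‖ := by
      rw [nj]; exact one_lt_zpow₀ hp1 (by omega)
    have hlt : ‖(1728 : PadicAlgCl p) * D‖ < ‖(c4 : PadicAlgCl p) ^ 3‖ := by
      rw [norm_mul, n1728, one_mul, norm_pow, ← hj']
      nlinarith
    have h1 : ‖u‖ ^ 12 = ‖(c4 : PadicAlgCl p)‖ ^ 3 := by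
      rw [← c6n, hrel', Ultra.sub_eq hlt, norm_pow]
    have ha1 : ‖a‖ = 1 := by
      rw [← h1, div_self (by positivity)] at na
      exact (pow_eq_one_iff_of_nonneg (norm_nonneg _) (by norm_num)).1 na
    refine ⟨ha1.le, nb, hd0, Or.inr ⟨ha1, ?_⟩⟩
    rw [nd, div_lt_one (by positivity), h1, ← norm_pow]
    simpa [norm_mul, n1728] using hlt
  · have hj1 : ‖(j : PadicAlgCl p)‖ < 1 := by
      rw [nj]; exact zpow_lt_one_of_neg₀ hp1 (by omega)
    have hlt : ‖(c4 : PadicAlgCl p) ^ 3‖ < ‖(1728 : PadicAlgCl p) * D‖ := by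
      rw [norm_mul, n1728, one_mul, norm_pow, ← hj']
      nlinarith
    have h1 : ‖u‖ ^ 12 = ‖(D : PadicAlgCl p)‖ := by
      rw [← c6n, hrel', norm_sub_rev, Ultra.sub_eq hlt, norm_mul, n1728, one_mul]
    have ha3 : ‖a‖ ^ 3 = ‖(j : PadicAlgCl p)‖ := by
      rw [na, h1, ← hj', mul_div_assoc, div_self D0.ne', mul_one]
    have ha1 : ‖a‖ < 1 := by
      by_contra h
      push Not at h
      have := one_le_pow₀ h (n := 3)
      linarith
    refine ⟨ha1.le, nb, hd0, Or.inl ⟨?_, ha1, ?_⟩⟩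
    · rw [nd, h1, div_self D0.ne']
    · rw [ha3, nj, ← zpow_natCast, ← _root_.zpow_neg_one, ← _root_.zpow_mul]
      exact zpow_le_zpow_right₀ hp1.le (by push_cast; omega)

open scoped Classical in
theorem main (E : WeierstrassCurve ℚ) [E.IsElliptic]
    (hE : E.j ∉ CMjInvariants) (p : ℕ) (hp : p.Prime) (hp37 : 37 < p)
    (ρ : (Qbar ≃ₐ[ℚ] Qbar) →* GL (Fin 2) (ZMod p)) (hρ : IsModPRep E p ρ)
    (himg : ∃ g : GL (Fin 2) (ZMod p),
      Set.range ρ ⊆ (fun x => g * x * g⁻¹) '' (CnsPlus p : Set (GL (Fin 2) (ZMod p))))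
    (hv0 : padicValRat p E.j ≠ 0) (hv3 : padicValRat p E.j < 3) : False := by
  haveI : Fact p.Prime := ⟨hp⟩
  have h2 : p ≠ 2 := by omega
  obtain ⟨e, he⟩ := hρ
  obtain ⟨g, hg⟩ := himg
  have hj0 : E.j ≠ 0 := fun h => hE (by rw [h]; simp [CMjInvariants])
  have hj1 : E.j ≠ 1728 := fun h => hE (by rw [h]; simp [CMjInvariants])
  have hD : E.Δ ≠ 0 := by rw [← E.coe_Δ']; exact E.Δ'.ne_zero
  have hj : E.j * E.Δ = E.c₄ ^ 3 := by
    rw [WeierstrassCurve.j, mul_comm, ← mul_assoc, ← E.coe_Δ', Units.mul_inv, one_mul]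
  have h4 : E.c₄ ≠ 0 := fun h => hj0 (E.j_eq_zero h)
  have h6 : E.c₆ ≠ 0 := by
    intro h
    have h3 := E.c_relation
    rw [h, ← hj] at h3
    apply hj1
    apply mul_right_cancel₀ hD
    linear_combination -h3
  obtain ⟨π, hπ⟩ := IsAlgClosed.exists_pow_nat_eq (p : PadicAlgCl p) (n := 6) (by norm_num)
  obtain ⟨W, hπW, hW⟩ := ResExt.exists_max π hπ
  have hπ0 : π ≠ 0 := by
    rintro rfl
    have : (p : PadicAlgCl p) ≠ 0 := by exact_mod_cast hp.ne_zero
    exact this (by rw [← hπ]; simp)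
  set u : PadicAlgCl p := π ^ (padicValRat p E.c₆) with hu
  have huW : u ∈ W := zpow_mem hπW _
  have hu0 : u ≠ 0 := zpow_ne_zero _ hπ0
  have hun : ‖u‖ ^ 6 = ‖(E.c₆ : PadicAlgCl p)‖ := by
    rw [norm_rat _ h6, hu, norm_zpow, ← zpow_natCast, ← _root_.zpow_mul, mul_comm, _root_.zpow_mul,
      zpow_natCast, ← norm_pow, hπ, ResExt.norm_p, _root_.inv_zpow, _root_.zpow_neg]
  obtain ⟨ha, hb, hd0, hcase⟩ := numerics hp37 E.c₄ E.c₆ E.Δ E.j h4 h6 hD E.c_relation hj hv0 hv3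
    u hu0 hun _ _ rfl rfl
  obtain ⟨ι⟩ : Nonempty (Qbar →+* PadicAlgCl p) := by
    have := normal_Qbar
    exact ⟨(IsAlgClosed.lift (R := ℚ) (S := Qbar) (M := PadicAlgCl p)).toRingHom⟩
  obtain ⟨r, hr⟩ := exists_res (K := W) ι
  letI := act E r
  have hcrv := PtCrd.wcrv_scale (PtCrd.wcrv (E⁄Qbar)) ι u hu0
  have e4 : ι (-27 * (E⁄Qbar).c₄) = ((-27 * E.c₄ : ℚ) : PadicAlgCl p) := by
    have h1 : (E⁄Qbar).c₄ = algebraMap ℚ Qbar E.c₄ := WeierstrassCurve.map_c₄ ..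
    rw [h1, map_mul, map_neg, map_ofNat]; push_cast; simp
  have e6 : ι (-54 * (E⁄Qbar).c₆) = ((-54 * E.c₆ : ℚ) : PadicAlgCl p) := by
    have h1 : (E⁄Qbar).c₆ = algebraMap ℚ Qbar E.c₆ := WeierstrassCurve.map_c₆ ..
    rw [h1, map_mul, map_neg, map_ofNat]; push_cast; simp
  rw [e4, e6] at hcrv
  have hσu : ∀ σ : PadicAlgCl p ≃ₐ[W] PadicAlgCl p, σ u = u := fun σ => σ.commutes ⟨u, huW⟩
  have hLG : LocGal p (((-27 * E.c₄ : ℚ) : PadicAlgCl p) / u ^ 4)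
      (((-54 * E.c₆ : ℚ) : PadicAlgCl p) / u ^ 6)
      (fun P => ι (PtCrd.xs (E⁄Qbar) P) / u ^ 2) (fun P => ι (PtCrd.ys (E⁄Qbar) P) / u ^ 3)
      (H := PadicAlgCl p ≃ₐ[W] PadicAlgCl p) (CC h2 (rr r ρ g)) :=
    { crv := hcrv
      hp := hp
      hp37 := hp37
      np := ResExt.norm_p
      ha := ha
      hb := hb
      card := card_tors E p e
      inf := by
        have hE' : WeierstrassCurve.IsElliptic (E⁄Qbar) :=
          inferInstanceAs (E.map (algebraMap ℚ Qbar)).IsElliptic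
        refine Set.infinite_of_injective_forall_mem (f := fun t : Qbar => ι t / u ^ 2) ?_ ?_
        · intro s t hst
          apply ι.injective
          simpa [div_left_inj' (pow_ne_zero 2 hu0)] using hst
        · intro t
          obtain ⟨P, hP⟩ := PtCrd.xs_surj (E⁄Qbar) t
          exact ⟨P, by simp only [hP]⟩
      isom := fun σ z => ResExt.isom σ z
      res := fun σ z hz => ResExt.res' hW σ z hz
      fix := fun z hz h => ResExt.fix hW z hz h
      eqv := fun σ P => by
        change ι (PtCrd.xs (E⁄Qbar) (galAct E (r σ) P)) / u ^ 2 =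
          σ (ι (PtCrd.xs (E⁄Qbar) P) / u ^ 2)
        rw [xs_galAct, hr, map_div₀, map_pow, hσu]
      fa := fun σ => by
        change σ _ = _
        rw [map_div₀, map_pow, hσu, map_ratCast]
      fb := fun σ => by
        change σ _ = _
        rw [map_div₀, map_pow, hσu, map_ratCast]
      c1 := CC_c1 h2 _ (rr_mem r ρ g hg)
      c2 := fun σ hσ P hP hPt n hn Q hQ => CC_c2 h2 E r ρ e he g σ hσ P hP hPt n hn Q hQ }
  exact hLG.local_false hd0 hcase

end Glob



/-- If `E/ℚ` is a non-CM elliptic curve and `p > 37` is a prime such that the image of `ρ_{E,p}`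
is contained, up to conjugacy, in the normaliser `C_ns⁺(p)` of a non-split Cartan subgroup of
`GL₂(𝔽_p)`, then either `v_p(j(E)) = 0` or `v_p(j(E)) ≥ 3`. -/
theorem padicValRat_j_of_cartan_normalizer (E : WeierstrassCurve ℚ) [E.IsElliptic]
    (hE : E.j ∉ CMjInvariants) (p : ℕ) (hp : p.Prime) (hp37 : 37 < p)
    (ρ : (Qbar ≃ₐ[ℚ] Qbar) →* GL (Fin 2) (ZMod p)) (hρ : IsModPRep E p ρ)
    (himg : ∃ g : GL (Fin 2) (ZMod p),
      Set.range ρ ⊆ (fun x => g * x * g⁻¹) '' (CnsPlus p : Set (GL (Fin 2) (ZMod p)))) :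
    padicValRat p E.j = 0 ∨ 3 ≤ padicValRat p E.j := by
  by_contra h
  push Not at h
  exact Glob.main E hE p hp hp37 ρ hρ himg h.1 h.2
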